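/- arXiv:2011.01091 — 5 statements merged into one kernel-verified Lean document; each statement's English description precedes it below -/
import Mathlib

section
/- Let N ≥ 2, let Ω ⊂ ℝ^N be open and bounded, let t > N and 1 < s < N, and set s* := Ns/(N−s). There exists a constant c = c(s,t,N) > 0 such that for every continuously differentiable u : Ω → ℝ with |u|^t and |∇u|^t integrable over Ω, every k ∈ ℝ, every x₀ ∈ Ω and all radii 0 < ρ < r < dist(x₀, ∂Ω), one has ∫_{A⁺(x₀,k,ρ)} (u−k)^{s*} dx ≤ (c/(r−ρ)^{s*}) · |A⁺(x₀,k,r)|^{(1−s/t)·(s*/s)} · ( ∫_{A⁺(x₀,k,r)} (u−k)^t dx + r^t ∫_{A⁺(x₀,k,r)} |∇u|^t dx )^{s*/t}. -/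
open MeasureTheory Metric Set Bornology

noncomputable def gReg (e y : ℝ) : ℝ := Real.sqrt (max y 0 ^ 2 + e ^ 2) - e

lemma hasDerivAt_maxsq (y : ℝ) : HasDerivAt (fun y : ℝ => max y 0 ^ 2) (2 * max y 0) y := by
  have key : ∀ y : ℝ, y ≠ 0 → HasDerivAt (fun y : ℝ => max y 0 ^ 2) (2 * max y 0) y := by
    intro y hy
    rcases lt_or_gt_of_ne hy with h | h
    · rw [max_eq_right h.le]
      have : (fun y : ℝ => max y 0 ^ 2) =ᶠ[nhds y] fun _ => 0 := by
        filter_upwards [Iio_mem_nhds h] with z hz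
        rw [max_eq_right (le_of_lt hz)]; norm_num
      simpa using (hasDerivAt_const y (0:ℝ)).congr_of_eventuallyEq this
    · rw [max_eq_left h.le]
      have : (fun y : ℝ => max y 0 ^ 2) =ᶠ[nhds y] fun z => z ^ 2 := by
        filter_upwards [Ioi_mem_nhds h] with z hz
        rw [max_eq_left (le_of_lt hz)]
      simpa using (hasDerivAt_pow 2 y).congr_of_eventuallyEq this
  by_cases hy : y = 0
  · subst hy
    exact hasDerivAt_of_hasDerivAt_of_ne key (by fun_prop) (by fun_prop)
  · exact key y hy

noncomputable def gReg' (e y : ℝ) : ℝ := max y 0 / Real.sqrt (max y 0 ^ 2 + e ^ 2)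

lemma gReg_hasDerivAt {e : ℝ} (he : 0 < e) (y : ℝ) : HasDerivAt (gReg e) (gReg' e y) y := by
  have h := (((hasDerivAt_maxsq y).add_const (e ^ 2)).sqrt (by positivity)).sub_const e
  have h2 : 2 * max y 0 / (2 * Real.sqrt (max y 0 ^ 2 + e ^ 2)) = gReg' e y := by
    unfold gReg'
    field_simp
  rw [h2] at h
  exact h

lemma gReg_contDiff {e : ℝ} (he : 0 < e) : ContDiff ℝ 1 (gReg e) := by
  rw [contDiff_one_iff_deriv]
  refine ⟨fun y => (gReg_hasDerivAt he y).differentiableAt, ?_⟩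
  have : deriv (gReg e) = gReg' e := funext fun y => (gReg_hasDerivAt he y).deriv
  rw [this]
  unfold gReg'
  refine Continuous.div (by fun_prop) (by fun_prop) fun y => ?_
  positivity

lemma gReg'_nonneg (e y : ℝ) : 0 ≤ gReg' e y := by unfold gReg'; positivity

lemma gReg'_le_one {e : ℝ} (y : ℝ) : gReg' e y ≤ 1 := by
  unfold gReg'
  apply div_le_one_of_le₀ _ (Real.sqrt_nonneg _)
  apply Real.le_sqrt_of_sq_le
  nlinarith [sq_nonneg e]

lemma gReg'_zero {e y : ℝ} (hy : y ≤ 0) : gReg' e y = 0 := by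
  simp [gReg', max_eq_right hy]

lemma gReg_zero {e y : ℝ} (he : 0 < e) (hy : y ≤ 0) : gReg e y = 0 := by
  simp [gReg, max_eq_right hy, Real.sqrt_sq he.le]

lemma gReg_nonneg {e : ℝ} (y : ℝ) : 0 ≤ gReg e y := by
  unfold gReg
  rw [sub_nonneg]
  apply Real.le_sqrt_of_sq_le
  nlinarith [sq_nonneg (max y 0)]

lemma gReg_le {e : ℝ} (he : 0 < e) (y : ℝ) : gReg e y ≤ max y 0 := by
  unfold gReg
  have : 0 ≤ max y 0 := le_max_right _ _
  rw [sub_le_iff_le_add, Real.sqrt_le_left (by positivity)]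
  nlinarith

lemma gReg_one_ge {y : ℝ} (hy : 1 ≤ y) : 1 / 4 ≤ gReg 1 y := by
  unfold gReg
  have h : 1 ≤ max y 0 := hy.trans (le_max_left _ _)
  have : (5/4 : ℝ) ≤ Real.sqrt (max y 0 ^ 2 + 1 ^ 2) := by
    apply Real.le_sqrt_of_sq_le
    nlinarith
  linarith

lemma gReg_tendsto (y : ℝ) :
    Filter.Tendsto (fun n : ℕ => gReg (1 / ((n : ℝ) + 1)) y) Filter.atTop (nhds (max y 0)) := by
  have h : Continuous fun e : ℝ => gReg e y := by unfold gReg; fun_prop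
  have h2 := (h.tendsto 0).comp (tendsto_one_div_add_atTop_nhds_zero_nat (𝕜 := ℝ))
  have h3 : gReg 0 y = max y 0 := by
    simp [gReg, Real.sqrt_sq (le_max_right y 0)]
  rw [h3] at h2
  exact h2

lemma closedBall_sub_of_lt {N : ℕ} {Ω : Set (EuclideanSpace ℝ (Fin N))}
    {x₀ : EuclideanSpace ℝ (Fin N)} {r : ℝ} (hΩ : IsOpen Ω) (hx : x₀ ∈ Ω) (hr0 : 0 < r)
    (hr : r < infDist x₀ (frontier Ω)) : closedBall x₀ r ⊆ Ω := by
  have hpre : IsPreconnected (closedBall x₀ r) := (convex_closedBall x₀ r).isPreconnected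
  refine hpre.subset_left_of_subset_union hΩ isClosed_closure.isOpen_compl
    (disjoint_compl_right.mono_right (compl_subset_compl.mpr subset_closure)) ?_
    ⟨x₀, mem_closedBall_self hr0.le, hx⟩
  intro y hy
  by_contra hcon
  simp only [mem_union, mem_compl_iff, not_or, not_not] at hcon
  have hy2 : y ∈ frontier Ω := by
    rw [hΩ.frontier_eq]; exact ⟨hcon.2, hcon.1⟩
  have := infDist_le_dist_of_mem (x := x₀) hy2
  rw [mem_closedBall, dist_comm] at hy
  linarith

noncomputable def cutQ {N : ℕ} (x₀ : EuclideanSpace ℝ (Fin N)) (ρ r : ℝ)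
    (x : EuclideanSpace ℝ (Fin N)) : ℝ := (r ^ 2 - ‖x - x₀‖ ^ 2) / (r ^ 2 - ρ ^ 2)

noncomputable def cutW {N : ℕ} (x₀ : EuclideanSpace ℝ (Fin N)) (ρ r : ℝ)
    (u : EuclideanSpace ℝ (Fin N) → ℝ) (k e : ℝ) (x : EuclideanSpace ℝ (Fin N)) : ℝ :=
  gReg 1 (cutQ x₀ ρ r x) * gReg e (u x - k)

lemma cutQ_contDiff {N : ℕ} (x₀ : EuclideanSpace ℝ (Fin N)) (ρ r : ℝ) :
    ContDiff ℝ 1 (cutQ x₀ ρ r) := by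
  unfold cutQ
  exact (contDiff_const.sub ((contDiff_id.sub contDiff_const).norm_sq ℝ)).div_const _

lemma cutQ_fderiv {N : ℕ} {x₀ : EuclideanSpace ℝ (Fin N)} {ρ r : ℝ} (hρ : 0 < ρ) (hr : ρ < r)
    (x : EuclideanSpace ℝ (Fin N)) (hx : ‖x - x₀‖ ≤ r) :
    ‖fderiv ℝ (cutQ x₀ ρ r) x‖ ≤ 2 * (r - ρ)⁻¹ := by
  have h0 : HasFDerivAt (fun x => x - x₀) (ContinuousLinearMap.id ℝ _) x :=
    (hasFDerivAt_id x).sub_const x₀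
  have h1 := (h0.norm_sq.const_sub (r ^ 2)).mul_const ((r ^ 2 - ρ ^ 2)⁻¹)
  have h2 : cutQ x₀ ρ r = fun x => (r ^ 2 - ‖x - x₀‖ ^ 2) * (r ^ 2 - ρ ^ 2)⁻¹ := by
    funext y; simp [cutQ, div_eq_mul_inv]
  have hd : 0 < r ^ 2 - ρ ^ 2 := by nlinarith
  have hrr : 0 < r - ρ := by linarith
  rw [h2, h1.fderiv, norm_smul, norm_neg, ContinuousLinearMap.comp_id,
    ← Nat.cast_smul_eq_nsmul ℝ, norm_smul,
    innerSL_apply_norm, norm_inv, Real.norm_of_nonneg hd.le]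
  rw [Nat.cast_ofNat, Real.norm_of_nonneg zero_le_two, inv_mul_eq_div, div_le_iff₀ hd]
  have : r ^ 2 - ρ ^ 2 = (r - ρ) * (r + ρ) := by ring
  rw [this]
  have : 2 * (r - ρ)⁻¹ * ((r - ρ) * (r + ρ)) = 2 * (r + ρ) := by field_simp
  rw [this]
  linarith

lemma cutQ_nonpos {N : ℕ} {x₀ : EuclideanSpace ℝ (Fin N)} {ρ r : ℝ} (hρ : 0 < ρ) (hr : ρ < r)
    (x : EuclideanSpace ℝ (Fin N)) (hx : r ≤ ‖x - x₀‖) : cutQ x₀ ρ r x ≤ 0 := by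
  unfold cutQ
  apply div_nonpos_of_nonpos_of_nonneg <;> nlinarith

lemma cutQ_le {N : ℕ} {x₀ : EuclideanSpace ℝ (Fin N)} {ρ r : ℝ} (hρ : 0 < ρ) (hr : ρ < r)
    (x : EuclideanSpace ℝ (Fin N)) : cutQ x₀ ρ r x ≤ (r - ρ)⁻¹ * r := by
  unfold cutQ
  have hrr : 0 < r - ρ := by linarith
  rw [inv_mul_eq_div, div_le_div_iff₀ (by nlinarith) hrr]
  nlinarith [mul_nonneg (sq_nonneg ‖x - x₀‖) hrr.le, mul_pos (mul_pos hρ hrr) (hρ.trans hr)]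

lemma cutQ_ge {N : ℕ} {x₀ : EuclideanSpace ℝ (Fin N)} {ρ r : ℝ} (hρ : 0 < ρ) (hr : ρ < r)
    (x : EuclideanSpace ℝ (Fin N)) (hx : ‖x - x₀‖ ≤ ρ) : 1 ≤ cutQ x₀ ρ r x := by
  unfold cutQ
  rw [one_le_div (by nlinarith)]
  nlinarith [norm_nonneg (x - x₀)]

lemma cutW_zero {N : ℕ} {x₀ : EuclideanSpace ℝ (Fin N)} {ρ r : ℝ} (hρ : 0 < ρ) (hr : ρ < r)
    (u : EuclideanSpace ℝ (Fin N) → ℝ) (k e : ℝ) (x : EuclideanSpace ℝ (Fin N))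
    (hx : r ≤ ‖x - x₀‖) : cutW x₀ ρ r u k e x = 0 := by
  unfold cutW
  rw [gReg_zero one_pos (cutQ_nonpos hρ hr x hx), zero_mul]

lemma cutW_eventually {N : ℕ} {x₀ : EuclideanSpace ℝ (Fin N)} {ρ r : ℝ} (hρ : 0 < ρ) (hr : ρ < r)
    (u : EuclideanSpace ℝ (Fin N) → ℝ) (k e : ℝ) (x : EuclideanSpace ℝ (Fin N))
    (hx : x ∉ closedBall x₀ r) : cutW x₀ ρ r u k e =ᶠ[nhds x] fun _ => 0 := by
  filter_upwards [isClosed_closedBall.isOpen_compl.mem_nhds hx] with y hy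
  apply cutW_zero hρ hr
  simp only [mem_compl_iff, mem_closedBall, dist_eq_norm, not_le] at hy
  exact hy.le

lemma cutW_contDiff {N : ℕ} {Ω : Set (EuclideanSpace ℝ (Fin N))}
    {x₀ : EuclideanSpace ℝ (Fin N)} {ρ r : ℝ} (hρ : 0 < ρ) (hr : ρ < r) (hΩ : IsOpen Ω)
    (hsub : closedBall x₀ r ⊆ Ω)
    (u : EuclideanSpace ℝ (Fin N) → ℝ) (hu : ContDiffOn ℝ 1 u Ω) (k : ℝ) {e : ℝ} (he : 0 < e) :
    ContDiff ℝ 1 (cutW x₀ ρ r u k e) := by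
  rw [contDiff_iff_contDiffAt]
  intro x
  by_cases hx : x ∈ closedBall x₀ r
  · have hux : ContDiffAt ℝ 1 u x := hu.contDiffAt (hΩ.mem_nhds (hsub hx))
    unfold cutW
    exact ((gReg_contDiff one_pos).contDiffAt.comp x (cutQ_contDiff x₀ ρ r).contDiffAt).mul
      ((gReg_contDiff he).contDiffAt.comp x (hux.sub contDiffAt_const))
  · exact contDiffAt_const.congr_of_eventuallyEq (cutW_eventually hρ hr u k e x hx)

lemma cutW_compact {N : ℕ} {x₀ : EuclideanSpace ℝ (Fin N)} {ρ r : ℝ} (hρ : 0 < ρ) (hr : ρ < r)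
    (u : EuclideanSpace ℝ (Fin N) → ℝ) (k e : ℝ) : HasCompactSupport (cutW x₀ ρ r u k e) := by
  refine HasCompactSupport.intro (isCompact_closedBall x₀ r) fun x hx => ?_
  exact (cutW_eventually hρ hr u k e x hx).eq_of_nhds

lemma cutW_fderiv {N : ℕ} {Ω : Set (EuclideanSpace ℝ (Fin N))}
    {x₀ : EuclideanSpace ℝ (Fin N)} {ρ r : ℝ} (hρ : 0 < ρ) (hr : ρ < r) (hΩ : IsOpen Ω)
    (hsub : closedBall x₀ r ⊆ Ω)
    (u : EuclideanSpace ℝ (Fin N) → ℝ) (hu : ContDiffOn ℝ 1 u Ω) (k : ℝ) {e : ℝ} (he : 0 < e)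
    (x : EuclideanSpace ℝ (Fin N)) :
    ‖fderiv ℝ (cutW x₀ ρ r u k e) x‖ ≤ {x ∈ ball x₀ r | k < u x}.indicator
      (fun x => (r - ρ)⁻¹ * (2 * (u x - k) + r * ‖gradient u x‖)) x := by
  have hrr : 0 < r - ρ := by linarith
  by_cases hx : x ∈ closedBall x₀ r
  swap
  · rw [(cutW_eventually hρ hr u k e x hx).fderiv_eq, indicator_of_notMem]
    · simp
    · exact fun h => hx (ball_subset_closedBall h.1)
  have hux : DifferentiableAt ℝ u x :=
    (hu.contDiffAt (hΩ.mem_nhds (hsub hx))).differentiableAt one_ne_zero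
  have hq : DifferentiableAt ℝ (cutQ x₀ ρ r) x :=
    (cutQ_contDiff x₀ ρ r).differentiable one_ne_zero x
  have h1 := (gReg_hasDerivAt one_pos (cutQ x₀ ρ r x)).comp_hasFDerivAt x hq.hasFDerivAt
  have h2 := (gReg_hasDerivAt he (u x - k)).comp_hasFDerivAt x (hux.hasFDerivAt.sub_const k)
  have h3 : fderiv ℝ (cutW x₀ ρ r u k e) x = _ := (h1.mul h2).fderiv
  rw [h3]
  have hg : ‖gradient u x‖ = ‖fderiv ℝ u x‖ := by
    simp [gradient]
  simp only [Function.comp]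
  by_cases hA : x ∈ {x ∈ ball x₀ r | k < u x}
  · rw [indicator_of_mem hA, hg]
    have hk : 0 < u x - k := sub_pos.mpr hA.2
    have hxr : ‖x - x₀‖ ≤ r := by simpa [dist_eq_norm] using hx
    have a1 : gReg 1 (cutQ x₀ ρ r x) ≤ (r - ρ)⁻¹ * r :=
      (gReg_le one_pos _).trans (max_le (cutQ_le hρ hr x) (by
        have := hρ.trans hr
        positivity))
    have a2 : gReg e (u x - k) ≤ u x - k := by
      simpa [max_eq_left hk.le] using gReg_le he (u x - k)
    have b1 : ‖gReg' e (u x - k) • fderiv ℝ u x‖ ≤ ‖fderiv ℝ u x‖ := by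
      rw [norm_smul, Real.norm_of_nonneg (gReg'_nonneg _ _)]
      exact mul_le_of_le_one_left (norm_nonneg _) (gReg'_le_one _)
    have b2 : ‖gReg' 1 (cutQ x₀ ρ r x) • fderiv ℝ (cutQ x₀ ρ r) x‖ ≤ 2 * (r - ρ)⁻¹ := by
      rw [norm_smul, Real.norm_of_nonneg (gReg'_nonneg _ _)]
      exact (mul_le_of_le_one_left (norm_nonneg _) (gReg'_le_one _)).trans
        (cutQ_fderiv hρ hr x hxr)
    refine (norm_add_le _ _).trans ?_
    rw [norm_smul (gReg 1 _), norm_smul (gReg e _), Real.norm_of_nonneg (gReg_nonneg _),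
      Real.norm_of_nonneg (gReg_nonneg _)]
    calc _ ≤ (r - ρ)⁻¹ * r * ‖fderiv ℝ u x‖ + (u x - k) * (2 * (r - ρ)⁻¹) := by
          have := hρ.trans hr
          gcongr
      _ = _ := by ring
  · rw [indicator_of_notMem hA]
    by_cases hk : k < u x
    · have hxr : r ≤ ‖x - x₀‖ := by
        by_contra hc
        exact hA ⟨by simpa [dist_eq_norm] using hc, hk⟩
      have := cutQ_nonpos hρ hr x hxr
      simp [gReg'_zero this, gReg_zero one_pos this]
    · have : u x - k ≤ 0 := by linarith
      simp [gReg'_zero this, gReg_zero he this]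

lemma rpow_combine {r t I J : ℝ} (hr : 0 < r) (ht : 0 < t) (hI : 0 ≤ I) (hJ : 0 ≤ J) :
    2 * I ^ t⁻¹ + r * J ^ t⁻¹ ≤ 3 * (I + r ^ t * J) ^ t⁻¹ := by
  have hrt : 0 < r ^ t := by positivity
  have hti : 0 ≤ t⁻¹ := by positivity
  have h1 : I ^ t⁻¹ ≤ (I + r ^ t * J) ^ t⁻¹ :=
    Real.rpow_le_rpow hI (by nlinarith [mul_nonneg hrt.le hJ]) hti
  have h2 : r * J ^ t⁻¹ ≤ (I + r ^ t * J) ^ t⁻¹ := by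
    have : r * J ^ t⁻¹ = (r ^ t * J) ^ t⁻¹ := by
      rw [Real.mul_rpow hrt.le hJ, Real.rpow_rpow_inv hr.le ht.ne']
    rw [this]
    exact Real.rpow_le_rpow (by positivity) (by linarith) hti
  linarith

lemma sobolev_step (N : ℕ) (hN : 2 ≤ N) (t s sstar : ℝ)
    (ht : (N : ℝ) < t) (hs1 : 1 < s) (hsN : s < (N : ℝ))
    (hsstar : sstar = N * s / (N - s)) :
    ∃ C : NNReal, ∀ (Ω : Set (EuclideanSpace ℝ (Fin N))), IsOpen Ω →
      ∀ u : EuclideanSpace ℝ (Fin N) → ℝ, ContDiffOn ℝ 1 u Ω →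
        ∀ (k : ℝ) (x₀ : EuclideanSpace ℝ (Fin N)) (ρ r e : ℝ),
          0 < ρ → ρ < r → closedBall x₀ r ⊆ Ω → 0 < e →
          eLpNorm (cutW x₀ ρ r u k e) (ENNReal.ofReal sstar) volume ≤ ENNReal.ofReal (
            C * (3 * (r - ρ)⁻¹ * (volume {x ∈ ball x₀ r | k < u x}).toReal ^ (1 / s - 1 / t) *
              ((∫ x in {x ∈ ball x₀ r | k < u x}, (u x - k) ^ t) +
                r ^ t * ∫ x in {x ∈ ball x₀ r | k < u x}, ‖gradient u x‖ ^ t) ^ t⁻¹)) := by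
  have hs0 : 0 < s := by linarith
  have hN0 : (0:ℝ) < N := by linarith
  have ht0 : 0 < t := by linarith
  have hNs : 0 < (N:ℝ) - s := by linarith
  have hss0 : 0 < sstar := by rw [hsstar]; positivity
  refine ⟨SNormLESNormFDerivOfEqConst ℝ (volume : Measure (EuclideanSpace ℝ (Fin N)))
    s.toNNReal, ?_⟩
  intro Ω hΩ u hu k x₀ ρ r e hρ hr hsub he
  set C := SNormLESNormFDerivOfEqConst ℝ (volume : Measure (EuclideanSpace ℝ (Fin N))) s.toNNReal
  have hrr : 0 < r - ρ := by linarith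
  have hr0 : 0 < r := by linarith
  have hsob : eLpNorm (cutW x₀ ρ r u k e) (ENNReal.ofReal sstar) volume ≤
      C * eLpNorm (fderiv ℝ (cutW x₀ ρ r u k e)) (ENNReal.ofReal s) volume := by
    refine eLpNorm_le_eLpNorm_fderiv_of_eq volume (cutW_contDiff hρ hr hΩ hsub u hu k he)
      (cutW_compact hρ hr u k e) (p := s.toNNReal) (p' := sstar.toNNReal) ?_ ?_ ?_
    · rw [← NNReal.coe_le_coe, Real.coe_toNNReal _ hs0.le]; exact hs1.le
    · simp; omega
    · rw [NNReal.coe_inv, Real.coe_toNNReal _ hs0.le, Real.coe_toNNReal _ hss0.le, hsstar,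
        finrank_euclideanSpace_fin]
      field_simp
  set A := {x ∈ ball x₀ r | k < u x} with hAdef
  have hbΩ : ball x₀ r ⊆ Ω := ball_subset_closedBall.trans hsub
  have hAo : IsOpen A := by
    have := (hu.continuousOn.mono hbΩ).isOpen_inter_preimage isOpen_ball (isOpen_Ioi (a := k))
    exact this
  have hAm : MeasurableSet A := hAo.measurableSet
  have hAc : A ⊆ closedBall x₀ r := fun x hx => ball_subset_closedBall hx.1
  have hAfin : volume A ≠ ⊤ :=
    ((measure_mono hAc).trans_lt measure_closedBall_lt_top).ne
  have : IsFiniteMeasure (volume.restrict A) := ⟨by simpa using hAfin.lt_top⟩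
  have hvc : ContinuousOn (fun x => u x - k) (closedBall x₀ r) :=
    (hu.continuousOn.mono hsub).sub continuousOn_const
  have hgc : ContinuousOn (fun x => ‖gradient u x‖) (closedBall x₀ r) := by
    have hg : (fun x => ‖gradient u x‖) = fun x => ‖fderiv ℝ u x‖ := by
      funext x; simp [gradient]
    rw [hg]
    exact ((hu.continuousOn_fderiv_of_isOpen hΩ le_rfl).mono hsub).norm
  have hmem : ∀ f : EuclideanSpace ℝ (Fin N) → ℝ, ContinuousOn f (closedBall x₀ r) →
      MemLp f (ENNReal.ofReal t) (volume.restrict A) := by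
    intro f hf
    obtain ⟨M, hM⟩ := (isCompact_closedBall x₀ r).exists_bound_of_continuousOn hf
    refine MemLp.of_bound ((hf.mono hAc).aestronglyMeasurable hAm) M ?_
    filter_upwards [ae_restrict_mem hAm] with x hx using hM x (hAc hx)
  have hvL := hmem _ hvc
  have hgL := hmem _ hgc
  have htE0 : ENNReal.ofReal t ≠ 0 := by simpa using ht0
  have hvN := hvL.eLpNorm_eq_integral_rpow_norm htE0 ENNReal.ofReal_ne_top
  have hgN := hgL.eLpNorm_eq_integral_rpow_norm htE0 ENNReal.ofReal_ne_top
  rw [ENNReal.toReal_ofReal ht0.le] at hvN hgN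
  have hvI : ∫ x in A, ‖u x - k‖ ^ t = ∫ x in A, (u x - k) ^ t := by
    refine setIntegral_congr_fun hAm fun x hx => ?_
    have : 0 ≤ u x - k := (sub_pos.mpr hx.2).le
    simp only [Real.norm_of_nonneg this]
  rw [hvI] at hvN
  simp only [norm_norm] at hgN
  set I := ∫ x in A, (u x - k) ^ t with hI
  set J := ∫ x in A, ‖gradient u x‖ ^ t with hJ
  have hI0 : 0 ≤ I := by
    rw [← hvI]; exact integral_nonneg fun x => by positivity
  have hJ0 : 0 ≤ J := integral_nonneg fun x => by positivity
  set F : EuclideanSpace ℝ (Fin N) → ℝ :=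
    (r - ρ)⁻¹ • ((2:ℝ) • (fun x => u x - k) + r • fun x => ‖gradient u x‖) with hF
  have hFm : AEStronglyMeasurable F (volume.restrict A) :=
    ((hvL.1.const_smul _).add (hgL.1.const_smul _)).const_smul _
  have hF1 : eLpNorm (fderiv ℝ (cutW x₀ ρ r u k e)) (ENNReal.ofReal s) volume ≤
      eLpNorm F (ENNReal.ofReal s) (volume.restrict A) := by
    rw [← eLpNorm_indicator_eq_eLpNorm_restrict hAm]
    exact eLpNorm_mono_real fun x => cutW_fderiv hρ hr hΩ hsub u hu k he x
  have hF2 : eLpNorm F (ENNReal.ofReal s) (volume.restrict A) ≤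
      eLpNorm F (ENNReal.ofReal t) (volume.restrict A) * (volume A) ^ (1 / s - 1 / t) := by
    have := eLpNorm_le_eLpNorm_mul_rpow_measure_univ
      (ENNReal.ofReal_le_ofReal (hsN.trans ht).le) hFm
    rwa [ENNReal.toReal_ofReal ht0.le, ENNReal.toReal_ofReal hs0.le,
      Measure.restrict_apply_univ] at this
  have hF3 : eLpNorm F (ENNReal.ofReal t) (volume.restrict A) ≤
      ENNReal.ofReal ((r - ρ)⁻¹ * (2 * I ^ t⁻¹ + r * J ^ t⁻¹)) := by
    refine eLpNorm_const_smul_le.trans ?_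
    rw [ENNReal.ofReal_mul (by positivity), Real.enorm_of_nonneg (by positivity)]
    gcongr
    refine (eLpNorm_add_le (hvL.1.const_smul _) (hgL.1.const_smul _) ?_).trans ?_
    · rw [ENNReal.one_le_ofReal]; linarith
    rw [ENNReal.ofReal_add (by positivity) (by positivity), ENNReal.ofReal_mul (by positivity),
      ENNReal.ofReal_mul hr0.le, ← hvN, ← hgN]
    refine add_le_add (eLpNorm_const_smul_le.trans ?_) (eLpNorm_const_smul_le.trans ?_)
    · rw [Real.enorm_of_nonneg (by positivity)]
    · rw [Real.enorm_of_nonneg hr0.le]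
  have hexp : 0 ≤ 1 / s - 1 / t := by
    rw [sub_nonneg]; exact one_div_le_one_div_of_le hs0 (by linarith)
  have hV : (volume A) ^ (1 / s - 1 / t) =
      ENNReal.ofReal ((volume A).toReal ^ (1 / s - 1 / t)) := by
    rw [← ENNReal.ofReal_rpow_of_nonneg ENNReal.toReal_nonneg hexp, ENNReal.ofReal_toReal hAfin]
  calc _ ≤ _ := hsob
    _ ≤ C * (ENNReal.ofReal ((r - ρ)⁻¹ * (2 * I ^ t⁻¹ + r * J ^ t⁻¹)) *
        ENNReal.ofReal ((volume A).toReal ^ (1 / s - 1 / t))) := by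
      gcongr
      refine hF1.trans (hF2.trans ?_)
      rw [hV]
      gcongr
    _ = ENNReal.ofReal (C * (((r - ρ)⁻¹ * (2 * I ^ t⁻¹ + r * J ^ t⁻¹)) *
        ((volume A).toReal ^ (1 / s - 1 / t)))) := by
      rw [ENNReal.ofReal_mul (NNReal.coe_nonneg C), ENNReal.ofReal_coe_nnreal,
        ENNReal.ofReal_mul (p := (r - ρ)⁻¹ * (2 * I ^ t⁻¹ + r * J ^ t⁻¹)) (by positivity)]
    _ ≤ _ := by
      apply ENNReal.ofReal_le_ofReal
      have := rpow_combine hr0 ht0 hI0 hJ0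
      apply mul_le_mul_of_nonneg_left _ (NNReal.coe_nonneg C)
      calc _ ≤ ((r - ρ)⁻¹ * (3 * (I + r ^ t * J) ^ t⁻¹)) *
        ((volume A).toReal ^ (1 / s - 1 / t)) := by gcongr
        _ = _ := by ring

/-- De Giorgi type level estimate (Lemma 2.1): for `u ∈ W^{1,t}`, `t > N`, `1 < s < N`,
`s* = Ns/(N-s)`, the integral of `(u-k)^{s*}` over the superlevel set in the smaller ball
is controlled by the level data on the larger ball. -/
theorem stmt0 (N : ℕ) (hN : 2 ≤ N) (t s sstar : ℝ)
    (ht : (N : ℝ) < t) (hs1 : 1 < s) (hsN : s < (N : ℝ))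
    (hsstar : sstar = N * s / (N - s)) :
    ∃ c > (0 : ℝ), ∀ (Ω : Set (EuclideanSpace ℝ (Fin N))),
      IsOpen Ω → IsBounded Ω →
      ∀ u : EuclideanSpace ℝ (Fin N) → ℝ,
        ContDiffOn ℝ 1 u Ω →
        IntegrableOn (fun x => |u x| ^ t) Ω →
        IntegrableOn (fun x => ‖gradient u x‖ ^ t) Ω →
        ∀ (k : ℝ) (x₀ : EuclideanSpace ℝ (Fin N)) (ρ r : ℝ),
          x₀ ∈ Ω → 0 < ρ → ρ < r → r < infDist x₀ (frontier Ω) →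
          ∫ x in {x ∈ ball x₀ ρ | k < u x}, (u x - k) ^ sstar ≤
            c / (r - ρ) ^ sstar *
              (volume {x ∈ ball x₀ r | k < u x}).toReal ^ ((1 - s / t) * (sstar / s)) *
              ((∫ x in {x ∈ ball x₀ r | k < u x}, (u x - k) ^ t) +
                r ^ t * ∫ x in {x ∈ ball x₀ r | k < u x}, ‖gradient u x‖ ^ t) ^ (sstar / t) := by
  have hs0 : 0 < s := by linarith
  have hN0 : (0:ℝ) < N := by linarith
  have ht0 : 0 < t := by linarith
  have hNs : 0 < (N:ℝ) - s := by linarith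
  have hss0 : 0 < sstar := by rw [hsstar]; positivity
  obtain ⟨C, hC⟩ := sobolev_step N hN t s sstar ht hs1 hsN hsstar
  refine ⟨(12 * ((C:ℝ) + 1)) ^ sstar, by positivity, ?_⟩
  intro Ω hΩ _ u hu _ _ k x₀ ρ r hx₀ hρ hr hrd
  have hrr : 0 < r - ρ := by linarith
  have hr0 : 0 < r := by linarith
  have hsub := closedBall_sub_of_lt hΩ hx₀ hr0 hrd
  have hC' := fun n : ℕ => hC Ω hΩ u hu k x₀ ρ r (1 / ((n : ℝ) + 1)) hρ hr hsub (by positivity)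
  set S := (∫ x in {x ∈ ball x₀ r | k < u x}, (u x - k) ^ t) +
                r ^ t * ∫ x in {x ∈ ball x₀ r | k < u x}, ‖gradient u x‖ ^ t with hS
  set V := (volume {x ∈ ball x₀ r | k < u x}).toReal with hV
  have hV0 : 0 ≤ V := ENNReal.toReal_nonneg
  set A := {x ∈ ball x₀ ρ | k < u x} with hAdef
  have hAc : A ⊆ closedBall x₀ r :=
    fun x hx => closedBall_subset_closedBall hr.le (ball_subset_closedBall hx.1)
  have hAo : IsOpen A := by
    have hbΩ : ball x₀ ρ ⊆ Ω :=
      ball_subset_closedBall.trans ((closedBall_subset_closedBall hr.le).trans hsub)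
    have := (hu.continuousOn.mono hbΩ).isOpen_inter_preimage isOpen_ball (isOpen_Ioi (a := k))
    exact this
  have hAm : MeasurableSet A := hAo.measurableSet
  have hAfin : volume A ≠ ⊤ :=
    ((measure_mono hAc).trans_lt measure_closedBall_lt_top).ne
  have : IsFiniteMeasure (volume.restrict A) := ⟨by simpa using hAfin.lt_top⟩
  have hS0 : 0 ≤ S := by
    refine add_nonneg (setIntegral_nonneg_of_ae_restrict ?_) (mul_nonneg (by positivity)
      (integral_nonneg fun x => by positivity))
    have hm : MeasurableSet {x ∈ ball x₀ r | k < u x} :=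
      ((hu.continuousOn.mono (ball_subset_closedBall.trans hsub)).isOpen_inter_preimage
        isOpen_ball (isOpen_Ioi (a := k))).measurableSet
    filter_upwards [ae_restrict_mem hm] with x hx
    have : 0 ≤ u x - k := (sub_pos.mpr hx.2).le
    simp only [Pi.zero_apply]
    positivity
  have hvc : ContinuousOn (fun x => u x - k) (closedBall x₀ r) :=
    (hu.continuousOn.mono hsub).sub continuousOn_const
  have hvL : MemLp (fun x => u x - k) (ENNReal.ofReal sstar) (volume.restrict A) := by
    obtain ⟨M, hM⟩ := (isCompact_closedBall x₀ r).exists_bound_of_continuousOn hvc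
    refine MemLp.of_bound ((hvc.mono hAc).aestronglyMeasurable hAm) M ?_
    filter_upwards [ae_restrict_mem hAm] with x hx using hM x (hAc hx)
  set K := C * (3 * (r - ρ)⁻¹ * V ^ (1 / s - 1 / t) * S ^ t⁻¹) with hK
  have hK0 : 0 ≤ K := by positivity
  have hmain : eLpNorm (fun x => u x - k) (ENNReal.ofReal sstar) (volume.restrict A) ≤
      ENNReal.ofReal (4 * K) := by
    refine (Lp.eLpNorm_lim_le_liminf_eLpNorm
      (f := fun (n : ℕ) x => gReg (1 / ((n : ℝ) + 1)) (u x - k)) ?_ _ ?_).trans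
      (Filter.liminf_le_of_frequently_le' (Filter.Frequently.of_forall fun n => ?_))
    · intro n
      exact (gReg_contDiff (by positivity)).continuous.comp_aestronglyMeasurable hvL.1
    · filter_upwards [ae_restrict_mem hAm] with x hx
      have : 0 ≤ u x - k := (sub_pos.mpr hx.2).le
      simpa [max_eq_left this] using gReg_tendsto (u x - k)
    · have h1 : eLpNorm (fun x => gReg (1 / ((n : ℝ) + 1)) (u x - k)) (ENNReal.ofReal sstar)
          (volume.restrict A) ≤ eLpNorm ((4:ℝ) • cutW x₀ ρ r u k (1 / ((n : ℝ) + 1)))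
            (ENNReal.ofReal sstar) (volume.restrict A) := by
        refine eLpNorm_mono_ae_real ?_
        filter_upwards [ae_restrict_mem hAm] with x hx
        have hxr : ‖x - x₀‖ ≤ ρ := by
          have := hx.1
          rw [mem_ball, dist_eq_norm] at this
          exact this.le
        have h4 := gReg_one_ge (cutQ_ge hρ hr x hxr)
        have h5 := gReg_nonneg (e := 1 / ((n : ℝ) + 1)) (u x - k)
        rw [Real.norm_of_nonneg h5]
        simp only [Pi.smul_apply, smul_eq_mul, cutW]
        nlinarith
      refine h1.trans ((eLpNorm_mono_measure _ Measure.restrict_le_self).trans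
        (eLpNorm_const_smul_le.trans ?_))
      rw [ENNReal.ofReal_mul (by norm_num), Real.enorm_of_nonneg (by norm_num)]
      gcongr
      exact hC' n
  rw [hvL.eLpNorm_eq_integral_rpow_norm (by simpa using hss0) ENNReal.ofReal_ne_top,
    ENNReal.toReal_ofReal hss0.le, ENNReal.ofReal_le_ofReal_iff (by positivity)] at hmain
  have hvI : ∫ x in A, ‖u x - k‖ ^ sstar = ∫ x in A, (u x - k) ^ sstar := by
    refine setIntegral_congr_fun hAm fun x hx => ?_
    have : 0 ≤ u x - k := (sub_pos.mpr hx.2).le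
    simp only [Real.norm_of_nonneg this]
  have hX0 : 0 ≤ ∫ x in A, ‖u x - k‖ ^ sstar := integral_nonneg fun x => by positivity
  rw [hvI] at hmain hX0
  rw [Real.rpow_inv_le_iff_of_pos hX0 (by positivity) hss0] at hmain
  refine hmain.trans ?_
  have hle : 4 * K ≤ 12 * ((C:ℝ) + 1) * (r - ρ)⁻¹ * V ^ (1 / s - 1 / t) * S ^ t⁻¹ := by
    have : 0 ≤ (r - ρ)⁻¹ * V ^ (1 / s - 1 / t) * S ^ t⁻¹ := by positivity
    rw [hK]
    nlinarith
  refine (Real.rpow_le_rpow (by positivity) hle hss0.le).trans (le_of_eq ?_)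
  have e1 : (1 - s / t) * (sstar / s) = (1 / s - 1 / t) * sstar := by field_simp
  have e2 : sstar / t = t⁻¹ * sstar := by field_simp
  rw [Real.mul_rpow (by positivity) (by positivity), Real.mul_rpow (by positivity) (by positivity),
    Real.mul_rpow (by positivity) (by positivity), e1, e2, Real.rpow_mul hV0, Real.rpow_mul hS0,
    Real.inv_rpow hrr.le, div_eq_mul_inv (_ ^ sstar) ((r - ρ) ^ sstar)]
end

section
/- Let N ≥ 2, Ω ⊂ ℝ^N open and bounded, t > N, p > 1 and 2 < q < 2p; set s := 2qN(p−1)/(N(2p−q)+2q(p−1)) and assume 1 < s < N; set s* := Ns/(N−s) and β := 1 − 2/q + (1 − s/t)·(s*/s)·(2p−q)/(pq). There exists c = c(p,q,t,N) > 0 such that for every continuously differentiable u : Ω → ℝ with |u|^t and |∇u|^t integrable over Ω, all levels l > k, every x₀ ∈ Ω and all radii 0 < ρ < r < dist(x₀, ∂Ω), one has ∫_{A⁺(x₀,l,ρ)} (u−l)² dx ≤ (c/(r−ρ)^{2(p−1)/p}) · |A⁺(x₀,k,r)|^{β} · ( ∫_{A⁺(x₀,k,r)} (u−k)² dx )^{1/p}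 · ( ∫_{A⁺(x₀,k,r)} (u−k)^t dx + r^t ∫_{A⁺(x₀,k,r)} |∇u|^t dx )^{2(p−1)/(pt)}. -/
open MeasureTheory Metric Set Bornology

lemma holder_real {α : Type*} [MeasurableSpace α] (μ : Measure α) {f g : α → ℝ} {a b : ℝ}
    (hf : Integrable f μ) (hg : Integrable g μ) (hf0 : ∀ x, 0 ≤ f x) (hg0 : ∀ x, 0 ≤ g x)
    (ha : 0 ≤ a) (hb : 0 ≤ b) (hab : a + b = 1) :
    ∫ x, f x ^ a * g x ^ b ∂μ ≤ (∫ x, f x ∂μ) ^ a * (∫ x, g x ∂μ) ^ b := by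
  have h := ENNReal.lintegral_mul_norm_pow_le (μ := μ) (f := fun x => ENNReal.ofReal (f x))
    (g := fun x => ENNReal.ofReal (g x)) hf.aemeasurable.ennreal_ofReal
    hg.aemeasurable.ennreal_ofReal ha hb hab
  have hf1 : 0 ≤ ∫ x, f x ∂μ := integral_nonneg hf0
  have hg1 : 0 ≤ ∫ x, g x ∂μ := integral_nonneg hg0
  rw [← ofReal_integral_eq_lintegral_ofReal hf (Filter.Eventually.of_forall hf0),
    ← ofReal_integral_eq_lintegral_ofReal hg (Filter.Eventually.of_forall hg0),
    ENNReal.ofReal_rpow_of_nonneg hf1 ha, ENNReal.ofReal_rpow_of_nonneg hg1 hb,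
    ← ENNReal.ofReal_mul (by positivity)] at h
  rw [integral_eq_lintegral_of_nonneg_ae]
  · refine ENNReal.toReal_le_of_le_ofReal (by positivity) (le_trans (le_of_eq ?_) h)
    refine lintegral_congr fun x => ?_
    rw [ENNReal.ofReal_mul (Real.rpow_nonneg (hf0 x) _), ENNReal.ofReal_rpow_of_nonneg (hf0 x) ha,
      ENNReal.ofReal_rpow_of_nonneg (hg0 x) hb]
  · exact Filter.Eventually.of_forall fun x =>
      mul_nonneg (Real.rpow_nonneg (hf0 x) _) (Real.rpow_nonneg (hg0 x) _)
  · exact ((hf.aemeasurable.pow_const a).mul (hg.aemeasurable.pow_const b)).aestronglyMeasurable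

lemma sobolev_real (N : ℕ) (hN : 2 ≤ N) (s sstar : ℝ) (hs1 : 1 < s) (hss : 0 < sstar)
    (h : sstar⁻¹ = s⁻¹ - (N : ℝ)⁻¹) :
    ∃ C : ℝ, 0 ≤ C ∧ ∀ w : EuclideanSpace ℝ (Fin N) → ℝ, ContDiff ℝ 1 w → HasCompactSupport w →
      (∫ x, |w x| ^ sstar) ^ sstar⁻¹ ≤ C * (∫ x, ‖fderiv ℝ w x‖ ^ s) ^ s⁻¹ := by
  have hs0 : 0 < s := by linarith
  lift s to NNReal using hs0.le
  lift sstar to NNReal using hss.le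
  refine ⟨SNormLESNormFDerivOfEqConst ℝ (volume : Measure (EuclideanSpace ℝ (Fin N))) s,
    NNReal.coe_nonneg _, fun w hw hc => ?_⟩
  have h1 := eLpNorm_le_eLpNorm_fderiv_of_eq (volume : Measure (EuclideanSpace ℝ (Fin N)))
    hw hc (p := s) (p' := sstar) (by exact_mod_cast hs1.le) (by simp; omega) (by simpa using h)
  have m1 : MemLp w sstar volume := hw.continuous.memLp_of_hasCompactSupport hc
  have m2 : MemLp (fderiv ℝ w) s volume :=
    (hw.continuous_fderiv one_ne_zero).memLp_of_hasCompactSupport (hc.fderiv ℝ)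
  have e1 : (sstar : ENNReal) ≠ 0 := by
    have : sstar ≠ 0 := by rintro rfl; simp at hss
    exact_mod_cast this
  have e2 : (s : ENNReal) ≠ 0 := by
    have : s ≠ 0 := by rintro rfl; simp at hs0
    exact_mod_cast this
  rw [m1.eLpNorm_eq_integral_rpow_norm e1 (by simp),
    m2.eLpNorm_eq_integral_rpow_norm e2 (by simp)] at h1
  simp only [ENNReal.coe_toReal, Real.norm_eq_abs] at h1
  rw [← ENNReal.ofReal_coe_nnreal, ← ENNReal.ofReal_mul (NNReal.coe_nonneg _)] at h1
  exact (ENNReal.ofReal_le_ofReal_iff (mul_nonneg (NNReal.coe_nonneg _)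
    (Real.rpow_nonneg (integral_nonneg fun x => by positivity) _))).1 h1

lemma closedBall_sub {E : Type*} [NormedAddCommGroup E] [NormedSpace ℝ E] {Ω : Set E}
    (hΩ : IsOpen Ω) (x₀ : E) (r : ℝ) (hx : x₀ ∈ Ω) (hr0 : 0 < r)
    (hr : r < infDist x₀ (frontier Ω)) :
    closedBall x₀ r ⊆ Ω := by
  apply (isPreconnected_closedBall (x := x₀) (r := r)).subset_of_closure_inter_subset hΩ
    ⟨x₀, by simp [hr0.le], hx⟩
  rintro y ⟨hy1, hy⟩
  by_contra hy'
  have h1 : y ∈ frontier Ω := by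
    rw [hΩ.frontier_eq]; exact ⟨hy1, hy'⟩
  have := infDist_le_dist_of_mem h1 (x := x₀)
  rw [mem_closedBall, dist_comm] at hy
  linarith

lemma phi_exists (k l : ℝ) (hkl : k < l) : ∃ φ φ' : ℝ → ℝ, (∀ y, HasDerivAt φ (φ' y) y) ∧
    ContDiff ℝ 1 φ ∧ (∀ y ≤ k, φ y = 0) ∧ (∀ y ≤ k, φ' y = 0) ∧ (∀ y, |φ' y| ≤ 1) ∧
    (∀ y, 0 ≤ φ y) ∧ (∀ y, k < y → φ y ≤ y - k) ∧ (∀ y, y - l ≤ φ y) := by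
  set e := l - k with he
  have he0 : 0 < e := by simp [he, hkl]
  let m : ℝ → ℝ := fun y => max (y - k) 0
  have hm : Continuous m := by fun_prop
  have hm0 : ∀ y, 0 ≤ m y := fun y => le_max_right _ _
  have hd : ∀ y, HasDerivAt (fun y => m y ^ 2) (2 * m y) y := by
    intro y
    rcases lt_trichotomy y k with h | h | h
    · have : (fun y => m y ^ 2) =ᶠ[nhds y] fun _ => 0 := by
        filter_upwards [Iio_mem_nhds h] with z hz
        simp only [m]; rw [max_eq_right (by simp at hz; linarith)]; simp
      have h2 : m y = 0 := max_eq_right (by linarith)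
      rw [h2, mul_zero]
      exact (hasDerivAt_const y (0:ℝ)).congr_of_eventuallyEq this
    · subst h
      have h2 : m y = 0 := by simp [m]
      rw [h2, mul_zero, hasDerivAt_iff_isLittleO]
      have : (fun x' => m x' ^ 2 - m y ^ 2 - (x' - y) • (0:ℝ)) = fun x' => m x' ^ 2 := by
        ext; simp [h2]
      rw [this]
      have h3 : (fun x' => m x' ^ 2) =O[nhds y] fun x' => (x' - y) ^ 2 := by
        apply Asymptotics.IsBigO.of_bound 1
        refine Filter.Eventually.of_forall fun z => ?_
        simp only [m, norm_pow, Real.norm_eq_abs, one_mul]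
        refine pow_le_pow_left₀ (abs_nonneg _) ?_ 2
        rw [abs_of_nonneg (le_max_right (z - y) 0)]
        exact max_le (le_abs_self _) (abs_nonneg _)
      refine h3.trans_isLittleO ?_
      have h4 : (fun x' => (x' - y) ^ 2) = fun x' => (x' - y) * (x' - y) := by ext; ring
      rw [h4]
      have h5 : (fun x' : ℝ => x' - y) =o[nhds y] fun _ => (1:ℝ) := by
        rw [Asymptotics.isLittleO_one_iff]
        have : Continuous fun x' : ℝ => x' - y := by fun_prop
        simpa using this.tendsto y
      simpa using h5.mul_isBigO (Asymptotics.isBigO_refl (fun x' : ℝ => x' - y) (nhds y))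
    · have : (fun y => m y ^ 2) =ᶠ[nhds y] fun y => (y - k) ^ 2 := by
        filter_upwards [Ioi_mem_nhds h] with z hz
        simp only [m]; rw [max_eq_left (by simp at hz; linarith)]
      have h2 : m y = y - k := max_eq_left (by linarith)
      rw [h2]
      refine HasDerivAt.congr_of_eventuallyEq ?_ this
      have h6 := ((hasDerivAt_id y).sub_const k).pow 2
      have h7 : ((fun x => id x - k) ^ 2 : ℝ → ℝ) = fun y => (y - k) ^ 2 := by ext; simp
      rw [h7] at h6
      simpa using h6
  have hpos : ∀ y, 0 < m y ^ 2 + e ^ 2 := fun y => by positivity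
  let φ : ℝ → ℝ := fun y => Real.sqrt (m y ^ 2 + e ^ 2) - e
  let φ' : ℝ → ℝ := fun y => (2 * m y) / (2 * Real.sqrt (m y ^ 2 + e ^ 2))
  have hφ : ∀ y, HasDerivAt φ (φ' y) y := fun y =>
    (((hd y).add_const (e ^ 2)).sqrt (hpos y).ne').sub_const e
  have hsq : ∀ y, Real.sqrt (m y ^ 2 + e ^ 2) ^ 2 = m y ^ 2 + e ^ 2 := fun y =>
    Real.sq_sqrt (hpos y).le
  have hs0 : ∀ y, 0 < Real.sqrt (m y ^ 2 + e ^ 2) := fun y => Real.sqrt_pos.2 (hpos y)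
  have hsm : ∀ y, m y ≤ Real.sqrt (m y ^ 2 + e ^ 2) := fun y => 
    Real.le_sqrt_of_sq_le (by nlinarith)
  refine ⟨φ, φ', hφ, ?_, ?_, ?_, ?_, ?_, ?_, ?_⟩
  · rw [contDiff_one_iff_deriv]
    refine ⟨fun y => (hφ y).differentiableAt, ?_⟩
    have : deriv φ = φ' := by ext y; exact (hφ y).deriv
    rw [this]
    refine Continuous.div (by fun_prop) (by fun_prop) fun y => ?_
    have := hs0 y
    positivity
  · intro y hy
    have h2 : m y = 0 := max_eq_right (by linarith)
    simp [φ, h2, Real.sqrt_sq he0.le]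
  · intro y hy
    have h2 : m y = 0 := max_eq_right (by linarith)
    simp [φ', h2]
  · intro y
    have := hs0 y
    have h0 := hm0 y
    rw [abs_of_nonneg (by positivity), div_le_one (by positivity)]
    linarith [hsm y]
  · intro y
    have : e ≤ Real.sqrt (m y ^ 2 + e ^ 2) := Real.le_sqrt_of_sq_le (by nlinarith [sq_nonneg (m y)])
    simp only [φ]; linarith
  · intro y hy
    have h2 : m y = y - k := max_eq_left (by linarith)
    have : Real.sqrt (m y ^ 2 + e ^ 2) ≤ m y + e := by
      apply Real.sqrt_le_iff.2 ⟨by linarith [hm0 y], by nlinarith [hm0 y]⟩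
    simp only [φ]; linarith
  · intro y
    have : y - k ≤ m y := le_max_left _ _
    have := hsm y
    simp only [φ]; linarith

lemma smooth_deriv_bound : ∃ K : ℝ, 0 ≤ K ∧ ∀ y, |deriv Real.smoothTransition y| ≤ K := by
  have hc : Continuous (deriv Real.smoothTransition) :=
    (Real.smoothTransition.contDiff (n := 1)).continuous_deriv le_rfl
  obtain ⟨K, hK⟩ := isCompact_Icc (a := (0:ℝ)) (b := 1) |>.exists_bound_of_continuousOn hc.continuousOn
  refine ⟨max K 0, le_max_right _ _, fun y => ?_⟩
  by_cases h0 : y < 0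
  · have : Real.smoothTransition =ᶠ[nhds y] fun _ => 0 := by
      filter_upwards [Iio_mem_nhds h0] with z hz
      exact Real.smoothTransition.zero_of_nonpos (le_of_lt hz)
    rw [this.deriv_eq]; simp
  by_cases h1 : 1 < y
  · have : Real.smoothTransition =ᶠ[nhds y] fun _ => 1 := by
      filter_upwards [Ioi_mem_nhds h1] with z hz
      exact Real.smoothTransition.one_of_one_le (le_of_lt hz)
    rw [this.deriv_eq]; simp
  · exact (hK y ⟨not_lt.1 h0, not_lt.1 h1⟩).trans (le_max_left _ _)

lemma cutoff_exists : ∃ K : ℝ, 1 ≤ K ∧ ∀ (N : ℕ) (x₀ : EuclideanSpace ℝ (Fin N)) (ρ r : ℝ),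
    0 < ρ → ρ < r → ∃ η : EuclideanSpace ℝ (Fin N) → ℝ, ContDiff ℝ 1 η ∧ (∀ x, 0 ≤ η x) ∧
      (∀ x, η x ≤ 1) ∧ (∀ x ∈ ball x₀ ρ, η x = 1) ∧ tsupport η ⊆ ball x₀ r ∧
      HasCompactSupport η ∧ ∀ x, ‖fderiv ℝ η x‖ ≤ K / (r - ρ) := by
  obtain ⟨K, hK0, hK⟩ := smooth_deriv_bound
  refine ⟨max 1 (4 * K), le_max_left _ _, fun N x₀ ρ r hρ hr => ?_⟩
  set R := (r + ρ) / 2 with hR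
  have hRρ : ρ < R := by rw [hR]; linarith
  have hRr : R < r := by rw [hR]; linarith
  have hD : 0 < R ^ 2 - ρ ^ 2 := by nlinarith
  let g : EuclideanSpace ℝ (Fin N) → ℝ := fun x => (R ^ 2 - ‖x - x₀‖ ^ 2) / (R ^ 2 - ρ ^ 2)
  have hg : ContDiff ℝ 1 g := by
    refine ContDiff.div_const (contDiff_const.sub ?_) _
    exact (contDiff_id.sub contDiff_const).norm_sq ℝ
  let η : EuclideanSpace ℝ (Fin N) → ℝ := fun x => Real.smoothTransition (g x)
  have hη : ContDiff ℝ 1 η := Real.smoothTransition.contDiff.comp hg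
  have hz : ∀ x, R ≤ ‖x - x₀‖ → η x = 0 := fun x hx =>
    Real.smoothTransition.zero_of_nonpos (div_nonpos_of_nonpos_of_nonneg (by nlinarith) hD.le)
  have hts : tsupport η ⊆ closedBall x₀ R := by
    apply closure_minimal _ isClosed_closedBall
    intro x hx
    by_contra hc
    rw [mem_closedBall, dist_eq_norm, not_le] at hc
    exact hx (hz x hc.le)
  refine ⟨η, hη, fun x => Real.smoothTransition.nonneg _, fun x => Real.smoothTransition.le_one _,
    ?_, hts.trans (closedBall_subset_ball hRr), ?_, ?_⟩
  · intro x hx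
    rw [mem_ball, dist_eq_norm] at hx
    apply Real.smoothTransition.one_of_one_le
    rw [le_div_iff₀ hD]
    nlinarith [norm_nonneg (x - x₀)]
  · exact (isCompact_closedBall x₀ R).of_isClosed_subset (isClosed_tsupport _) hts
  · intro x
    have hrp : 0 < r - ρ := by linarith
    by_cases hx : x ∈ closedBall x₀ R
    · rw [mem_closedBall, dist_eq_norm] at hx
      have h1 : HasFDerivAt (fun x => ‖x - x₀‖ ^ 2)
          (2 • (innerSL ℝ (x - x₀))) x := by
        simpa using ((hasFDerivAt_id x).sub_const x₀).norm_sq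
      have h2 : HasFDerivAt g ((R ^ 2 - ρ ^ 2)⁻¹ • (-((2 : ℕ) • (innerSL ℝ (x - x₀)) : EuclideanSpace ℝ (Fin N) →L[ℝ] ℝ))) x := by
        have := ((h1.const_sub (R ^ 2)).const_smul ((R ^ 2 - ρ ^ 2)⁻¹))
        refine this.congr_of_eventuallyEq (Filter.Eventually.of_forall fun y => ?_)
        simp [g, div_eq_inv_mul]
      have h3 : HasDerivAt Real.smoothTransition (deriv Real.smoothTransition (g x)) (g x) :=
        ((Real.smoothTransition.contDiff (n := 1)).differentiable one_ne_zero _).hasDerivAt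
      have h4 : HasFDerivAt η _ x := h3.comp_hasFDerivAt x h2
      rw [h4.fderiv, norm_smul, norm_smul, norm_neg]
      have h5 : ‖2 • (innerSL ℝ (x - x₀))‖ ≤ 2 * R := by
        rw [two_smul]
        refine (norm_add_le _ _).trans ?_
        rw [innerSL_apply_norm]; linarith
      rw [Real.norm_eq_abs, Real.norm_eq_abs, abs_of_pos (inv_pos.2 hD)]
      have h6 : (R ^ 2 - ρ ^ 2)⁻¹ * (2 * R) ≤ 4 / (r - ρ) := by
        rw [inv_mul_eq_div, div_le_div_iff₀ hD hrp]
        have : r - ρ = 2 * (R - ρ) := by rw [hR]; ring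
        rw [this]; nlinarith [mul_pos (sub_pos.2 hRρ) hρ]
      calc _ ≤ K * ((R ^ 2 - ρ ^ 2)⁻¹ * (2 * R)) := by
            gcongr
            exact hK _
        _ ≤ K * (4 / (r - ρ)) := by gcongr
        _ = (4 * K) / (r - ρ) := by ring
        _ ≤ _ := by gcongr; exact le_max_right _ _
    · have : x ∉ tsupport η := fun h => hx (hts h)
      have : fderiv ℝ η x = 0 := by
        by_contra hne
        exact this (support_fderiv_subset ℝ hne)
      rw [this, norm_zero]; positivity

lemma w_exists : ∃ K : ℝ, 1 ≤ K ∧ ∀ (N : ℕ) (Ω : Set (EuclideanSpace ℝ (Fin N))) 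
    (u : EuclideanSpace ℝ (Fin N) → ℝ) (x₀ : EuclideanSpace ℝ (Fin N)) (k l ρ r : ℝ),
    IsOpen Ω → ContDiffOn ℝ 1 u Ω → closedBall x₀ r ⊆ Ω → k < l → 0 < ρ → ρ < r →
    ∃ w : EuclideanSpace ℝ (Fin N) → ℝ, ContDiff ℝ 1 w ∧ HasCompactSupport w ∧ (∀ x, 0 ≤ w x) ∧
      (∀ x ∉ {x ∈ ball x₀ r | k < u x}, w x = 0) ∧
      (∀ x ∈ {x ∈ ball x₀ r | k < u x}, w x ≤ u x - k) ∧
      (∀ x ∈ ball x₀ ρ, u x - l ≤ w x) ∧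
      (∀ x ∉ {x ∈ ball x₀ r | k < u x}, fderiv ℝ w x = 0) ∧
      (∀ x ∈ {x ∈ ball x₀ r | k < u x}, 
        ‖fderiv ℝ w x‖ ≤ K / (r - ρ) * ((u x - k) + r * ‖gradient u x‖)) := by
  obtain ⟨K, hK1, hK⟩ := cutoff_exists
  refine ⟨K, hK1, fun N Ω u x₀ k l ρ r hΩ hu hb hkl hρ hr => ?_⟩
  obtain ⟨η, hη, hη0, hη1, hηρ, hηt, hηc, hηd⟩ := hK N x₀ ρ r hρ hr
  obtain ⟨φ, φ', hφ, hφc, hφk, hφ'k, hφ'1, hφ0, hφ1, hφl⟩ := phi_exists k l hkl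
  have hbb : ball x₀ r ⊆ Ω := ball_subset_closedBall.trans hb
  have hua : ∀ x ∈ ball x₀ r, ContDiffAt ℝ 1 u x := fun x hx =>
    hu.contDiffAt (hΩ.mem_nhds (hbb hx))
  let w : EuclideanSpace ℝ (Fin N) → ℝ := fun x => η x * φ (u x)
  have hwt : tsupport w ⊆ tsupport η := tsupport_mul_subset_left
  have hnt : ∀ x ∉ ball x₀ r, w =ᶠ[nhds x] fun _ => 0 := fun x hx => 
    notMem_tsupport_iff_eventuallyEq.1 fun h => hx (hηt (hwt h))
  have hw : ContDiff ℝ 1 w := by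
    rw [contDiff_iff_contDiffAt]
    intro x
    by_cases hx : x ∈ ball x₀ r
    · exact hη.contDiffAt.mul (hφc.contDiffAt.comp x (hua x hx))
    · exact contDiffAt_const.congr_of_eventuallyEq (hnt x hx)
  have hfd : ∀ x ∈ ball x₀ r, fderiv ℝ w x = 
      η x • (φ' (u x) • fderiv ℝ u x) + φ (u x) • fderiv ℝ η x := by
    intro x hx
    have h1 : HasFDerivAt u (fderiv ℝ u x) x :=
      ((hua x hx).differentiableAt one_ne_zero).hasFDerivAt
    have h2 : HasFDerivAt (fun x => φ (u x)) (φ' (u x) • fderiv ℝ u x) x :=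
      (hφ (u x)).comp_hasFDerivAt x h1
    have h3 : HasFDerivAt η (fderiv ℝ η x) x := (hη.differentiable one_ne_zero x).hasFDerivAt
    exact (h3.mul h2).fderiv
  refine ⟨w, hw, hηc.mul_right, fun x => mul_nonneg (hη0 x) (hφ0 _), ?_, ?_, ?_, ?_, ?_⟩
  · intro x hx
    by_cases hxb : x ∈ ball x₀ r
    · have : u x ≤ k := by
        by_contra h; exact hx ⟨hxb, not_le.1 h⟩
      simp [w, hφk _ this]
    · exact (hnt x hxb).eq_of_nhds
  · intro x hx
    calc w x ≤ 1 * φ (u x) := mul_le_mul_of_nonneg_right (hη1 x) (hφ0 _)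
      _ ≤ _ := by rw [one_mul]; exact hφ1 _ hx.2
  · intro x hx
    simp only [w, hηρ x hx, one_mul]; exact hφl _
  · intro x hx
    by_cases hxb : x ∈ ball x₀ r
    · have : u x ≤ k := by
        by_contra h; exact hx ⟨hxb, not_le.1 h⟩
      rw [hfd x hxb, hφk _ this, hφ'k _ this]; simp
    · rw [(hnt x hxb).fderiv_eq]; simp
  · intro x hx
    have hg : ‖gradient u x‖ = ‖fderiv ℝ u x‖ := by simp [gradient]
    rw [hfd x hx.1, hg]
    have hrp : 0 < r - ρ := by linarith
    have h1 : ‖η x • (φ' (u x) • fderiv ℝ u x)‖ ≤ 1 * (1 * ‖fderiv ℝ u x‖) := by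
      rw [norm_smul, norm_smul, Real.norm_eq_abs, Real.norm_eq_abs, abs_of_nonneg (hη0 x)]
      have := hη1 x
      have := hφ'1 (u x)
      gcongr
    have h2 : ‖φ (u x) • fderiv ℝ η x‖ ≤ (u x - k) * (K / (r - ρ)) := by
      rw [norm_smul, Real.norm_eq_abs, abs_of_nonneg (hφ0 _)]
      have := hφ1 _ hx.2
      have := hηd x
      have := hx.2
      have : 0 ≤ u x - k := by linarith
      gcongr
    have h3 : 1 ≤ K / (r - ρ) * r := by
      rw [div_mul_eq_mul_div, le_div_iff₀ hrp]; nlinarith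
    calc _ ≤ _ := norm_add_le _ _
      _ ≤ 1 * (1 * ‖fderiv ℝ u x‖) + (u x - k) * (K / (r - ρ)) := add_le_add h1 h2
      _ ≤ (K / (r - ρ) * r) * ‖fderiv ℝ u x‖ + (u x - k) * (K / (r - ρ)) := by
        rw [one_mul]; gcongr
      _ = _ := by ring

lemma add_rpow_le {a b t : ℝ} (ha : 0 ≤ a) (hb : 0 ≤ b) (ht : 0 ≤ t) :
    (a + b) ^ t ≤ 2 ^ t * (a ^ t + b ^ t) := by
  have h1 : a + b ≤ 2 * max a b := by
    have := le_max_left a b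
    have := le_max_right a b
    linarith
  have hm : 0 ≤ max a b := le_max_of_le_left ha
  calc (a + b) ^ t ≤ (2 * max a b) ^ t := Real.rpow_le_rpow (by positivity) h1 ht
    _ = 2 ^ t * (max a b) ^ t := Real.mul_rpow (by norm_num) hm
    _ ≤ _ := by
      gcongr
      have := Real.rpow_nonneg ha t
      have := Real.rpow_nonneg hb t
      rcases max_choice a b with h | h <;> rw [h] <;> linarith

/-- the real-number part -/
lemma final_real {n t p q s sstar β C K d V X Y Z G T I J : ℝ} 
    (hn : 2 ≤ n) (ht : n < t) (hp : 1 < p) (hq2 : 2 < q) (hq : q < 2 * p)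
    (hs1 : 1 < s) (hsN : s < n) (hst : sstar = 2 * q * (p - 1) / (2 * p - q)) 
    (hβ : β = 1 - 2 / q + (1 - s / t) * (sstar / s) * ((2 * p - q) / (p * q)))
    (hC : 0 ≤ C) (hK : 1 ≤ K) (hd : 0 < d) (hV : 0 ≤ V) (hX : 0 ≤ X) (hY : 0 ≤ Y) (hZ : 0 ≤ Z)
    (hG : 0 ≤ G) (hT : 0 ≤ T) (hJ : 0 ≤ J) (hXI : X ≤ I)
    (h1 : X ≤ V ^ (1 - 2 / q) * Y ^ (2 / q))
    (h2 : Y ≤ X ^ (q / (2 * p)) * Z ^ ((2 * p - q) / (2 * p)))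
    (h3 : Z ^ sstar⁻¹ ≤ C * G ^ s⁻¹)
    (h4 : G ≤ V ^ (1 - s / t) * T ^ (s / t))
    (h5 : T ≤ (2 * K / d) ^ t * J) :
    X ≤ ((C * (2 * K)) ^ (2 * (p - 1) / p) + 1) / d ^ (2 * (p - 1) / p) * V ^ β * I ^ (1 / p) *
      J ^ (2 * (p - 1) / (p * t)) := by
  have hp0 : 0 < p := by linarith
  have hq0 : 0 < q := by linarith
  have ht0 : 0 < t := by linarith
  have hs0 : 0 < s := by linarith
  have hp1 : 0 < p - 1 := by linarith
  have hpq : 0 < 2 * p - q := by linarith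
  set γ := 2 * (p - 1) / p with hγ
  have hγ0 : 0 < γ := by positivity
  have hss : 0 < sstar := by rw [hst]; positivity
  have hst1 : s / t ≤ 1 := by rw [div_le_one ht0]; linarith
  have hst2 : 0 ≤ s⁻¹ - t⁻¹ := by
    rw [sub_nonneg]; gcongr; linarith
  have hq1 : 0 ≤ 1 - 2 / q := by
    rw [sub_nonneg, div_le_one hq0]; linarith
  have hI : 0 ≤ I := hX.trans hXI
  have hkd : 0 ≤ 2 * K / d := by positivity
  -- gradient chain
  have a1 : G ^ s⁻¹ ≤ V ^ (s⁻¹ - t⁻¹) * T ^ t⁻¹ := by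
    calc G ^ s⁻¹ ≤ (V ^ (1 - s / t) * T ^ (s / t)) ^ s⁻¹ := Real.rpow_le_rpow hG h4 (by positivity)
      _ = _ := by
        rw [Real.mul_rpow (by positivity) (by positivity), ← Real.rpow_mul hV, ← Real.rpow_mul hT]
        congr 2 <;> field_simp
  have a2 : T ^ t⁻¹ ≤ (2 * K / d) * J ^ t⁻¹ := by
    calc T ^ t⁻¹ ≤ ((2 * K / d) ^ t * J) ^ t⁻¹ := Real.rpow_le_rpow hT h5 (by positivity)
      _ = _ := by
        rw [Real.mul_rpow (by positivity) hJ, Real.rpow_rpow_inv hkd ht0.ne']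
  have a3 : Z ^ sstar⁻¹ ≤ C * (V ^ (s⁻¹ - t⁻¹) * ((2 * K / d) * J ^ t⁻¹)) := by
    refine h3.trans ?_
    gcongr
    refine a1.trans ?_
    gcongr
  have a4 : (Z ^ sstar⁻¹) ^ γ ≤
      (C * (2 * K)) ^ γ / d ^ γ * V ^ ((s⁻¹ - t⁻¹) * γ) * J ^ (2 * (p - 1) / (p * t)) := by
    calc (Z ^ sstar⁻¹) ^ γ ≤ (C * (V ^ (s⁻¹ - t⁻¹) * ((2 * K / d) * J ^ t⁻¹))) ^ γ :=
          Real.rpow_le_rpow (by positivity) a3 hγ0.le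
      _ = (C * (2 * K) / d * (V ^ (s⁻¹ - t⁻¹) * J ^ t⁻¹)) ^ γ := by congr 1; ring
      _ = _ := by
        rw [Real.mul_rpow (by positivity) (by positivity), Real.mul_rpow (by positivity)
          (by positivity), Real.div_rpow (by positivity) hd.le, ← Real.rpow_mul hV, 
          ← Real.rpow_mul hJ, mul_assoc]
        congr 3
        rw [hγ]; field_simp
  have a5 : Y ^ (2 / q) ≤ X ^ (1 / p) * (Z ^ sstar⁻¹) ^ γ := by
    calc Y ^ (2 / q) ≤ (X ^ (q / (2 * p)) * Z ^ ((2 * p - q) / (2 * p))) ^ (2 / q) :=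
          Real.rpow_le_rpow hY h2 (by positivity)
      _ = _ := by
        rw [Real.mul_rpow (by positivity) (by positivity), ← Real.rpow_mul hX, ← Real.rpow_mul hZ,
          ← Real.rpow_mul hZ]
        congr 2
        · field_simp
        · rw [hst, hγ]; field_simp
  have a6 : V ^ β = V ^ (1 - 2 / q) * V ^ ((s⁻¹ - t⁻¹) * γ) := by
    rw [← Real.rpow_add_of_nonneg hV hq1 (by positivity), hβ, hst, hγ]
    congr 2
    field_simp
  calc X ≤ _ := h1
    _ ≤ V ^ (1 - 2 / q) * (I ^ (1 / p) * ((C * (2 * K)) ^ γ / d ^ γ * V ^ ((s⁻¹ - t⁻¹) * γ) *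
          J ^ (2 * (p - 1) / (p * t)))) := by
        gcongr
        refine a5.trans ?_
        gcongr
    _ = (C * (2 * K)) ^ γ / d ^ γ * V ^ β * I ^ (1 / p) * J ^ (2 * (p - 1) / (p * t)) := by
        rw [a6]; ring
    _ ≤ _ := by
        gcongr
        linarith

set_option maxHeartbeats 2000000 in
/-- Lemma 2.2: level estimate relating the level `l > k` on the smaller ball
to the level `k` on the larger ball. -/
theorem stmt1 (N : ℕ) (hN : 2 ≤ N) (t p q s sstar β : ℝ)
    (ht : (N : ℝ) < t) (hp : 1 < p) (hq2 : 2 < q) (hq : q < 2 * p)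
    (hs : s = 2 * q * N * (p - 1) / (N * (2 * p - q) + 2 * q * (p - 1)))
    (hs1 : 1 < s) (hsN : s < (N : ℝ))
    (hsstar : sstar = N * s / (N - s))
    (hβ : β = 1 - 2 / q + (1 - s / t) * (sstar / s) * ((2 * p - q) / (p * q))) :
    ∃ c > (0 : ℝ), ∀ (Ω : Set (EuclideanSpace ℝ (Fin N))),
      IsOpen Ω → IsBounded Ω →
      ∀ u : EuclideanSpace ℝ (Fin N) → ℝ,
        ContDiffOn ℝ 1 u Ω →
        IntegrableOn (fun x => |u x| ^ t) Ω →
        IntegrableOn (fun x => ‖gradient u x‖ ^ t) Ω →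
        ∀ (l k : ℝ), k < l →
        ∀ (x₀ : EuclideanSpace ℝ (Fin N)) (ρ r : ℝ),
          x₀ ∈ Ω → 0 < ρ → ρ < r → r < infDist x₀ (frontier Ω) →
          ∫ x in {x ∈ ball x₀ ρ | l < u x}, (u x - l) ^ 2 ≤
            c / (r - ρ) ^ (2 * (p - 1) / p) *
              (volume {x ∈ ball x₀ r | k < u x}).toReal ^ β *
              (∫ x in {x ∈ ball x₀ r | k < u x}, (u x - k) ^ 2) ^ (1 / p) *
              ((∫ x in {x ∈ ball x₀ r | k < u x}, (u x - k) ^ t) +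
                r ^ t * ∫ x in {x ∈ ball x₀ r | k < u x}, ‖gradient u x‖ ^ t) ^
                  (2 * (p - 1) / (p * t)) := by
  have hN2 : (2 : ℝ) ≤ N := by exact_mod_cast hN
  have hp0 : 0 < p := by linarith
  have hq0 : 0 < q := by linarith
  have ht0 : 0 < t := by linarith
  have hs0 : 0 < s := by linarith
  have hN0 : (0 : ℝ) < N := by linarith
  have hp1 : 0 < p - 1 := by linarith
  have hpq : 0 < 2 * p - q := by linarith
  have hNs : 0 < (N : ℝ) - s := by linarith
  have hinv : sstar⁻¹ = s⁻¹ - (N : ℝ)⁻¹ := by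
    rw [hsstar]; field_simp
  have hst : sstar = 2 * q * (p - 1) / (2 * p - q) := by
    rw [← inv_inj, hinv, hs]
    have : 0 < N * (2 * p - q) + 2 * q * (p - 1) := by positivity
    field_simp
    ring
  have hss : 0 < sstar := by rw [hst]; positivity
  have hst1 : s / t ≤ 1 := by rw [div_le_one ht0]; linarith
  have hq1 : 0 ≤ 1 - 2 / q := by
    rw [sub_nonneg, div_le_one hq0]; linarith
  obtain ⟨C, hC0, hC⟩ := sobolev_real N hN s sstar hs1 hss hinv
  obtain ⟨K, hK1, hK⟩ := w_exists
  refine ⟨(C * (2 * K)) ^ (2 * (p - 1) / p) + 1, by positivity, ?_⟩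
  intro Ω hΩ _ u hu _ _ l k hkl x₀ ρ r hx₀ hρ hr hrd
  have hr0 : 0 < r := hρ.trans hr
  have hb := closedBall_sub hΩ x₀ r hx₀ hr0 hrd
  obtain ⟨w, hw, hwc, hw0, hwA, hwk, hwl, hdA, hdk⟩ := hK N Ω u x₀ k l ρ r hΩ hu hb hkl hρ hr
  have hdw : Continuous (fderiv ℝ w) := hw.continuous_fderiv one_ne_zero
  have huc : ContinuousOn u (closedBall x₀ r) := hu.continuousOn.mono hb
  have hgrad : (fun x => ‖gradient u x‖) = fun x => ‖fderiv ℝ u x‖ := by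
    ext x; simp [gradient]
  have hgc : ContinuousOn (fun x => ‖gradient u x‖) (closedBall x₀ r) := by
    rw [hgrad]
    exact ((hu.continuousOn_fderiv_of_isOpen hΩ le_rfl).mono hb).norm
  have hlev : ∀ (m σ : ℝ), σ ≤ r → IsOpen {x ∈ ball x₀ σ | m < u x} := by
    intro m σ hσ
    exact (huc.mono ((ball_subset_ball hσ).trans ball_subset_closedBall)).isOpen_inter_preimage
      isOpen_ball isOpen_Ioi
  have hAo := hlev k r le_rfl
  have hBo := hlev l ρ hr.le
  set A := {x ∈ ball x₀ r | k < u x} with hA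
  set B := {x ∈ ball x₀ ρ | l < u x} with hB
  have hAc : A ⊆ closedBall x₀ r := fun x hx => ball_subset_closedBall hx.1
  have hBc : B ⊆ closedBall x₀ r := fun x hx => 
    ball_subset_closedBall (ball_subset_ball hr.le hx.1)
  have hcpt : IsCompact (closedBall x₀ r) := isCompact_closedBall x₀ r
  have hAfin : volume A ≠ ⊤ := (measure_mono hAc).trans_lt hcpt.measure_lt_top |>.ne
  have hint : ∀ (f : EuclideanSpace ℝ (Fin N) → ℝ) (D : Set (EuclideanSpace ℝ (Fin N))),
      D ⊆ closedBall x₀ r → ContinuousOn f (closedBall x₀ r) → IntegrableOn f D := 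
    fun f D hD hf => (hf.integrableOn_compact hcpt).mono_set hD
  have iw2 : Integrable (fun x => w x ^ 2) volume := by
    refine (hw.continuous.pow 2).integrable_of_hasCompactSupport ?_
    change HasCompactSupport ((fun y : ℝ => y ^ 2) ∘ w)
    exact hwc.comp_left (g := fun y : ℝ => y ^ 2) (by simp)
  have iwr : ∀ a : ℝ, 0 < a → Integrable (fun x => w x ^ a) volume := by
    intro a ha
    refine (hw.continuous.rpow_const fun x => Or.inr ha.le).integrable_of_hasCompactSupport ?_
    change HasCompactSupport ((fun y : ℝ => y ^ a) ∘ w)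
    exact hwc.comp_left (g := fun y : ℝ => y ^ a) (Real.zero_rpow ha.ne')
  have idr : ∀ a : ℝ, 0 < a → Integrable (fun x => ‖fderiv ℝ w x‖ ^ a) volume := by
    intro a ha
    refine (hdw.norm.rpow_const fun x => Or.inr ha.le).integrable_of_hasCompactSupport ?_
    exact (hwc.fderiv ℝ).comp_left (g := fun y => ‖y‖ ^ a) (by simp [ha.ne'])
  have i1 : IntegrableOn (fun _ => (1 : ℝ)) A := integrableOn_const hAfin
  have hV1 : ∫ x in A, (1 : ℝ) = (volume A).toReal := by simp [Measure.real]
  -- restrict to A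
  have r2 : ∫ x in A, w x ^ 2 = ∫ x, w x ^ 2 :=
    setIntegral_eq_integral_of_forall_compl_eq_zero fun x hx => by simp [hwA x hx]
  have rq : ∫ x in A, w x ^ q = ∫ x, w x ^ q :=
    setIntegral_eq_integral_of_forall_compl_eq_zero fun x hx => by simp [hwA x hx, hq0.ne']
  have rs : ∫ x in A, ‖fderiv ℝ w x‖ ^ s = ∫ x, ‖fderiv ℝ w x‖ ^ s :=
    setIntegral_eq_integral_of_forall_compl_eq_zero fun x hx => by simp [hdA x hx, hs0.ne']
  have i2 : IntegrableOn (fun x => (u x - k) ^ 2) A :=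
    hint _ _ hAc ((huc.sub continuousOn_const).pow 2)
  have it : IntegrableOn (fun x => (u x - k) ^ t) A :=
    hint _ _ hAc ((huc.sub continuousOn_const).rpow_const fun x _ => Or.inr ht0.le)
  have ig : IntegrableOn (fun x => ‖gradient u x‖ ^ t) A :=
    hint _ _ hAc (hgc.rpow_const fun x _ => Or.inr ht0.le)
  have hLX : ∫ x in B, (u x - l) ^ 2 ≤ ∫ x, w x ^ 2 := by
    calc ∫ x in B, (u x - l) ^ 2 ≤ ∫ x in B, w x ^ 2 := by
          refine setIntegral_mono_on (hint _ _ hBc ((huc.sub continuousOn_const).pow 2))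
            iw2.integrableOn hBo.measurableSet fun x hx => ?_
          have := hwl x hx.1
          have := hx.2
          gcongr
      _ ≤ _ := setIntegral_le_integral iw2 (Filter.Eventually.of_forall fun x => sq_nonneg _)
  refine hLX.trans ?_
  have hrp : 0 < r - ρ := by linarith
  refine final_real (Y := ∫ x, w x ^ q) (Z := ∫ x, |w x| ^ sstar)
    (G := ∫ x, ‖fderiv ℝ w x‖ ^ s) (T := ∫ x in A, ‖fderiv ℝ w x‖ ^ t)
    hN2 ht hp hq2 hq hs1 hsN hst hβ hC0 hK1 hrp ENNReal.toReal_nonneg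
    (integral_nonneg fun x => sq_nonneg _) (integral_nonneg fun x => Real.rpow_nonneg (hw0 x) _)
    (integral_nonneg fun x => by positivity) (integral_nonneg fun x => by positivity)
    (integral_nonneg fun x => by positivity) ?_ ?_ ?_ ?_ (hC w hw hwc) ?_ ?_
  · have : 0 ≤ ∫ x in A, (u x - k) ^ t := setIntegral_nonneg hAo.measurableSet fun x hx => 
      Real.rpow_nonneg (by linarith [hx.2]) _
    have : 0 ≤ ∫ x in A, ‖gradient u x‖ ^ t := integral_nonneg fun x => by positivity
    positivity
  · rw [← r2]
    refine setIntegral_mono_on iw2.integrableOn i2 hAo.measurableSet fun x hx => ?_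
    have := hw0 x
    have := hwk x hx
    gcongr
  · rw [← r2, ← rq, ← hV1]
    have := holder_real (volume.restrict A) (a := 1 - 2 / q) (b := 2 / q) i1 
      (iwr q hq0).integrableOn (fun _ => zero_le_one) (fun x => Real.rpow_nonneg (hw0 x) _)
      hq1 (by positivity) (by ring)
    refine le_trans (le_of_eq ?_) this
    congr 1
    ext x
    rw [Real.one_rpow, one_mul, ← Real.rpow_mul (hw0 x), mul_div_cancel₀ _ hq0.ne', 
      Real.rpow_two]
  · have habs : (fun x => |w x| ^ sstar) = fun x => w x ^ sstar := by
      ext x; rw [abs_of_nonneg (hw0 x)]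
    rw [habs]
    have := holder_real volume (a := q / (2 * p)) (b := (2 * p - q) / (2 * p)) iw2
      (iwr sstar hss) (fun x => sq_nonneg _) (fun x => Real.rpow_nonneg (hw0 x) _)
      (by positivity) (by positivity) (by field_simp; ring)
    refine le_trans (le_of_eq ?_) this
    congr 1
    ext x
    rw [← Real.rpow_two, ← Real.rpow_mul (hw0 x), ← Real.rpow_mul (hw0 x), 
      ← Real.rpow_add_of_nonneg (hw0 x) (by positivity) (by positivity)]
    congr 1
    rw [hst]; field_simp; ring
  · rw [← rs, ← hV1]
    have := holder_real (volume.restrict A) (a := 1 - s / t) (b := s / t) i1 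
      (idr t ht0).integrableOn (fun _ => zero_le_one) (fun x => by positivity)
      (by linarith) (by positivity) (by ring)
    refine le_trans (le_of_eq ?_) this
    congr 1
    ext x
    rw [Real.one_rpow, one_mul, ← Real.rpow_mul (norm_nonneg _), mul_div_cancel₀ _ ht0.ne']
  · have hsum : (2 * K / (r - ρ)) ^ t * ((∫ x in A, (u x - k) ^ t) +
        r ^ t * ∫ x in A, ‖gradient u x‖ ^ t) = 
        ∫ x in A, (2 * K / (r - ρ)) ^ t * ((u x - k) ^ t + r ^ t * ‖gradient u x‖ ^ t) := by
      rw [integral_const_mul, integral_add it (ig.const_mul _), integral_const_mul]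
    rw [hsum]
    refine setIntegral_mono_on (idr t ht0).integrableOn ((it.add (ig.const_mul _)).const_mul _)
      hAo.measurableSet fun x hx => ?_
    have hk0 : 0 ≤ u x - k := by linarith [hx.2]
    have hKd : 0 ≤ K / (r - ρ) := by positivity
    calc ‖fderiv ℝ w x‖ ^ t ≤ (K / (r - ρ) * ((u x - k) + r * ‖gradient u x‖)) ^ t :=
          Real.rpow_le_rpow (norm_nonneg _) (hdk x hx) ht0.le
      _ = (K / (r - ρ)) ^ t * ((u x - k) + r * ‖gradient u x‖) ^ t :=
          Real.mul_rpow hKd (by positivity)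
      _ ≤ (K / (r - ρ)) ^ t * (2 ^ t * ((u x - k) ^ t + (r * ‖gradient u x‖) ^ t)) := by
          gcongr
          exact add_rpow_le hk0 (by positivity) ht0.le
      _ = _ := by
          rw [Real.mul_rpow hr0.le (norm_nonneg _), mul_div_assoc 2 K, 
            Real.mul_rpow (by norm_num) hKd]
          ring
end

section
/- Let N ≥ 2, Ω ⊂ ℝ^N open and bounded, t > N, p > 1 and 2 < q < 2p; set s := 2qN(p−1)/(N(2p−q)+2q(p−1)) and assume 1 < s < N; set s* := Ns/(N−s), β := 1 − 2/q + (1 − s/t)·(s*/s)·(2p−q)/(pq), θ := (1/p + √(1/p² + 4β))/2, and let ξ, η > 0 be a positive solution of ξ/p + η = θξ and βξ = θη. There exists c = c(N,t,p,q,ξ,η) > 0 such that for every continuously differentiable u : Ω → ℝ with |u|^t and |∇u|^t integrable over Ω, every k ∈ ℝ, every y ∈ Ω and every 0 < r < dist(y, ∂Ω): sup_{B(y,r/2)} u ≤ k + d, where d := (c / r^{ξ(p−1)/(ηp)}) · ( ∫_{A⁺(y,k,r)} |u−k|^t dx + r^t ∫_{A⁺(y,k,r)} |∇u|^t dx )^{ξ(p−1)/(tpη)}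 · ( ∫_{A⁺(y,k,r)} |u−k|² dx )^{ξ(θ−1)/(2η)} · |A⁺(y,k,r)|^{(θ−1)/2}. -/
open MeasureTheory Metric Set Bornology

open scoped ENNReal

lemma aux_scale {N : ℕ} (x : EuclideanSpace ℝ (Fin N)) {τ : ℝ} (hτ : 0 < τ)
    (g : EuclideanSpace ℝ (Fin N) → ℝ≥0∞) (hg : Measurable g) :
    ∫⁻ z, g (x + τ • (z - x)) = ENNReal.ofReal ((τ ^ N)⁻¹) * ∫⁻ z, g z := by
  have h1 : ∫⁻ z, g (x + τ • (z - x)) = ∫⁻ z, g (x + τ • z) :=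
    lintegral_sub_right_eq_self (fun z => g (x + τ • z)) x
  have h2 : ∫⁻ z, g (x + τ • z) = ∫⁻ w, g (x + w) ∂(Measure.map (τ • ·) volume) := by
    rw [lintegral_map (by fun_prop) (by fun_prop)]
  rw [h1, h2, Measure.map_addHaar_smul _ hτ.ne', lintegral_smul_measure,
    lintegral_add_left_eq_self]
  simp [abs_of_pos (pow_pos hτ N)]

lemma aux_tau {a : ℝ} (ha : a < 1) :
    ∫⁻ τ in Ioc (0:ℝ) 1, ENNReal.ofReal (τ ^ (-a)) = ENNReal.ofReal (1 / (1 - a)) := by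
  have hi : IntegrableOn (fun τ : ℝ => τ ^ (-a)) (Ioc 0 1) := by
    have := (intervalIntegral.intervalIntegrable_rpow' (a := 0) (b := 1) (r := -a) (by linarith))
    rwa [intervalIntegrable_iff_integrableOn_Ioc_of_le zero_le_one] at this
  rw [← ofReal_integral_eq_lintegral_ofReal hi, ← intervalIntegral.integral_of_le zero_le_one,
    integral_rpow (Or.inl (by linarith))]
  · rw [Real.one_rpow, Real.zero_rpow (by linarith)]
    congr 1
    ring
  · filter_upwards [self_mem_ae_restrict measurableSet_Ioc] with τ hτ
    exact Real.rpow_nonneg hτ.1.le _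

lemma aux_morrey {N : ℕ} (hN : 2 ≤ N) {t : ℝ} (ht : (N:ℝ) < t)
    (x : EuclideanSpace ℝ (Fin N)) {ρ m : ℝ}
    (f : EuclideanSpace ℝ (Fin N) → ℝ≥0∞) (hf : Measurable f)
    (T : Set (EuclideanSpace ℝ (Fin N))) (hT : MeasurableSet T) (hTs : T ⊆ ball x ρ)
    (h : ∀ z ∈ T, ENNReal.ofReal m ≤
      ENNReal.ofReal ρ * ∫⁻ τ in Ioc (0:ℝ) 1, f (x + τ • (z - x))) :
    ENNReal.ofReal m * volume T ≤ ENNReal.ofReal ρ * (ENNReal.ofReal (1 / (1 - N / t)) *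
      ((∫⁻ z, f z ^ t) ^ (1 / t) * volume (ball x ρ) ^ (1 - 1 / t))) := by
  have hN' : (2:ℝ) ≤ N := by exact_mod_cast hN
  have ht0 : 0 < t := by linarith
  have ht1 : 1 < t := by linarith
  have hm : Measurable (fun q : EuclideanSpace ℝ (Fin N) × ℝ => f (x + q.2 • (q.1 - x))) :=
    hf.comp (by fun_prop)
  have hm1 : ∀ τ : ℝ, Measurable (fun z : EuclideanSpace ℝ (Fin N) => f (x + τ • (z - x))) :=
    fun τ => hf.comp (by fun_prop)
  calc ENNReal.ofReal m * volume T = ∫⁻ z in T, ENNReal.ofReal m := by simp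
    _ ≤ ∫⁻ z in T, ENNReal.ofReal ρ * ∫⁻ τ in Ioc (0:ℝ) 1, f (x + τ • (z - x)) :=
        setLIntegral_mono' hT h
    _ ≤ ∫⁻ z in ball x ρ, ENNReal.ofReal ρ * ∫⁻ τ in Ioc (0:ℝ) 1, f (x + τ • (z - x)) :=
        lintegral_mono_set hTs
    _ = ENNReal.ofReal ρ * ∫⁻ z in ball x ρ, ∫⁻ τ in Ioc (0:ℝ) 1, f (x + τ • (z - x)) := by
        rw [lintegral_const_mul' _ _ ENNReal.ofReal_ne_top]
    _ = ENNReal.ofReal ρ * ∫⁻ τ in Ioc (0:ℝ) 1, ∫⁻ z in ball x ρ, f (x + τ • (z - x)) := by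
        rw [lintegral_lintegral_swap]
        exact hm.aemeasurable
    _ ≤ ENNReal.ofReal ρ * ∫⁻ τ in Ioc (0:ℝ) 1, ENNReal.ofReal (τ ^ (-(N / t))) *
          ((∫⁻ z, f z ^ t) ^ (1 / t) * volume (ball x ρ) ^ (1 - 1 / t)) := by
        refine mul_le_mul' le_rfl ?_
        refine setLIntegral_mono' measurableSet_Ioc fun τ hτ => ?_
        have hh := ENNReal.lintegral_mul_le_Lp_mul_Lq (volume.restrict (ball x ρ))
          (Real.HolderConjugate.conjExponent ht1) (hm1 τ).aemeasurable
          (aemeasurable_const (b := (1:ℝ≥0∞)))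
        have hc : 1 / t.conjExponent = 1 - 1 / t := by
          rw [Real.conjExponent]; field_simp
        simp only [Pi.mul_apply, mul_one, ENNReal.one_rpow, lintegral_one,
          Measure.restrict_apply MeasurableSet.univ, univ_inter, hc] at hh
        refine hh.trans ?_
        rw [← mul_assoc]
        gcongr
        have h3 : ∫⁻ z in ball x ρ, f (x + τ • (z - x)) ^ t ≤
            ENNReal.ofReal ((τ ^ N)⁻¹) * ∫⁻ z, f z ^ t :=
          (setLIntegral_le_lintegral _ _).trans_eq
            (aux_scale x hτ.1 (fun z => f z ^ t) (hf.pow_const _))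
        calc _ ≤ (ENNReal.ofReal ((τ ^ N)⁻¹) * ∫⁻ z, f z ^ t) ^ (1 / t) := by gcongr
          _ = _ := by
            rw [ENNReal.mul_rpow_of_nonneg _ _ (by positivity), ENNReal.ofReal_rpow_of_nonneg
              (inv_nonneg.2 (pow_nonneg hτ.1.le _)) (by positivity)]
            congr 2
            rw [← Real.rpow_natCast, ← Real.rpow_neg hτ.1.le, ← Real.rpow_mul hτ.1.le]
            congr 1
            ring
    _ = _ := by
        rw [lintegral_mul_const _ (by fun_prop), aux_tau]
        rw [div_lt_one ht0]; exact ht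

lemma aux_line {N : ℕ} {u : EuclideanSpace ℝ (Fin N) → ℝ} {y : EuclideanSpace ℝ (Fin N)}
    {r k M : ℝ} (hu : ContDiffOn ℝ 1 u (ball y r)) {x z : EuclideanSpace ℝ (Fin N)}
    (hx : x ∈ ball y r) (hz : z ∈ ball y r) (hM : 0 < M) (hxu : u x = k + M)
    (hzu : u z < k + M / 2) :
    ENNReal.ofReal (M / 2) ≤ ‖z - x‖ₑ * ∫⁻ τ in Ioc (0:ℝ) 1,
      ({z ∈ ball y r | k < u z}.indicator (fun z => ‖gradient u z‖ₑ)) (x + τ • (z - x)) := by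
  set φ : ℝ → ℝ := fun τ => u (x + τ • (z - x)) with hφ
  have hmem : ∀ τ ∈ Icc (0:ℝ) 1, x + τ • (z - x) ∈ ball y r := fun τ hτ =>
    (convex_ball y r).add_smul_sub_mem hx hz hτ
  have hφc : ContDiffOn ℝ 1 φ (Icc 0 1) := by
    refine hu.comp (t := ball y r) ?_ hmem
    fun_prop
  have h0 : φ 0 = k + M := by simp [hφ, hxu]
  have h1 : φ 1 < k + M / 2 := by simpa [hφ] using hzu
  have hK : IsCompact {τ ∈ Icc (0:ℝ) 1 | φ τ ≤ k + M / 2} := by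
    have : IsClosed (Icc (0:ℝ) 1 ∩ φ ⁻¹' (Iic (k + M/2))) :=
      hφc.continuousOn.preimage_isClosed_of_isClosed isClosed_Icc isClosed_Iic
    exact isCompact_Icc.of_isClosed_subset this (fun _ h => h.1)
  obtain ⟨τ₀, ⟨hτ₀, hτ₀'⟩, hleast⟩ := hK.exists_isLeast ⟨1, ⟨zero_le_one, le_rfl⟩, h1.le⟩
  have hsub : Icc (0:ℝ) τ₀ ⊆ Icc 0 1 := Icc_subset_Icc_right hτ₀.2
  have key := enorm_sub_le_lintegral_deriv_of_contDiffOn_Icc (hφc.mono hsub) hτ₀.1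
  have hlow : ENNReal.ofReal (M/2) ≤ ‖φ τ₀ - φ 0‖ₑ := by
    rw [Real.enorm_eq_ofReal_abs]
    apply ENNReal.ofReal_le_ofReal
    rw [abs_sub_comm]
    exact le_trans (by linarith) (le_abs_self _)
  refine hlow.trans (key.trans ?_)
  rw [← lintegral_const_mul' _ _ enorm_ne_top, ← restrict_Ioo_eq_restrict_Icc]
  refine le_trans (setLIntegral_mono' measurableSet_Ioo (g := fun τ => ‖z - x‖ₑ *
    ({z ∈ ball y r | k < u z}.indicator (fun z => ‖gradient u z‖ₑ)) (x + τ • (z - x))) ?_)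
    (lintegral_mono_set fun τ hτ => ⟨hτ.1, hτ.2.le.trans hτ₀.2⟩)
  intro τ hτ
  have hτ1 : τ ∈ Icc (0:ℝ) 1 := ⟨hτ.1.le, hτ.2.le.trans hτ₀.2⟩
  have hgt : k < u (x + τ • (z - x)) := by
    by_contra! hle
    have : τ₀ ≤ τ := hleast ⟨hτ1, by simp only [hφ]; linarith⟩
    exact absurd hτ.2 this.not_gt
  rw [indicator_of_mem (show x + τ • (z - x) ∈ {z ∈ ball y r | k < u z} from ⟨hmem τ hτ1, hgt⟩)]
  have hd : DifferentiableAt ℝ u (x + τ • (z - x)) :=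
    (hu.differentiableOn one_ne_zero).differentiableAt (isOpen_ball.mem_nhds (hmem τ hτ1))
  have hg : HasDerivAt (fun τ : ℝ => x + τ • (z - x)) (z - x) τ := by
    simpa using ((hasDerivAt_id τ).smul_const (z - x)).const_add x
  have hd2 : HasDerivAt φ (fderiv ℝ u (x + τ • (z - x)) (z - x)) τ :=
    hd.hasFDerivAt.comp_hasDerivAt τ hg
  rw [hd2.deriv]
  have hn : ‖gradient u (x + τ • (z - x))‖ = ‖fderiv ℝ u (x + τ • (z - x))‖ := by
    simp [gradient]
  rw [← ofReal_norm, ← ofReal_norm (z - x),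
    ← ofReal_norm (gradient u _), hn, ← ENNReal.ofReal_mul (norm_nonneg _)]
  apply ENNReal.ofReal_le_ofReal
  rw [mul_comm]
  exact ContinuousLinearMap.le_opNorm _ _

lemma aux_beta {n t p q s sstar β : ℝ} (hn : 2 ≤ n) (ht : n < t) (hp : 1 < p) (hq2 : 2 < q)
    (hq : q < 2 * p)
    (hs : s = 2 * q * n * (p - 1) / (n * (2 * p - q) + 2 * q * (p - 1)))
    (hsstar : sstar = n * s / (n - s))
    (hβ : β = 1 - 2 / q + (1 - s / t) * (sstar / s) * ((2 * p - q) / (p * q))) :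
    β = 1 - 1 / p + 2 * (1 - 1 / p) * (1 / n - 1 / t) := by
  have hD : 0 < n * (2 * p - q) + 2 * q * (p - 1) := by
    have : 0 < n * (2 * p - q) := mul_pos (by linarith) (by linarith)
    have : 0 < 2 * q * (p - 1) := mul_pos (by linarith) (by linarith)
    linarith
  have h1 : 0 < 2 * p - q := by linarith
  have hp1 : 0 < p - 1 := by linarith
  have hq0 : 0 < q := by linarith
  have hn0 : 0 < n := by linarith
  have ht0 : 0 < t := by linarith
  have hp0 : 0 < p := by linarith
  have hs0 : 0 < s := by rw [hs]; positivity
  have hns : n - s = n * (n * (2 * p - q)) / (n * (2 * p - q) + 2 * q * (p - 1)) := by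
    rw [hs]; field_simp; ring
  have hss : sstar / s = (n * (2 * p - q) + 2 * q * (p - 1)) / (n * (2 * p - q)) := by
    rw [hsstar, hns]; field_simp
  have hsD : s * (n * (2 * p - q) + 2 * q * (p - 1)) = 2 * q * n * (p - 1) := by
    rw [hs]; field_simp
  have h2 : (1 - s / t) * (sstar / s) * ((2 * p - q) / (p * q)) =
      (n * (2 * p - q) + 2 * q * (p - 1)) / (n * p * q) - 2 * (p - 1) / (t * p) := by
    rw [hss]; field_simp; linear_combination -hsD
  rw [hβ, h2]
  field_simp
  ring

lemma aux_theta {n t p β θ ξ η : ℝ} (hn : 2 ≤ n) (ht : n < t) (hp : 1 < p)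
    (hβ : β = 1 - 1 / p + 2 * (1 - 1 / p) * (1 / n - 1 / t))
    (hξ : 0 < ξ) (hη : 0 < η)
    (heq1 : ξ / p + η = θ * ξ) (heq2 : β * ξ = θ * η) :
    1 < θ ∧ ξ * (p - 1) / (η * p) + ξ * (θ - 1) / η = 1 ∧
    n * (ξ * (θ - 1) / (2 * η) + (θ - 1) / 2) = (1 - n / t) * (ξ * (p - 1) / (η * p)) := by
  have hn0 : 0 < n := by linarith
  have ht0 : 0 < t := by linarith
  have hp0 : 0 < p := by linarith
  have hη' : η = (θ - 1 / p) * ξ := by linear_combination heq1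
  have hq : β = θ * (θ - 1 / p) := by
    have : β * ξ = (θ * (θ - 1 / p)) * ξ := by rw [heq2, hη']; ring
    exact mul_right_cancel₀ hξ.ne' this
  have hθ0 : 0 < θ := by
    have : 0 < θ * ξ := by rw [← heq1]; positivity
    exact pos_of_mul_pos_left this hξ.le
  have hpi : 1 / p < 1 := by rw [div_lt_one hp0]; exact hp
  have hni : 1 / t < 1 / n := one_div_lt_one_div_of_lt hn0 ht
  have hprod : (θ - 1) * (θ + 1 - 1 / p) = 2 * (1 - 1 / p) * (1 / n - 1 / t) := by
    linear_combination hβ - hq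
  have hpos : 0 < 2 * (1 - 1 / p) * (1 / n - 1 / t) :=
    mul_pos (mul_pos two_pos (by linarith)) (by linarith)
  have hθ : 1 < θ := by
    rw [← hprod] at hpos
    have := pos_of_mul_pos_left hpos (by linarith)
    linarith
  have hd : 0 < θ - 1 / p := by linarith
  refine ⟨hθ, ?_, ?_⟩
  · field_simp
    field_simp at heq1
    linear_combination -heq1
  · have e1 : ξ * (θ - 1) / (2 * η) + (θ - 1) / 2 = (θ - 1) * (θ + 1 - 1 / p) * (ξ / (2 * η)) := by
      have e0 : ξ + η = (θ + 1 - 1 / p) * ξ := by rw [hη']; ring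
      have e00 : ξ * (θ - 1) / (2 * η) + (θ - 1) / 2 = (θ - 1) * (ξ + η) / (2 * η) := by
        field_simp
      rw [e00, e0]; ring
    rw [e1, hprod]
    field_simp

lemma alg1 {n α t A B C r E M κ K ρ : ℝ} (ht : 0 < t) (hr : 0 < r) (hE : 0 < E) (hM : 0 < M)
    (hκ : 0 < κ) (hK : 0 < K) (hρ : 0 < ρ) (h : ρ ^ α = M * r / (K * E))
    (hAB : A + B = 1) (hN : n * (B / 2 + C) = α * A) :
    (2 ^ B * κ ^ (-(B / 2 + C)) * K ^ A) / r ^ A * (E ^ t) ^ (A / t) *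
      ((M / 2) ^ (2:ℝ) * (κ * ρ ^ n)) ^ (B / 2) * (κ * ρ ^ n) ^ C = M := by
  obtain ⟨r, rfl⟩ : ∃ a, r = Real.exp a := ⟨_, (Real.exp_log hr).symm⟩
  obtain ⟨E, rfl⟩ : ∃ a, E = Real.exp a := ⟨_, (Real.exp_log hE).symm⟩
  obtain ⟨M, rfl⟩ : ∃ a, M = Real.exp a := ⟨_, (Real.exp_log hM).symm⟩
  obtain ⟨κ, rfl⟩ : ∃ a, κ = Real.exp a := ⟨_, (Real.exp_log hκ).symm⟩
  obtain ⟨K, rfl⟩ : ∃ a, K = Real.exp a := ⟨_, (Real.exp_log hK).symm⟩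
  obtain ⟨ρ, rfl⟩ : ∃ a, ρ = Real.exp a := ⟨_, (Real.exp_log hρ).symm⟩
  obtain ⟨w, hw⟩ : ∃ w, (2:ℝ) = Real.exp w := ⟨_, (Real.exp_log two_pos).symm⟩
  have e : ((2:ℝ) ^ B) = Real.exp (w * B) := by rw [hw, ← Real.exp_mul]
  have e2 : Real.exp M / 2 = Real.exp (M - w) := by rw [Real.exp_sub, ← hw]
  rw [e, e2]
  simp only [← Real.exp_mul, ← Real.exp_add, ← Real.exp_sub] at h ⊢
  have h' := Real.exp_injective h
  congr 1
  have : E * t * (A / t) = E * A := by field_simp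
  rw [this]
  linear_combination A * h' + ρ * hN + M * hAB

lemma alg2 {n t A B C r M κ : ℝ} (ht : 0 < t) (hr : 0 < r) (hM : 0 < M)
    (hκ : 0 < κ)
    (hAB : A + B = 1) (hN : n * (B / 2 + C) = (1 - n / t) * A) :
    (2 * 2 ^ A * κ ^ (-(A / t + B / 2 + C))) / r ^ A * ((M / 2) ^ t * (κ * (r / 2) ^ n)) ^ (A / t) *
      ((M / 2) ^ (2:ℝ) * (κ * (r / 2) ^ n)) ^ (B / 2) * (κ * (r / 2) ^ n) ^ C = M := by
  obtain ⟨r, rfl⟩ : ∃ a, r = Real.exp a := ⟨_, (Real.exp_log hr).symm⟩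
  obtain ⟨M, rfl⟩ : ∃ a, M = Real.exp a := ⟨_, (Real.exp_log hM).symm⟩
  obtain ⟨κ, rfl⟩ : ∃ a, κ = Real.exp a := ⟨_, (Real.exp_log hκ).symm⟩
  obtain ⟨w, hw⟩ : ∃ w, (2:ℝ) = Real.exp w := ⟨_, (Real.exp_log two_pos).symm⟩
  have e : (2 * (2:ℝ) ^ A) = Real.exp (w + w * A) := by rw [Real.exp_add, Real.exp_mul, ← hw]
  have e2 : Real.exp M / 2 = Real.exp (M - w) := by rw [Real.exp_sub, ← hw]
  have e3 : Real.exp r / 2 = Real.exp (r - w) := by rw [Real.exp_sub, ← hw]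
  rw [e, e2, e3]
  simp only [← Real.exp_mul, ← Real.exp_add, ← Real.exp_sub]
  congr 1
  have : ((M - w) * t + (κ + (r - w) * n)) * (A / t) =
      (M - w) * A + κ * (A / t) + (r - w) * (n / t * A) := by field_simp; ring
  rw [this]
  linear_combination (M - w) * hAB + (r - w) * hN

lemma aux_S {N : ℕ} (hN : 2 ≤ N) {t : ℝ} (ht : (N:ℝ) < t)
    {u : EuclideanSpace ℝ (Fin N) → ℝ} {y x : EuclideanSpace ℝ (Fin N)} {r ρ k M : ℝ}
    (hu : ContDiffOn ℝ 1 u (ball y r)) (hρ : 0 < ρ) (hsub : ball x ρ ⊆ ball y r)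
    (hM : 0 < M) (hxu : u x = k + M)
    (hint : IntegrableOn (fun z => ‖gradient u z‖ ^ t) {z ∈ ball y r | k < u z})
    (hcond : 1 / (1 - N / t) * (volume (ball (0 : EuclideanSpace ℝ (Fin N)) 1)).toReal ^ (-(1 / t))
      * ρ ^ (1 - N / t) * (∫ z in {z ∈ ball y r | k < u z}, ‖gradient u z‖ ^ t) ^ (1 / t)
      ≤ M / 4) :
    (volume (ball (0 : EuclideanSpace ℝ (Fin N)) 1)).toReal / 2 * ρ ^ (N:ℝ) ≤
      (volume {z ∈ ball x ρ | k + M / 2 ≤ u z}).toReal := by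
  have hN' : (2:ℝ) ≤ N := by exact_mod_cast hN
  have ht0 : 0 < t := by linarith
  set A := {z ∈ ball y r | k < u z} with hA
  set ω := (volume (ball (0 : EuclideanSpace ℝ (Fin N)) 1)).toReal with hω
  have hω0 : 0 < ω := ENNReal.toReal_pos (measure_ball_pos _ _ one_pos).ne' measure_ball_lt_top.ne
  have huc := hu.continuousOn
  have hAo : IsOpen A := huc.isOpen_inter_preimage isOpen_ball isOpen_Ioi
  have hV : (volume (ball x ρ)).toReal = ω * ρ ^ (N:ℝ) := by
    rw [Measure.addHaar_ball_of_pos _ _ hρ, ENNReal.toReal_mul, ENNReal.toReal_ofReal (by positivity)]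
    simp [hω, mul_comm]
  set T := {z ∈ ball x ρ | u z < k + M / 2} with hTdef
  have hTo : IsOpen T := (huc.mono hsub).isOpen_inter_preimage isOpen_ball isOpen_Iio
  have hTs : T ⊆ ball x ρ := fun z hz => hz.1
  have hnorm : ∀ z, ‖gradient u z‖ = ‖fderiv ℝ u z‖ := fun z => by simp [gradient]
  have hgm : Measurable (fun z => ‖gradient u z‖) := by
    simp only [hnorm]
    exact (measurable_fderiv ℝ u).norm
  have hgm' : Measurable (fun z => ‖gradient u z‖ₑ) := by
    simp only [← ofReal_norm]
    exact hgm.ennreal_ofReal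
  have hfm : Measurable (A.indicator (fun z => ‖gradient u z‖ₑ)) :=
    hgm'.indicator hAo.measurableSet
  have main := aux_morrey hN ht x (ρ := ρ) (m := M / 2) _ hfm T hTo.measurableSet hTs (by
    intro z hz
    refine (aux_line hu (hsub (mem_ball_self hρ)) (hsub hz.1) hM hxu hz.2).trans ?_
    gcongr
    rw [← ofReal_norm]
    apply ENNReal.ofReal_le_ofReal
    have := hz.1
    rw [mem_ball, dist_eq_norm] at this
    exact this.le)
  have hI : ∫⁻ z, (A.indicator (fun z => ‖gradient u z‖ₑ)) z ^ t =
      ENNReal.ofReal (∫ z in A, ‖gradient u z‖ ^ t) := by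
    rw [ofReal_integral_eq_lintegral_ofReal hint
      (Filter.Eventually.of_forall fun z => by positivity), ← lintegral_indicator hAo.measurableSet]
    congr 1 with z
    by_cases hz : z ∈ A
    · simp only [indicator_of_mem hz]
      rw [← ofReal_norm, ENNReal.ofReal_rpow_of_nonneg (norm_nonneg _) ht0.le]
    · simp [indicator_of_notMem hz, ht0]
  set G := ∫ z in A, ‖gradient u z‖ ^ t with hG
  have hG0 : 0 ≤ G := integral_nonneg fun z => by positivity
  have h1N : 0 < 1 - N / t := by
    rw [sub_pos, div_lt_one ht0]; exact ht
  have hTt : volume T ≠ ⊤ := (measure_mono hTs |>.trans_lt measure_ball_lt_top).ne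
  have h1t : 0 ≤ 1 - 1 / t := by
    rw [sub_nonneg, div_le_one ht0]; linarith
  rw [hI] at main
  have main' := ENNReal.toReal_mono (by
    refine ENNReal.mul_ne_top ENNReal.ofReal_ne_top (ENNReal.mul_ne_top ENNReal.ofReal_ne_top
      (ENNReal.mul_ne_top ?_ ?_))
    · exact ENNReal.rpow_ne_top_of_nonneg (by positivity) ENNReal.ofReal_ne_top
    · exact ENNReal.rpow_ne_top_of_nonneg h1t measure_ball_lt_top.ne) main
  simp only [ENNReal.toReal_mul, ← ENNReal.toReal_rpow, hV, ENNReal.toReal_ofReal hG0,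
    ENNReal.toReal_ofReal hρ.le, ENNReal.toReal_ofReal (half_pos hM).le,
    ENNReal.toReal_ofReal (one_div_pos.2 h1N).le] at main'
  have hVpos : 0 < ω * ρ ^ (N:ℝ) := by positivity
  have hid : ρ * (1 / (1 - N / t) * (G ^ (1 / t) * (ω * ρ ^ (N:ℝ)) ^ (1 - 1 / t))) =
      (ω * ρ ^ (N:ℝ)) * (1 / (1 - N / t) * ω ^ (-(1 / t)) * ρ ^ (1 - N / t) * G ^ (1 / t)) := by
    have e1 : (ω * ρ ^ (N:ℝ)) ^ (1 - 1 / t) =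
        (ω * ρ ^ (N:ℝ)) * (ω ^ (-(1 / t)) * ρ ^ (-(N / t))) := by
      rw [sub_eq_add_neg, Real.rpow_add hVpos, Real.rpow_one, Real.mul_rpow hω0.le (by positivity),
        ← Real.rpow_mul hρ.le]
      congr 3
      ring
    have e2 : ρ ^ (1 - N / t) = ρ * ρ ^ (-(N / t)) := by
      rw [sub_eq_add_neg, Real.rpow_add hρ, Real.rpow_one]
    rw [e1, e2]; ring
  rw [hid] at main'
  have h3 := main'.trans (mul_le_mul_of_nonneg_left hcond hVpos.le)
  have hTle : (volume T).toReal ≤ ω * ρ ^ (N:ℝ) / 2 := by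
    have : (M / 2) * (volume T).toReal ≤ (M / 2) * (ω * ρ ^ (N:ℝ) / 2) := by linarith
    exact le_of_mul_le_mul_left this (half_pos hM)
  have hcover : ball x ρ ⊆ T ∪ {z ∈ ball x ρ | k + M / 2 ≤ u z} := by
    intro z hz
    rcases lt_or_ge (u z) (k + M / 2) with h | h
    · exact Or.inl ⟨hz, h⟩
    · exact Or.inr ⟨hz, h⟩
  have hSt : volume {z ∈ ball x ρ | k + M / 2 ≤ u z} ≠ ⊤ :=
    (measure_mono (fun z hz => hz.1) |>.trans_lt (measure_ball_lt_top (x := x) (r := ρ))).ne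
  have h4 := ENNReal.toReal_mono (ENNReal.add_ne_top.2 ⟨hTt, hSt⟩)
    ((measure_mono hcover).trans (measure_union_le _ _))
  rw [ENNReal.toReal_add hTt hSt, hV] at h4
  linarith

lemma aux_cheb {N : ℕ} {u : EuclideanSpace ℝ (Fin N) → ℝ} {k M e : ℝ}
    {A S : Set (EuclideanSpace ℝ (Fin N))} (hS : MeasurableSet S)
    (hSA : S ⊆ A) (hAf : volume A ≠ ⊤) (hM : 0 < M) (he : 0 ≤ e)
    (hSu : ∀ z ∈ S, k + M / 2 ≤ u z)
    (hint : IntegrableOn (fun z => |u z - k| ^ e) A) {v : ℝ} (hv : v ≤ (volume S).toReal) :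
    (M / 2) ^ e * v ≤ ∫ z in A, |u z - k| ^ e := by
  calc (M / 2) ^ e * v ≤ (M / 2) ^ e * (volume S).toReal := by gcongr
    _ = ∫ z in S, (M / 2) ^ e := by simp [Measure.real, mul_comm]
    _ ≤ ∫ z in S, |u z - k| ^ e := by
      refine setIntegral_mono_on ?_ (hint.mono_set hSA) hS fun z hz => ?_
      · exact integrableOn_const ((measure_mono hSA).trans_lt (lt_top_iff_ne_top.2 hAf)).ne
      · have := hSu z hz
        exact Real.rpow_le_rpow (by positivity) (le_trans (by linarith) (le_abs_self _)) he
    _ ≤ _ := setIntegral_mono_set hint (Filter.Eventually.of_forall fun z => by positivity)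
        hSA.eventuallyLE

set_option maxHeartbeats 1600000 in
/-- Theorem 3.1 (De Giorgi type sup estimate): for `u ∈ W^{1,t}`, `t > N`,
`sup_{B(y,r/2)} u ≤ k + d` with `d` given explicitly in terms of level data at level `k`
on `B(y,r)`. -/
theorem stmt3 (N : ℕ) (hN : 2 ≤ N) (t p q s sstar β θ ξ η : ℝ)
    (ht : (N : ℝ) < t) (hp : 1 < p) (hq2 : 2 < q) (hq : q < 2 * p)
    (hs : s = 2 * q * N * (p - 1) / (N * (2 * p - q) + 2 * q * (p - 1)))
    (hs1 : 1 < s) (hsN : s < (N : ℝ))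
    (hsstar : sstar = N * s / (N - s))
    (hβ : β = 1 - 2 / q + (1 - s / t) * (sstar / s) * ((2 * p - q) / (p * q)))
    (hθ : θ = (1 / p + Real.sqrt (1 / p ^ 2 + 4 * β)) / 2)
    (hξ : 0 < ξ) (hη : 0 < η)
    (heq1 : ξ / p + η = θ * ξ) (heq2 : β * ξ = θ * η) :
    ∃ c > (0 : ℝ), ∀ (Ω : Set (EuclideanSpace ℝ (Fin N))),
      IsOpen Ω → IsBounded Ω →
      ∀ u : EuclideanSpace ℝ (Fin N) → ℝ,
        ContDiffOn ℝ 1 u Ω →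
        IntegrableOn (fun x => |u x| ^ t) Ω →
        IntegrableOn (fun x => ‖gradient u x‖ ^ t) Ω →
        ∀ (k : ℝ) (y : EuclideanSpace ℝ (Fin N)) (r : ℝ),
          y ∈ Ω → 0 < r → r < infDist y (frontier Ω) →
          ∀ x ∈ ball y (r / 2),
            u x ≤ k +
              c / r ^ (ξ * (p - 1) / (η * p)) *
                ((∫ z in {z ∈ ball y r | k < u z}, |u z - k| ^ t) +
                  r ^ t * ∫ z in {z ∈ ball y r | k < u z}, ‖gradient u z‖ ^ t) ^
                    (ξ * (p - 1) / (t * p * η)) *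
                (∫ z in {z ∈ ball y r | k < u z}, |u z - k| ^ 2) ^ (ξ * (θ - 1) / (2 * η)) *
                (volume {z ∈ ball y r | k < u z}).toReal ^ ((θ - 1) / 2) := by
  have hN' : (2:ℝ) ≤ N := by exact_mod_cast hN
  have ht0 : 0 < t := by linarith
  obtain ⟨hθ1, hAB, hNC⟩ := aux_theta hN' ht hp
    (aux_beta hN' ht hp hq2 hq hs hsstar hβ) hξ hη heq1 heq2
  set A := ξ * (p - 1) / (η * p) with hA
  set C := (θ - 1) / 2 with hC
  obtain ⟨B, hB⟩ : ∃ B, B = ξ * (θ - 1) / η := ⟨_, rfl⟩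
  have hB2 : ξ * (θ - 1) / (2 * η) = B / 2 := by rw [hB]; field_simp
  have hAt : ξ * (p - 1) / (t * p * η) = A / t := by rw [hA]; field_simp
  rw [← hB] at hAB
  rw [hB2] at hNC
  rw [hB2, hAt]
  have hp1 : 0 < p - 1 := by linarith
  have hp0 : 0 < p := by linarith
  have hθ0 : 0 < θ - 1 := by linarith
  have hA0 : 0 < A := by positivity
  have hB0 : 0 < B := by rw [hB]; positivity
  have hC0 : 0 < C := by positivity
  have hα : 0 < 1 - (N:ℝ) / t := by rw [sub_pos, div_lt_one ht0]; exact ht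
  set ω := (volume (ball (0 : EuclideanSpace ℝ (Fin N)) 1)).toReal with hω
  have hω0 : 0 < ω := ENNReal.toReal_pos (measure_ball_pos _ _ one_pos).ne' measure_ball_lt_top.ne
  set κ := ω / 2 with hκ
  have hκ0 : 0 < κ := by positivity
  set α := 1 - (N:ℝ) / t with hαdef
  set K := 1 / α * ω ^ (-(1 / t)) with hK
  have hK0 : 0 < K := by positivity
  set c₁ := 2 ^ B * κ ^ (-(B / 2 + C)) * (4 * K) ^ A with hc₁
  set c₂ := 2 * 2 ^ A * κ ^ (-(A / t + B / 2 + C)) with hc₂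
  have hc₁0 : 0 < c₁ := by positivity
  have hc₂0 : 0 < c₂ := by positivity
  refine ⟨c₁ + c₂, by positivity, ?_⟩
  intro Ω hΩ _ u hu _ _ k y r hy hr hrd x hx
  have hcb : closedBall y r ⊆ Ω := by
    have hd : Disjoint (closedBall y r) (frontier Ω) := by
      rw [Set.disjoint_left]
      intro z hz hzf
      have h1 := infDist_le_dist_of_mem (x := y) hzf
      rw [mem_closedBall, dist_comm] at hz
      linarith
    have hpre : IsPreconnected (closedBall y r) := (convex_closedBall y r).isPreconnected
    by_contra hns
    obtain ⟨z, hz, hzΩ⟩ := Set.not_subset.1 hns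
    have := isPreconnected_iff_subset_of_disjoint.1 hpre Ω (closure Ω)ᶜ hΩ
      isClosed_closure.isOpen_compl (by
        intro w hw
        by_cases hwΩ : w ∈ Ω
        · exact Or.inl hwΩ
        · refine Or.inr fun hwc => Set.disjoint_left.1 hd hw ?_
          rw [hΩ.frontier_eq]
          exact ⟨hwc, hwΩ⟩) (by
        ext w
        simp only [mem_inter_iff, mem_compl_iff, mem_empty_iff_false, iff_false]
        rintro ⟨_, h1, h2⟩
        exact h2 (subset_closure h1))
    rcases this with h | h
    · exact hzΩ (h hz)
    · exact h (mem_closedBall_self hr.le) (subset_closure hy)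
  have hbcb : ball y r ⊆ closedBall y r := ball_subset_closedBall
  have hub : ContDiffOn ℝ 1 u (ball y r) := hu.mono (hbcb.trans hcb)
  have hnorm : ∀ z, ‖gradient u z‖ = ‖fderiv ℝ u z‖ := fun z => by simp [gradient]
  have hgc : ContinuousOn (fun z => ‖gradient u z‖ ^ t) (closedBall y r) := by
    simp only [hnorm]
    exact (((hu.continuousOn_fderiv_of_isOpen hΩ le_rfl).mono hcb).norm).rpow_const
      (fun _ _ => Or.inr ht0.le)
  have huc : ∀ e : ℝ, 0 ≤ e → ContinuousOn (fun z => |u z - k| ^ e) (closedBall y r) := fun e he =>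
    (((hu.continuousOn.mono hcb).sub continuousOn_const).abs).rpow_const (fun _ _ => Or.inr he)
  set D := {z ∈ ball y r | k < u z} with hD
  have hDo : IsOpen D := hub.continuousOn.isOpen_inter_preimage isOpen_ball isOpen_Ioi
  have hDs : D ⊆ closedBall y r := fun z hz => hbcb hz.1
  have hDf : volume D ≠ ⊤ := (measure_mono hDs |>.trans_lt measure_closedBall_lt_top).ne
  have hgi : IntegrableOn (fun z => ‖gradient u z‖ ^ t) D :=
    (hgc.integrableOn_compact (isCompact_closedBall y r)).mono_set hDs
  have hui : ∀ e : ℝ, 0 ≤ e → IntegrableOn (fun z => |u z - k| ^ e) D := fun e he =>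
    ((huc e he).integrableOn_compact (isCompact_closedBall y r)).mono_set hDs
  have hJ : ∫ z in D, |u z - k| ^ 2 = ∫ z in D, |u z - k| ^ (2:ℝ) := by
    simp only [Real.rpow_two]
  rw [hJ]
  set G := ∫ z in D, ‖gradient u z‖ ^ t with hG
  set U := ∫ z in D, |u z - k| ^ t with hU
  set J := ∫ z in D, |u z - k| ^ (2:ℝ) with hJdef
  set v := (volume D).toReal with hv
  have hG0 : 0 ≤ G := integral_nonneg fun z => by positivity
  have hU0 : 0 ≤ U := integral_nonneg fun z => by positivity
  have hJ0 : 0 ≤ J := integral_nonneg fun z => by positivity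
  have hv0 : 0 ≤ v := ENNReal.toReal_nonneg
  have hI0 : 0 ≤ U + r ^ t * G := by positivity
  rcases le_or_gt (u x) k with hle | hgt
  · have : 0 ≤ (c₁ + c₂) / r ^ A * (U + r ^ t * G) ^ (A / t) * J ^ (B / 2) * v ^ C := by positivity
    linarith
  obtain ⟨M, hM⟩ : ∃ M, M = u x - k := ⟨_, rfl⟩
  have hM0 : 0 < M := by linarith
  have hxu : u x = k + M := by linarith
  suffices hmain : M ≤ (c₁ + c₂) / r ^ A * (U + r ^ t * G) ^ (A / t) * J ^ (B / 2) * v ^ C by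
    linarith
  -- lower bounds from a good radius
  have good : ∀ ρ, 0 < ρ → ρ ≤ r / 2 → K * ρ ^ α * G ^ (1 / t) ≤ M / 4 →
      (M / 2) ^ (2:ℝ) * (κ * ρ ^ (N:ℝ)) ≤ J ∧ (M / 2) ^ t * (κ * ρ ^ (N:ℝ)) ≤ U ∧
        κ * ρ ^ (N:ℝ) ≤ v := by
    intro ρ hρ hρr hc
    have hsub : ball x ρ ⊆ ball y r := by
      apply ball_subset_ball'
      rw [mem_ball] at hx
      linarith
    have hS := aux_S hN ht hub hρ hsub hM0 hxu hgi hc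
    have hSD : {z ∈ ball x ρ | k + M / 2 ≤ u z} ⊆ D := fun z hz =>
      ⟨hsub hz.1, by have : k + M / 2 ≤ u z := hz.2; linarith⟩
    have hSm : MeasurableSet {z ∈ ball x ρ | k + M / 2 ≤ u z} := by
      have : {z ∈ ball x ρ | k + M / 2 ≤ u z} = ball x ρ \ {z ∈ ball x ρ | u z < k + M / 2} := by
        ext z
        simp only [mem_ofPred_eq, mem_sdiff, not_and, not_lt]
        exact ⟨fun h => ⟨h.1, fun _ => h.2⟩, fun h => ⟨h.1, h.2 h.1⟩⟩
      rw [this]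
      refine measurableSet_ball.diff (IsOpen.measurableSet ?_)
      exact (hub.continuousOn.mono hsub).isOpen_inter_preimage isOpen_ball isOpen_Iio
    refine ⟨?_, ?_, ?_⟩
    · exact aux_cheb hSm hSD hDf hM0 (by norm_num) (fun z hz => hz.2) (hui 2 (by norm_num)) hS
    · exact aux_cheb hSm hSD hDf hM0 ht0.le (fun z hz => hz.2) (hui t ht0.le) hS
    · exact hS.trans (ENNReal.toReal_mono hDf (measure_mono hSD))
  obtain ⟨E, hE⟩ : ∃ E, E = (U + r ^ t * G) ^ (1 / t) := ⟨_, rfl⟩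
  have hE0 : 0 ≤ E := by rw [hE]; positivity
  have hEt : E ^ t = U + r ^ t * G := by
    rw [hE, ← Real.rpow_mul hI0]
    simp [ht0.ne']
  have hGE : G ^ (1 / t) ≤ E / r := by
    rw [le_div_iff₀ hr, hE]
    have : r = (r ^ t) ^ (1 / t) := by
      rw [← Real.rpow_mul hr.le]; simp [ht0.ne']
    nth_rewrite 1 [this]
    rw [← Real.mul_rpow hG0 (by positivity)]
    apply Real.rpow_le_rpow (by positivity) _ (by positivity)
    linarith
  have hr2 : 0 < r / 2 := by positivity
  rcases le_or_gt (K * (r / 2) ^ α * (E / r)) (M / 4) with hcase | hcase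
  · obtain ⟨h1, h2, h3⟩ := good (r / 2) hr2 le_rfl (le_trans (by gcongr) hcase)
    calc M = c₂ / r ^ A * ((M / 2) ^ t * (κ * (r / 2) ^ (N:ℝ))) ^ (A / t) *
          ((M / 2) ^ (2:ℝ) * (κ * (r / 2) ^ (N:ℝ))) ^ (B / 2) * (κ * (r / 2) ^ (N:ℝ)) ^ C :=
          (alg2 ht0 hr hM0 hκ0 hAB hNC).symm
      _ ≤ _ := by
        have h4 : c₂ ≤ c₁ + c₂ := by linarith
        have h5 : (M / 2) ^ t * (κ * (r / 2) ^ (N:ℝ)) ≤ U + r ^ t * G := by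
          have : 0 ≤ r ^ t * G := by positivity
          linarith
        gcongr
  · have hEpos : 0 < E := by
      rcases hE0.eq_or_lt with h | h
      · rw [← h] at hcase
        simp at hcase
        linarith
      · exact h
    set ρ := (M * r / (4 * K * E)) ^ (1 / α) with hρ
    have hρ0 : 0 < ρ := by positivity
    have hρα : ρ ^ α = M * r / (4 * K * E) := by
      rw [hρ, ← Real.rpow_mul (by positivity)]
      simp [hα.ne']
    have hρr : ρ ≤ r / 2 := by
      rw [← Real.rpow_le_rpow_iff hρ0.le hr2.le hα, hρα, div_le_iff₀ (by positivity)]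
      have h6 : K * (r / 2) ^ α * (E / r) = K * (r / 2) ^ α * E / r := by ring
      rw [h6, lt_div_iff₀ hr] at hcase
      linarith
    have hcond : K * ρ ^ α * (E / r) = M / 4 := by
      rw [hρα]; field_simp
    obtain ⟨h1, h2, h3⟩ := good ρ hρ0 hρr (le_trans (by gcongr) hcond.le)
    calc M = c₁ / r ^ A * (E ^ t) ^ (A / t) *
          ((M / 2) ^ (2:ℝ) * (κ * ρ ^ (N:ℝ))) ^ (B / 2) * (κ * ρ ^ (N:ℝ)) ^ C :=
          (alg1 ht0 hr hEpos hM0 hκ0 (by positivity) hρ0 hρα hAB hNC).symm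
      _ ≤ _ := by
        have h4 : c₁ ≤ c₁ + c₂ := by linarith
        rw [hEt]
        gcongr
end

section
/- Let N ≥ 2, Ω ⊂ ℝ^N open and bounded, t > N, p > 1 and 2 < q < 2p; set s := 2qN(p−1)/(N(2p−q)+2q(p−1)) and assume 1 < s < N; set s* := Ns/(N−s), β := 1 − 2/q + (1 − s/t)·(s*/s)·(2p−q)/(pq), θ := (1/p + √(1/p² + 4β))/2, and let ξ, η > 0 be a positive solution of ξ/p + η = θξ and βξ = θη. There exists a constant c > 0 depending only on N, t, p, q such that for every continuously differentiable u : Ω → ℝ with |∇u|^t and |∇u|² integrable over Ω, every x₀ ∈ Ω and every 0 < r < dist(x₀, ∂Ω): sup_{B(x₀,r/2)} u ≤ inf_{B(x₀,r/2)} u + c · r^{(ξ/η + N/2)(θ−1)} · ( ∫_{B(x₀,r)} |∇u|^t dx )^{(ξ/η)·(p−1)/(tp)} · ( ∫_{B(x₀,r)} |∇u|² dx )^{ξ(θ−1)/(2η)}. -/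
open MeasureTheory Metric Set Bornology

section helpers

open scoped ENNReal

lemma aux_scale_s6 {N : ℕ} (F : EuclideanSpace ℝ (Fin N) → ℝ≥0∞) (hF : Measurable F)
    (x₀ x : EuclideanSpace ℝ (Fin N)) (r τ : ℝ) (hx : x ∈ ball x₀ r) (h0 : 0 < τ) (h1 : τ < 1) :
    ∫⁻ z in ball x₀ r, F (x + τ • (z - x)) ≤
      ENNReal.ofReal (τ ^ (-(N : ℝ))) * ∫⁻ z in ball x₀ r, F z := by
  set G : EuclideanSpace ℝ (Fin N) → ℝ≥0∞ := (ball x₀ r).indicator F with hG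
  have hGm : Measurable G := hF.indicator measurableSet_ball
  have key : ∫⁻ z, G (τ • z + (x - τ • x)) =
      ENNReal.ofReal (τ ^ (-(N : ℝ))) * ∫⁻ z, G z := by
    have e1 : ∫⁻ z, G (τ • z + (x - τ • x)) =
        ∫⁻ w, G (w + (x - τ • x)) ∂(Measure.map (fun z : EuclideanSpace ℝ (Fin N) => τ • z) volume) := by
      rw [lintegral_map (f := fun w => G (w + (x - τ • x))) (by fun_prop) (by fun_prop)]
    rw [e1, Measure.map_addHaar_smul _ h0.ne', lintegral_smul_measure,
      lintegral_add_right_eq_self G, smul_eq_mul]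
    congr 2
    rw [finrank_euclideanSpace_fin, abs_of_pos (by positivity), Real.rpow_neg h0.le,
      Real.rpow_natCast]
  calc ∫⁻ z in ball x₀ r, F (x + τ • (z - x))
      = ∫⁻ z in ball x₀ r, G (τ • z + (x - τ • x)) := by
        apply setLIntegral_congr_fun measurableSet_ball
        intro z hz
        have e : τ • z + (x - τ • x) = x + τ • (z - x) := by rw [smul_sub]; abel
        have hm : x + τ • (z - x) ∈ ball x₀ r :=
          (convex_ball x₀ r).add_smul_sub_mem hx hz ⟨h0.le, h1.le⟩
        simp only [e, hG, indicator_of_mem hm]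
    _ ≤ ∫⁻ z, G (τ • z + (x - τ • x)) := setLIntegral_le_lintegral _ _
    _ = _ := by rw [key, hG, lintegral_indicator measurableSet_ball]

lemma aux_holder {α : Type*} [MeasurableSpace α] (μ : Measure α) (h : α → ℝ≥0∞)
    (hh : Measurable h) (t b d : ℝ) (hb : 0 ≤ b) (hd : 0 ≤ d) (ht : 0 ≤ t) (hbd : b + d ≤ 1)
    (hs : b * t + 2 * d = 1) :
    ∫⁻ z, h z ∂μ ≤
      (μ univ) ^ (1 - b - d) * ((∫⁻ z, h z ^ t ∂μ) ^ b * (∫⁻ z, h z ^ (2 : ℝ) ∂μ) ^ d) := by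
  have := ENNReal.lintegral_prod_norm_pow_le (μ := μ) (Finset.univ : Finset (Fin 3))
    (f := ![fun _ => 1, fun z => h z ^ t, fun z => h z ^ (2 : ℝ)])
    (p := ![1 - b - d, b, d])
    (by intro i _; fin_cases i <;> simp <;> fun_prop)
    (by simp [Fin.sum_univ_three]; ring)
    (by intro i _; fin_cases i <;> simp <;> linarith)
  simp only [Fin.prod_univ_three] at this
  simp only [Matrix.cons_val_zero, Matrix.cons_val_one, Matrix.cons_val, ENNReal.one_rpow, one_mul,
    lintegral_one, mul_assoc] at this
  refine le_trans (le_of_eq ?_) this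
  refine lintegral_congr fun z => ?_
  rw [← ENNReal.rpow_mul, ← ENNReal.rpow_mul, ← ENNReal.rpow_add_of_nonneg _ _ (by positivity) (by positivity),
    show t * b + 2 * d = 1 by linarith, ENNReal.rpow_one]

lemma aux_point {N : ℕ} (u : EuclideanSpace ℝ (Fin N) → ℝ)
    (x₀ x z : EuclideanSpace ℝ (Fin N)) (r : ℝ) (hu : ContDiffOn ℝ 1 u (ball x₀ r))
    (hx : x ∈ ball x₀ r) (hz : z ∈ ball x₀ r) :
    ‖u z - u x‖ₑ ≤ ENNReal.ofReal (2 * r) *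
      ∫⁻ τ in Ioo (0 : ℝ) 1, ‖fderiv ℝ u (x + τ • (z - x))‖ₑ := by
  have hmem : ∀ τ ∈ Icc (0 : ℝ) 1, x + τ • (z - x) ∈ ball x₀ r := fun τ hτ =>
    (convex_ball x₀ r).add_smul_sub_mem hx hz hτ
  have hc : ContDiffOn ℝ 1 (fun τ : ℝ => u (x + τ • (z - x))) (Icc 0 1) := by
    apply hu.comp (t := ball x₀ r) (f := fun τ : ℝ => x + τ • (z - x)) _ hmem
    fun_prop
  have := enorm_sub_le_lintegral_deriv_of_contDiffOn_Icc hc zero_le_one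
  simp only [one_smul, zero_smul, add_zero, add_sub_cancel] at this
  refine this.trans ?_
  rw [restrict_Ioo_eq_restrict_Icc, ← lintegral_const_mul' _ _ ENNReal.ofReal_ne_top]
  apply setLIntegral_mono' measurableSet_Icc
  intro τ hτ
  have hd : DifferentiableAt ℝ u (x + τ • (z - x)) :=
    (hu.differentiableOn one_ne_zero).differentiableAt (isOpen_ball.mem_nhds (hmem τ hτ))
  have hl : HasDerivAt (fun τ : ℝ => x + τ • (z - x)) (z - x) τ := by
    simpa using ((hasDerivAt_id τ).smul_const (z - x)).const_add x
  have hD := hd.hasFDerivAt.comp_hasDerivAt τ hl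
  have hD' : deriv (fun τ : ℝ => u (x + τ • (z - x))) τ = fderiv ℝ u (x + τ • (z - x)) (z - x) :=
    hD.deriv
  rw [hD', mul_comm]
  refine (ContinuousLinearMap.le_opENorm _ _).trans ?_
  gcongr
  rw [← ofReal_norm]
  apply ENNReal.ofReal_le_ofReal
  rw [← dist_eq_norm]
  have h1 := dist_triangle_right z x x₀
  rw [mem_ball] at hx hz
  linarith

lemma aux_int {N : ℕ} (u : EuclideanSpace ℝ (Fin N) → ℝ)
    (x₀ x : EuclideanSpace ℝ (Fin N)) (r : ℝ) (hu : ContDiffOn ℝ 1 u (ball x₀ r))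
    (hx : x ∈ ball x₀ r)
    (t b d : ℝ) (hb : 0 ≤ b) (hd : 0 ≤ d) (ht : 0 ≤ t) (hbd : b + d ≤ 1)
    (hs : b * t + 2 * d = 1) :
    ∫⁻ z in ball x₀ r, ‖u z - u x‖ₑ ≤ ENNReal.ofReal (2 * r) *
      ((∫⁻ τ in Ioo (0 : ℝ) 1, ENNReal.ofReal (τ ^ (-(N * (b + d))))) *
        (volume (ball x₀ r) ^ (1 - b - d) *
        ((∫⁻ z in ball x₀ r, ‖fderiv ℝ u z‖ₑ ^ t) ^ b *
        (∫⁻ z in ball x₀ r, ‖fderiv ℝ u z‖ₑ ^ (2 : ℝ)) ^ d))) := by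
  have hm : Measurable (fun z => ‖fderiv ℝ u z‖ₑ) := (measurable_fderiv ℝ u).enorm
  calc ∫⁻ z in ball x₀ r, ‖u z - u x‖ₑ
      ≤ ∫⁻ z in ball x₀ r, ENNReal.ofReal (2 * r) *
      ∫⁻ τ in Ioo (0 : ℝ) 1, ‖fderiv ℝ u (x + τ • (z - x))‖ₑ :=
        setLIntegral_mono' measurableSet_ball fun z hz => aux_point u x₀ x z r hu hx hz
    _ = ENNReal.ofReal (2 * r) * ∫⁻ τ in Ioo (0 : ℝ) 1, ∫⁻ z in ball x₀ r,
          ‖fderiv ℝ u (x + τ • (z - x))‖ₑ := by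
        rw [lintegral_const_mul' _ _ ENNReal.ofReal_ne_top, lintegral_lintegral_swap]
        apply Measurable.aemeasurable
        exact hm.comp (g := fun z => ‖fderiv ℝ u z‖ₑ)
          (f := fun a : EuclideanSpace ℝ (Fin N) × ℝ => x + a.2 • (a.1 - x)) (by fun_prop)
    _ ≤ _ := by
        gcongr
        rw [← lintegral_mul_const _ (by fun_prop)]
        apply setLIntegral_mono' measurableSet_Ioo
        intro τ hτ
        have h1 := aux_holder (volume.restrict (ball x₀ r))
          (fun z => ‖fderiv ℝ u (x + τ • (z - x))‖ₑ)
          (hm.comp (g := fun z => ‖fderiv ℝ u z‖ₑ) (f := fun z => x + τ • (z - x)) (by fun_prop))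
          t b d hb hd ht hbd hs
        refine h1.trans ?_
        rw [Measure.restrict_apply_univ]
        have h2 := aux_scale_s6 (fun z => ‖fderiv ℝ u z‖ₑ ^ t) (by fun_prop) x₀ x r τ hx hτ.1 hτ.2
        have h3 := aux_scale_s6 (fun z => ‖fderiv ℝ u z‖ₑ ^ (2 : ℝ)) (by fun_prop) x₀ x r τ hx hτ.1 hτ.2
        have h4 : ENNReal.ofReal (τ ^ (-(N * (b + d)))) =
            ENNReal.ofReal (τ ^ (-(N : ℝ))) ^ b * ENNReal.ofReal (τ ^ (-(N : ℝ))) ^ d := by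
          rw [← ENNReal.rpow_add_of_nonneg _ _ hb hd,
            ENNReal.ofReal_rpow_of_nonneg (Real.rpow_nonneg hτ.1.le _) (by positivity),
            ← Real.rpow_mul hτ.1.le]
          congr 2; ring
        calc _ ≤ volume (ball x₀ r) ^ (1 - b - d) *
            ((ENNReal.ofReal (τ ^ (-(N : ℝ))) * ∫⁻ z in ball x₀ r, ‖fderiv ℝ u z‖ₑ ^ t) ^ b *
             (ENNReal.ofReal (τ ^ (-(N : ℝ))) * ∫⁻ z in ball x₀ r, ‖fderiv ℝ u z‖ₑ ^ (2 : ℝ)) ^ d) := by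
              gcongr
          _ = _ := by
            rw [ENNReal.mul_rpow_of_nonneg _ _ hb, ENNReal.mul_rpow_of_nonneg _ _ hd, h4]
            ring

lemma aux_main {N : ℕ} (hN : 1 ≤ N) (t b d : ℝ) (hb : 0 ≤ b) (hd : 0 ≤ d) (ht : 0 ≤ t)
    (hbd : N * (b + d) < 1) (hs : b * t + 2 * d = 1) :
    ∃ c > (0 : ℝ), ∀ (u : EuclideanSpace ℝ (Fin N) → ℝ) (x₀ : EuclideanSpace ℝ (Fin N)) (r : ℝ),
      0 < r → ContDiffOn ℝ 1 u (ball x₀ r) →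
      IntegrableOn (fun x => ‖gradient u x‖ ^ t) (ball x₀ r) →
      IntegrableOn (fun x => ‖gradient u x‖ ^ 2) (ball x₀ r) →
      ∀ x ∈ ball x₀ r, ∀ y ∈ ball x₀ r,
        u x ≤ u y + c * r ^ (1 - N * (b + d)) *
          (∫ z in ball x₀ r, ‖gradient u z‖ ^ t) ^ b *
          (∫ z in ball x₀ r, ‖gradient u z‖ ^ 2) ^ d := by
  have : Nonempty (Fin N) := ⟨⟨0, hN⟩⟩
  have hN1 : (1 : ℝ) ≤ N := by exact_mod_cast hN
  have hbd1 : b + d ≤ 1 := by nlinarith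
  set K : ℝ≥0∞ := ∫⁻ τ in Ioo (0 : ℝ) 1, ENNReal.ofReal (τ ^ (-(N * (b + d)))) with hK
  have hKfin : K ≠ ⊤ := by
    have hi : IntegrableOn (fun τ : ℝ => τ ^ (-(N * (b + d)))) (Ioo (0 : ℝ) 1) :=
      (intervalIntegral.integrableOn_Ioo_rpow_iff one_pos).2 (by linarith)
    have := hi.lintegral_lt_top
    exact this.ne
  set ω : ℝ := (volume (ball (0 : EuclideanSpace ℝ (Fin N)) 1)).toReal with hω
  have hω0 : 0 < ω := ENNReal.toReal_pos (measure_ball_pos _ _ one_pos).ne' measure_ball_lt_top.ne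
  refine ⟨4 * (K.toReal + 1) * ω ^ (-(b + d)), by positivity, ?_⟩
  intro u x₀ r hr hu hT hD x hx y hy
  have hg : ∀ z, ‖gradient u z‖ = ‖fderiv ℝ u z‖ := fun z => by simp [gradient]
  simp only [hg] at hT hD ⊢
  set T := ∫ z in ball x₀ r, ‖fderiv ℝ u z‖ ^ t with hTd
  set D := ∫ z in ball x₀ r, ‖fderiv ℝ u z‖ ^ 2 with hDd
  have hT0 : 0 ≤ T := integral_nonneg fun z => by positivity
  have hD0 : 0 ≤ D := integral_nonneg fun z => by positivity
  have eT : ∫⁻ z in ball x₀ r, ‖fderiv ℝ u z‖ₑ ^ t = ENNReal.ofReal T := by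
    rw [hTd, ofReal_integral_eq_lintegral_ofReal hT (ae_of_all _ fun z => by positivity)]
    refine lintegral_congr fun z => ?_
    rw [← ofReal_norm, ENNReal.ofReal_rpow_of_nonneg (norm_nonneg _) ht]
  have eD : ∫⁻ z in ball x₀ r, ‖fderiv ℝ u z‖ₑ ^ (2 : ℝ) = ENNReal.ofReal D := by
    rw [hDd, ofReal_integral_eq_lintegral_ofReal hD (ae_of_all _ fun z => by positivity)]
    refine lintegral_congr fun z => ?_
    rw [← ofReal_norm, ENNReal.ofReal_rpow_of_nonneg (norm_nonneg _) (by norm_num)]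
    norm_num
  have eV : volume (ball x₀ r) = ENNReal.ofReal (r ^ (N : ℝ) * ω) := by
    rw [Measure.addHaar_ball _ _ hr.le, finrank_euclideanSpace_fin,
      ENNReal.ofReal_mul (by positivity), hω, ENNReal.ofReal_toReal measure_ball_lt_top.ne,
      Real.rpow_natCast]
  set V := r ^ (N : ℝ) * ω with hV
  have hV0 : 0 < V := by positivity
  have eK : K = ENNReal.ofReal K.toReal := (ENNReal.ofReal_toReal hKfin).symm
  set R : ℝ := 2 * r * (K.toReal * (V ^ (1 - b - d) * (T ^ b * D ^ d))) with hR
  have hR0 : 0 ≤ R := by positivity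
  have hint : ∀ w ∈ ball x₀ r, ∫⁻ z in ball x₀ r, ‖u z - u w‖ₑ ≤ ENNReal.ofReal R := by
    intro w hw
    have := aux_int u x₀ w r hu hw t b d hb hd ht hbd1 hs
    rw [eT, eD, eV, ← hK, eK, ENNReal.ofReal_rpow_of_pos hV0, ENNReal.ofReal_rpow_of_nonneg hT0 hb,
      ENNReal.ofReal_rpow_of_nonneg hD0 hd, ← ENNReal.ofReal_mul (by positivity),
      ← ENNReal.ofReal_mul (by positivity), ← ENNReal.ofReal_mul (by positivity),
      ← ENNReal.ofReal_mul (by positivity)] at this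
    exact this
  have hmeas : AEMeasurable (fun z => ‖u z - u x‖ₑ) (volume.restrict (ball x₀ r)) :=
    ((hu.continuousOn.sub continuousOn_const).aemeasurable measurableSet_ball).enorm
  have hsum : ENNReal.ofReal (|u x - u y| * V) ≤ ENNReal.ofReal (R + R) := by
    rw [ENNReal.ofReal_add hR0 hR0, ENNReal.ofReal_mul (abs_nonneg _), ← eV]
    calc ENNReal.ofReal |u x - u y| * volume (ball x₀ r)
        = ∫⁻ z in ball x₀ r, ENNReal.ofReal |u x - u y| := by rw [setLIntegral_const]
      _ ≤ ∫⁻ z in ball x₀ r, (‖u z - u x‖ₑ + ‖u z - u y‖ₑ) := by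
          refine lintegral_mono fun z => ?_
          rw [← ofReal_norm, ← ofReal_norm,
            ← ENNReal.ofReal_add (norm_nonneg _) (norm_nonneg _)]
          apply ENNReal.ofReal_le_ofReal
          rw [Real.norm_eq_abs, Real.norm_eq_abs, abs_sub_comm (u z) (u x)]
          exact abs_sub_le _ _ _
      _ = _ := lintegral_add_left' hmeas _
      _ ≤ _ := add_le_add (hint x hx) (hint y hy)
  rw [ENNReal.ofReal_le_ofReal_iff (by positivity)] at hsum
  have hVp : V ^ (1 - b - d) = V * (r ^ (-(N * (b + d))) * ω ^ (-(b + d))) := by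
    rw [show 1 - b - d = 1 + -(b + d) by ring, Real.rpow_add hV0, Real.rpow_one, hV,
      Real.mul_rpow (by positivity) hω0.le, ← Real.rpow_mul hr.le]
    congr 3; ring_nf
  have hrp : r ^ (1 - N * (b + d)) = r * r ^ (-(N * (b + d))) := by
    rw [sub_eq_add_neg, Real.rpow_add hr, Real.rpow_one]
  have h1 : |u x - u y| ≤ 4 * K.toReal * ω ^ (-(b + d)) * r ^ (1 - N * (b + d)) * T ^ b * D ^ d := by
    refine le_of_mul_le_mul_right (hsum.trans (le_of_eq ?_)) hV0
    rw [hR, hVp, hrp]; ring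
  have h2 : 4 * K.toReal * ω ^ (-(b + d)) * r ^ (1 - N * (b + d)) * T ^ b * D ^ d ≤
      4 * (K.toReal + 1) * ω ^ (-(b + d)) * r ^ (1 - N * (b + d)) * T ^ b * D ^ d := by
    gcongr; linarith
  have h3 := le_abs_self (u x - u y)
  linarith

lemma aux_ball {N : ℕ} (Ω : Set (EuclideanSpace ℝ (Fin N))) (x₀ : EuclideanSpace ℝ (Fin N))
    (r : ℝ) (hΩ : IsOpen Ω) (hx : x₀ ∈ Ω) (hr : 0 < r) (h : r < infDist x₀ (frontier Ω)) : ball x₀ r ⊆ Ω := by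
  intro z hz
  by_contra hzΩ
  have hpre : IsPreconnected (ball x₀ r) := (convex_ball x₀ r).isPreconnected
  have hfr : ∀ w ∈ ball x₀ r, w ∉ frontier Ω := by
    intro w hw hwf
    have := infDist_le_dist_of_mem (x := x₀) hwf
    rw [mem_ball, dist_comm] at hw
    linarith
  have hcl : ∀ w ∈ ball x₀ r, w ∉ Ω → w ∈ (closure Ω)ᶜ := by
    intro w hw hwΩ hwc
    apply hfr w hw
    rw [hΩ.frontier_eq]
    exact ⟨hwc, hwΩ⟩
  obtain ⟨w, _, hw1, hw2⟩ := hpre Ω (closure Ω)ᶜ hΩ isClosed_closure.isOpen_compl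
    (fun w hw => by
      by_cases hwΩ : w ∈ Ω
      · exact Or.inl hwΩ
      · exact Or.inr (hcl w hw hwΩ))
    ⟨x₀, mem_ball_self hr, hx⟩ ⟨z, hz, hcl z hz hzΩ⟩
  exact hw2 (subset_closure hw1)

end helpers


/-- Theorem 3.3 (Harnack type inequality): for `u ∈ W^{1,t}`, `t > N`, with a constant `c`
depending only on `N, t, p, q`,
`sup_{B(x₀,r/2)} u ≤ inf_{B(x₀,r/2)} u + c r^{(ξ/η+N/2)(θ−1)} ‖∇u‖_{L^t(B_r)}-type terms`. -/
theorem stmt6 (N : ℕ) (hN : 2 ≤ N) (t p q s sstar β θ : ℝ)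
    (ht : (N : ℝ) < t) (hp : 1 < p) (hq2 : 2 < q) (hq : q < 2 * p)
    (hs : s = 2 * q * N * (p - 1) / (N * (2 * p - q) + 2 * q * (p - 1)))
    (hs1 : 1 < s) (hsN : s < (N : ℝ))
    (hsstar : sstar = N * s / (N - s))
    (hβ : β = 1 - 2 / q + (1 - s / t) * (sstar / s) * ((2 * p - q) / (p * q)))
    (hθ : θ = (1 / p + Real.sqrt (1 / p ^ 2 + 4 * β)) / 2) :
    ∃ c > (0 : ℝ), ∀ ξ η : ℝ, 0 < ξ → 0 < η →
      ξ / p + η = θ * ξ → β * ξ = θ * η →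
      ∀ (Ω : Set (EuclideanSpace ℝ (Fin N))),
        IsOpen Ω → IsBounded Ω →
        ∀ u : EuclideanSpace ℝ (Fin N) → ℝ,
          ContDiffOn ℝ 1 u Ω →
          IntegrableOn (fun x => ‖gradient u x‖ ^ t) Ω →
          IntegrableOn (fun x => ‖gradient u x‖ ^ 2) Ω →
          ∀ (x₀ : EuclideanSpace ℝ (Fin N)) (r : ℝ),
            x₀ ∈ Ω → 0 < r → r < infDist x₀ (frontier Ω) →
            ∀ x ∈ ball x₀ (r / 2), ∀ y ∈ ball x₀ (r / 2),
              u x ≤ u y +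
                c * r ^ ((ξ / η + N / 2) * (θ - 1)) *
                  (∫ z in ball x₀ r, ‖gradient u z‖ ^ t) ^ (ξ / η * ((p - 1) / (t * p))) *
                  (∫ z in ball x₀ r, ‖gradient u z‖ ^ 2) ^ (ξ * (θ - 1) / (2 * η)) := by

  have hp0 : 0 < p := by linarith
  have hq0 : 0 < q := by linarith
  have hN2 : (2 : ℝ) ≤ N := by exact_mod_cast hN
  have ht0 : 0 < t := by linarith
  have hβ' : β = (1 - 1 / p) * (1 + 2 / N - 2 / t) := by
    have h1 : 0 < 2 * p - q := by linarith
    have h2 : 0 < p - 1 := by linarith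
    have hden : 0 < N * (2 * p - q) + 2 * q * (p - 1) := by positivity
    have hs0 : 0 < s := by linarith
    have hNs : (N : ℝ) - s = N * (N * (2 * p - q)) / (N * (2 * p - q) + 2 * q * (p - 1)) := by
      rw [hs]; field_simp; ring
    have e1 : sstar / s = (N * (2 * p - q) + 2 * q * (p - 1)) / (N * (2 * p - q)) := by
      rw [hsstar, hNs]; field_simp
    have hs2 : s / t = 2 * q * N * (p - 1) / ((N * (2 * p - q) + 2 * q * (p - 1)) * t) := by
      rw [hs]; field_simp
    rw [hβ, e1, hs2]
    field_simp
    ring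
  set P := 1 - 1 / p with hP
  have hP0 : 0 < P := by
    have : 1 / p < 1 := by rw [div_lt_one hp0]; exact hp
    linarith
  have hinv : 2 / t < 2 / (N : ℝ) := by gcongr
  have hβP : P < β := by rw [hβ']; nlinarith
  have hquad : θ * (θ - 1 / p) = β := by
    have hsq := Real.sq_sqrt (show 0 ≤ 1 / p ^ 2 + 4 * β by
      have : 0 < β := by linarith
      positivity)
    have e : Real.sqrt (1 / p ^ 2 + 4 * β) = 2 * θ - 1 / p := by rw [hθ]; ring
    rw [e] at hsq
    have : (1 / p) ^ 2 = 1 / p ^ 2 := by rw [div_pow, one_pow]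
    nlinarith
  have hθ0 : 0 < θ := by rw [hθ]; positivity
  have hθ1 : 0 < θ - 1 := by
    by_contra hcon
    have : θ - 1 / p ≤ P := by rw [hP]; linarith
    have h3 : θ * (θ - 1 / p) ≤ P := by
      nlinarith
    linarith
  have hden : 0 < θ - 1 / p := by
    have : 1 / p < 1 := by rw [hP] at hP0; linarith
    linarith
  set k := 1 / (θ - 1 / p) with hk
  have hk0 : 0 < k := by positivity
  have hkm : k * (θ - 1 + P) = 1 := by
    rw [hk, show θ - 1 + P = θ - 1 / p by rw [hP]; ring]
    exact one_div_mul_cancel hden.ne'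
  set b := k * ((p - 1) / (t * p)) with hb
  set d := k * (θ - 1) / 2 with hd
  have hb' : b = k * P / t := by rw [hb, hP]; field_simp
  have hb0 : 0 ≤ b := by rw [hb']; positivity
  have hd0 : 0 ≤ d := by positivity
  have hs' : b * t + 2 * d = 1 := by
    have e : b * t = k * P := by rw [hb']; field_simp
    rw [e, hd]; linear_combination hkm
  have hexp : 1 - N * (b + d) = (k + N / 2) * (θ - 1) := by
    have hx : (θ - 1) * (1 + (θ - 1) + P) = P * (2 / N - 2 / t) := by
      have : θ * (θ - 1 + P) = P * (1 + 2 / N - 2 / t) := by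
        rw [← hβ', ← hquad, hP]; ring
      linarith
    have hx2 : (N / 2) * ((θ - 1) * (1 + (θ - 1) + P)) = P - N * P / t := by
      rw [hx]; field_simp
    have e1 : N * (b + d) = k * (N * P / t + N / 2 * (θ - 1)) := by
      rw [hb', hd]; ring
    rw [e1]
    have hNP : N * P / t = P - (N / 2) * ((θ - 1) * (1 + (θ - 1) + P)) := by linarith
    rw [hNP]
    linear_combination (-1 + N / 2 * (θ - 1)) * hkm
  have hlt : N * (b + d) < 1 := by
    have : 0 < (k + N / 2) * (θ - 1) := by positivity
    linarith
  obtain ⟨c, hc, H⟩ := aux_main (N := N) (by omega) t b d hb0 hd0 ht0.le hlt hs'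
  refine ⟨c, hc, ?_⟩
  intro ξ η hξ hη h1 h2 Ω hΩ _ u hu hT hD x₀ r hx₀ hr hrd x hx y hy
  have hsub := aux_ball Ω x₀ r hΩ hx₀ hr hrd
  have hkk : ξ / η = k := by
    have : η = ξ * (θ - 1 / p) := by linear_combination h1
    rw [hk, this]; field_simp
  have hhalf : ball x₀ (r / 2) ⊆ ball x₀ r := ball_subset_ball (by linarith)
  have := H u x₀ r hr (hu.mono hsub) (hT.mono_set hsub) (hD.mono_set hsub) x (hhalf hx) y (hhalf hy)
  rw [hexp] at this
  rw [hkk, show ξ * (θ - 1) / (2 * η) = d by rw [hd, ← hkk]; field_simp]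
  exact this
end

section
/- Let Ω ⊂ ℝ³ be open and bounded with smooth boundary, let γ ≥ 0, and let f : Ω → ℝ be continuous and square-integrable with f ≥ 0 on Ω. Let u be a classical solution: u is C⁴ on an open neighborhood of the closure of Ω, u = 0 and ∇u = 0 at every point of ∂Ω, and Δ²u(x) − γΔu(x) = f(x) for every x ∈ Ω. Then there exists a constant c > 0, independent of γ, f and u, such that ( ∫_Ω |∇u|⁶ dx )^{1/6} ≤ c · ( ∫_Ω f u dx )^{1/2}. -/
open MeasureTheory Metric Set Bornology

/-- Partial derivative in the `i`-th coordinate direction. -/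
noncomputable def pd {N : ℕ} (i : Fin N) (u : EuclideanSpace ℝ (Fin N) → ℝ) :
    EuclideanSpace ℝ (Fin N) → ℝ :=
  fun x => fderiv ℝ u x (EuclideanSpace.single i 1)

/-- The Laplacian `Δu = ∑ i ∂²u/∂xᵢ²`. -/
noncomputable def lap {N : ℕ} (u : EuclideanSpace ℝ (Fin N) → ℝ) :
    EuclideanSpace ℝ (Fin N) → ℝ :=
  fun x => ∑ i : Fin N, pd i (pd i u) x

/-- `Ω` has smooth boundary. -/
def HasSmoothBoundary {N : ℕ} (Ω : Set (EuclideanSpace ℝ (Fin N))) : Prop :=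
  ∃ Φ : EuclideanSpace ℝ (Fin N) → ℝ, ContDiff ℝ (⊤ : ℕ∞) Φ ∧
    Ω = Φ ⁻¹' Set.Iio 0 ∧ frontier Ω = Φ ⁻¹' {0} ∧
    ∀ x ∈ frontier Ω, fderiv ℝ Φ x ≠ 0

open Filter Topology

/-- The derivative of the truncation. -/
noncomputable def trH (ε : ℝ) (s : ℝ) : ℝ := min 1 (max (|s| / ε - 1) 0)

/-- A `C¹` truncation vanishing near zero. -/
noncomputable def trE (ε : ℝ) (t : ℝ) : ℝ := ∫ s in (0:ℝ)..t, trH ε s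

lemma trH_cont (ε : ℝ) : Continuous (trH ε) := by
  unfold trH; fun_prop

lemma trH_nonneg (ε s : ℝ) : 0 ≤ trH ε s := by
  unfold trH; positivity

lemma trH_le (ε s : ℝ) : trH ε s ≤ 1 := min_le_left _ _

lemma trH_zero {ε s : ℝ} (hε : 0 < ε) (h : |s| ≤ ε) : trH ε s = 0 := by
  unfold trH
  have : |s| / ε - 1 ≤ 0 := by
    rw [sub_nonpos, div_le_one hε]; exact h
  rw [max_eq_right this]; simp

lemma trH_one {ε s : ℝ} (hε : 0 < ε) (h : 2 * ε ≤ |s|) : trH ε s = 1 := by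
  unfold trH
  have : 1 ≤ |s| / ε - 1 := by
    rw [le_sub_iff_add_le, le_div_iff₀ hε]; linarith
  rw [max_eq_left (by linarith), min_eq_left this]

lemma trE_hasDerivAt (ε t : ℝ) : HasDerivAt (trE ε) (trH ε t) t :=
  (trH_cont ε).integral_hasStrictDerivAt 0 t |>.hasDerivAt

lemma trE_contDiff (ε : ℝ) : ContDiff ℝ 1 (trE ε) := by
  rw [contDiff_one_iff_deriv]
  refine ⟨fun t => (trE_hasDerivAt ε t).differentiableAt, ?_⟩
  have : deriv (trE ε) = trH ε := funext fun t => (trE_hasDerivAt ε t).deriv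
  rw [this]; exact trH_cont ε

lemma trE_zero {ε t : ℝ} (hε : 0 < ε) (h : |t| ≤ ε) : trE ε t = 0 := by
  unfold trE
  rw [intervalIntegral.integral_congr (g := fun _ => (0:ℝ))]
  · simp
  intro s hs
  apply trH_zero hε
  have := Set.abs_sub_left_of_mem_uIcc hs
  simp only [sub_zero] at this
  linarith

lemma trE_abs_le (ε t : ℝ) : |trE ε t| ≤ |t| := by
  unfold trE
  have := intervalIntegral.norm_integral_le_of_norm_le_const (a := (0:ℝ)) (b := t) (C := 1)
    (f := trH ε) (fun s _ => by
      rw [Real.norm_eq_abs, abs_of_nonneg (trH_nonneg _ _)]; exact trH_le _ _)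
  simpa using this

lemma trE_sub_le {ε : ℝ} (hε : 0 < ε) (t : ℝ) : |trE ε t - t| ≤ 2 * ε := by
  have key : ∀ a b : ℝ, |(trE ε a - a) - (trE ε b - b)| ≤ |a - b| := by
    intro a b
    have := Convex.norm_image_sub_le_of_norm_hasDerivWithin_le (f := fun t => trE ε t - t)
      (f' := fun t => trH ε t - 1) (s := univ) (C := 1) (x := b) (y := a)
      (fun x _ => ((trE_hasDerivAt ε x).sub (hasDerivAt_id x)).hasDerivWithinAt)
      (fun x _ => by
        rw [Real.norm_eq_abs, abs_le]
        constructor <;> linarith [trH_nonneg ε x, trH_le ε x]) convex_univ trivial trivial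
    simpa using this
  have key2 : ∀ (s : Set ℝ), Convex ℝ s → (∀ x ∈ s, 2 * ε ≤ |x|) → ∀ a ∈ s, ∀ b ∈ s,
      (trE ε a - a) = (trE ε b - b) := by
    intro s hs h a ha b hb
    have := Convex.norm_image_sub_le_of_norm_hasDerivWithin_le (f := fun t => trE ε t - t)
      (f' := fun t => trH ε t - 1) (s := s) (C := 0) (x := b) (y := a)
      (fun x _ => ((trE_hasDerivAt ε x).sub (hasDerivAt_id x)).hasDerivWithinAt)
      (fun x hx => by
        rw [trH_one hε (h x hx)]; simp) hs hb ha
    simp only [zero_mul, norm_le_zero_iff] at this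
    linarith
  have h0 : trE ε 0 = 0 := trE_zero hε (by simpa using hε.le)
  rcases le_total (|t|) (2 * ε) with h | h
  · have := key t 0
    simp only [h0, sub_zero] at this
    linarith
  · rcases le_total 0 t with ht | ht
    · rw [abs_of_nonneg ht] at h
      rw [key2 (Ici (2 * ε)) (convex_Ici _) (fun x hx => le_trans hx (le_abs_self x)) t h
        (2 * ε) self_mem_Ici]
      have := key (2 * ε) 0
      simp only [h0, sub_zero] at this
      rwa [abs_of_pos (by linarith : 0 < 2 * ε)] at this
    · rw [abs_of_nonpos ht] at h
      rw [key2 (Iic (-(2 * ε))) (convex_Iic _)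
        (fun x hx => le_trans (by have := mem_Iic.1 hx; linarith) (neg_le_abs x)) t
        (by simp only [mem_Iic]; linarith)
        (-(2 * ε)) self_mem_Iic]
      have := key (-(2 * ε)) 0
      simp only [h0, sub_zero] at this
      rwa [abs_neg (2 * ε), abs_of_pos (by linarith : 0 < 2 * ε)] at this

abbrev E3 := EuclideanSpace ℝ (Fin 3)

/-- The truncation of `w`, extended by zero. -/
noncomputable def trW (Ω : Set E3) (ε : ℝ) (w : E3 → ℝ) : E3 → ℝ :=
  Ω.indicator (fun x => trE ε (w x))

lemma trW_local {Ω : Set E3} (hΩ : IsOpen Ω) {ε : ℝ} (hε : 0 < ε) {w : E3 → ℝ}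
    (hw : Continuous w) (hf : ∀ x ∈ frontier Ω, w x = 0) {x : E3} (hx : x ∉ Ω) :
    trW Ω ε w =ᶠ[𝓝 x] fun _ => 0 := by
  by_cases hc : x ∈ closure Ω
  · have hfr : x ∈ frontier Ω := by
      rw [hΩ.frontier_eq]; exact ⟨hc, hx⟩
    have h1 : ∀ᶠ y in 𝓝 x, |w y| < ε := by
      have : ContinuousAt (fun y => |w y|) x := hw.abs.continuousAt
      apply this.eventually_lt continuousAt_const
      simpa [hf x hfr] using hε
    filter_upwards [h1] with y hy
    unfold trW
    by_cases hyΩ : y ∈ Ω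
    · rw [indicator_of_mem hyΩ, trE_zero hε hy.le]
    · rw [indicator_of_notMem hyΩ]
  · have : (closure Ω)ᶜ ∈ 𝓝 x := isClosed_closure.isOpen_compl.mem_nhds hc
    filter_upwards [this] with y hy
    exact indicator_of_notMem (fun h => hy (subset_closure h)) _

lemma trW_local_in {Ω : Set E3} (hΩ : IsOpen Ω) {ε : ℝ} {w : E3 → ℝ}
    {x : E3} (hx : x ∈ Ω) :
    trW Ω ε w =ᶠ[𝓝 x] fun y => trE ε (w y) := by
  filter_upwards [hΩ.mem_nhds hx] with y hy
  exact indicator_of_mem hy _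

lemma trW_contDiff {Ω : Set E3} (hΩ : IsOpen Ω) {ε : ℝ} (hε : 0 < ε) {w : E3 → ℝ}
    (hw : ContDiff ℝ 1 w) (hf : ∀ x ∈ frontier Ω, w x = 0) : ContDiff ℝ 1 (trW Ω ε w) := by
  rw [contDiff_iff_contDiffAt]
  intro x
  by_cases hx : x ∈ Ω
  · exact (((trE_contDiff ε).comp hw).contDiffAt).congr_of_eventuallyEq (trW_local_in hΩ hx)
  · exact contDiffAt_const.congr_of_eventuallyEq (trW_local hΩ hε hw.continuous hf hx)

lemma trW_compact {Ω : Set E3} (hb : IsBounded Ω) {ε : ℝ} {w : E3 → ℝ} :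
    HasCompactSupport (trW Ω ε w) :=
  HasCompactSupport.intro hb.isCompact_closure fun _ hx =>
    indicator_of_notMem (fun h => hx (subset_closure h)) _

lemma trW_fderiv {Ω : Set E3} (hΩ : IsOpen Ω) {ε : ℝ} (hε : 0 < ε) {w : E3 → ℝ}
    (hw : ContDiff ℝ 1 w) (hf : ∀ x ∈ frontier Ω, w x = 0) (x : E3) :
    fderiv ℝ (trW Ω ε w) x = Ω.indicator (fun x => trH ε (w x) • fderiv ℝ w x) x := by
  by_cases hx : x ∈ Ω
  · rw [(trW_local_in hΩ hx).fderiv_eq, indicator_of_mem hx]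
    exact ((trE_hasDerivAt ε (w x)).comp_hasFDerivAt x
      (hw.differentiable one_ne_zero x).hasFDerivAt).fderiv
  · rw [(trW_local hΩ hε hw.continuous hf hx).fderiv_eq, indicator_of_notMem hx]
    simp

lemma integral_fderiv_zero {g : E3 → ℝ} (hg : ContDiff ℝ 1 g) (hc : HasCompactSupport g)
    (v : E3) : ∫ x, fderiv ℝ g x v = 0 := by
  have h := integral_mul_fderiv_eq_neg_fderiv_mul_of_integrable (𝕜 := ℝ) (μ := (volume : Measure E3))
    (f := fun _ => (1:ℝ)) (g := g) (v := v) (by simp)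
    (by
      simp only [one_mul]
      apply Continuous.integrable_of_hasCompactSupport
      · exact (hg.continuous_fderiv one_ne_zero).clm_apply continuous_const
      · exact hc.fderiv_apply ℝ v)
    (by simpa using hg.continuous.integrable_of_hasCompactSupport hc)
    (by intros; fun_prop) (fun x _ => hg.differentiable one_ne_zero x)
  simpa using h

lemma ae_fderiv_zero {w : E3 → ℝ} (hw : ContDiff ℝ 1 w) (hc : HasCompactSupport w) :
    ∀ᵐ x, w x = 0 → fderiv ℝ w x = 0 := by
  obtain ⟨C, hC⟩ := ContDiff.lipschitzWith_of_hasCompactSupport hc hw one_ne_zero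
  have h2 : LipschitzWith (1 * C) (fun x => ‖w x‖) := lipschitzWith_one_norm.comp hC
  filter_upwards [h2.ae_differentiableAt (μ := (volume : Measure E3))] with x hx h0
  have hmin : IsLocalMin (fun x => ‖w x‖) x :=
    Eventually.of_forall fun y => by simp [h0]
  have hd := hx.hasFDerivAt
  rw [hmin.fderiv_eq_zero, hasFDerivAt_iff_isLittleO] at hd
  have : HasFDerivAt w (0 : E3 →L[ℝ] ℝ) x := by
    rw [hasFDerivAt_iff_isLittleO]
    simp only [h0, norm_zero, sub_zero, zero_apply] at hd ⊢
    exact hd.of_norm_left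
  exact this.fderiv

lemma integrableOn_bdd {Ω : Set E3} (hb : IsBounded Ω) {g : E3 → ℝ} (hg : Continuous g) :
    IntegrableOn g Ω :=
  (hg.continuousOn.integrableOn_compact hb.isCompact_closure).mono_set subset_closure

/-- Integration of a derivative over `Ω`. -/
lemma key_int {Ω : Set E3} (hΩ : IsOpen Ω) (hb : IsBounded Ω) {w : E3 → ℝ}
    (hw : ContDiff ℝ 1 w) (hc : HasCompactSupport w) (hf : ∀ x ∈ frontier Ω, w x = 0)
    (i : Fin 3) : ∫ x in Ω, pd i w x = 0 := by
  have hcont : Continuous (pd i w) :=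
    (hw.continuous_fderiv one_ne_zero).clm_apply continuous_const
  have hzero : ∀ n : ℕ, ∫ x in Ω, trH (1 / ((n:ℝ) + 1)) (w x) * pd i w x = 0 := by
    intro n
    have hε : (0:ℝ) < 1 / ((n:ℝ) + 1) := by positivity
    have := integral_fderiv_zero (trW_contDiff hΩ hε hw hf) (trW_compact hb)
      (EuclideanSpace.single i 1)
    rw [← integral_indicator hΩ.measurableSet, ← this]
    congr 1
    ext x
    rw [trW_fderiv hΩ hε hw hf]
    by_cases hx : x ∈ Ω
    · simp [hx, pd]
    · simp [hx]
  have hlim : Tendsto (fun n : ℕ => ∫ x in Ω, trH (1 / ((n:ℝ) + 1)) (w x) * pd i w x) atTop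
      (𝓝 (∫ x in Ω, pd i w x)) := by
    apply tendsto_integral_of_dominated_convergence (fun x => |pd i w x|)
    · intro n
      exact (((trH_cont _).comp hw.continuous).mul hcont).aestronglyMeasurable
    · exact (integrableOn_bdd hb hcont).abs
    · intro n
      refine Eventually.of_forall fun x => ?_
      rw [norm_mul, Real.norm_eq_abs, Real.norm_eq_abs, abs_of_nonneg (trH_nonneg _ _)]
      exact mul_le_of_le_one_left (abs_nonneg _) (trH_le _ _)
    · filter_upwards [ae_restrict_of_ae (ae_fderiv_zero hw hc)] with x hx
      by_cases h0 : w x = 0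
      · simp [pd, hx h0]
      · apply tendsto_const_nhds.congr'
        have ht : Tendsto (fun n : ℕ => 2 * (1 / ((n:ℝ) + 1))) atTop (𝓝 (2 * 0)) :=
          tendsto_one_div_add_atTop_nhds_zero_nat.const_mul 2
        have hpos : 2 * 0 < |w x| := by simpa using h0
        filter_upwards [ht.eventually_lt_const hpos] with n hn
        rw [trH_one (by positivity) hn.le, one_mul]
  simp only [hzero] at hlim
  exact tendsto_nhds_unique hlim tendsto_const_nhds |>.symm ▸ rfl

lemma integrableOn_mul {Ω : Set E3} (hb : IsBounded Ω) {a b : E3 → ℝ} (ha : Continuous a)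
    (hc : Continuous b) : IntegrableOn (fun x => a x * b x) Ω :=
  integrableOn_bdd hb (ha.mul hc)

lemma gns {Ω : Set E3} (hΩ : IsOpen Ω) (hb : IsBounded Ω) :
    ∃ K : ℝ, 0 ≤ K ∧ ∀ w : E3 → ℝ, ContDiff ℝ 1 w → (∀ x ∈ frontier Ω, w x = 0) →
      ∫ x in Ω, |w x| ^ 6 ≤ K * (∫ x in Ω, ‖fderiv ℝ w x‖ ^ 2) ^ 3 := by
  set C : NNReal := eLpNormLESNormFDerivOfEqInnerConst (volume : Measure E3) ((2 : NNReal) : ℝ)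
    with hC
  refine ⟨(C:ℝ) ^ 6, by positivity, fun w hw hf => ?_⟩
  have hfd : Continuous (fderiv ℝ w) := hw.continuous_fderiv one_ne_zero
  have step : ∀ ε : ℝ, 0 < ε → ∫ x in Ω, |trE ε (w x)| ^ 6 ≤
      (C:ℝ) ^ 6 * (∫ x in Ω, ‖fderiv ℝ w x‖ ^ 2) ^ 3 := by
    intro ε hε
    have hW := trW_contDiff hΩ hε hw hf
    have hWc : HasCompactSupport (trW Ω ε w) := trW_compact hb
    have hWd : Continuous (fderiv ℝ (trW Ω ε w)) := hW.continuous_fderiv one_ne_zero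
    have h := eLpNorm_le_eLpNorm_fderiv_of_eq_inner (volume : Measure E3) hW hWc
      (p := 2) (p' := 6) (by norm_num) (by simp) (by simp; norm_num)
    rw [(hW.continuous.memLp_of_hasCompactSupport hWc).eLpNorm_eq_integral_rpow_norm
        (by norm_num) (by simp),
      (hWd.memLp_of_hasCompactSupport (hWc.fderiv ℝ)).eLpNorm_eq_integral_rpow_norm
        (by norm_num) (by simp), ← hC, ← ENNReal.ofReal_coe_nnreal (p := C),
      ← ENNReal.ofReal_mul (by positivity), ENNReal.ofReal_le_ofReal_iff (by positivity)] at h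
    have e6 : ((6 : NNReal) : ENNReal).toReal = ((6:ℕ):ℝ) := by norm_num
    have e2 : ((2 : NNReal) : ENNReal).toReal = ((2:ℕ):ℝ) := by norm_num
    rw [e6, e2] at h
    simp only [Real.rpow_natCast] at h
    have hA : 0 ≤ ∫ x, ‖trW Ω ε w x‖ ^ 6 := by positivity
    have hB : 0 ≤ ∫ x, ‖fderiv ℝ (trW Ω ε w) x‖ ^ 2 := by positivity
    have h6 := pow_le_pow_left₀ (by positivity) h 6
    rw [mul_pow, Real.rpow_inv_natCast_pow hA (by norm_num),
      show (6:ℕ) = 2 * 3 from rfl, pow_mul (_ ^ _ : ℝ) 2 3] at h6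
    rw [Real.rpow_inv_natCast_pow hB (by norm_num)] at h6
    have l : ∫ x in Ω, |trE ε (w x)| ^ 6 = ∫ x, ‖trW Ω ε w x‖ ^ 6 := by
      rw [← integral_indicator hΩ.measurableSet]
      congr 1
      ext x
      by_cases hx : x ∈ Ω <;> simp [hx, trW]
    have r : ∫ x, ‖fderiv ℝ (trW Ω ε w) x‖ ^ 2 ≤ ∫ x in Ω, ‖fderiv ℝ w x‖ ^ 2 := by
      rw [← integral_indicator hΩ.measurableSet]
      apply integral_mono_of_nonneg
      · exact Eventually.of_forall fun x => by positivity
      · exact (integrable_indicator_iff hΩ.measurableSet).2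
          (integrableOn_bdd hb (hfd.norm.pow 2))
      · refine Eventually.of_forall fun x => ?_
        simp only [trW_fderiv hΩ hε hw hf]
        by_cases hx : x ∈ Ω
        · simp only [hx, indicator_of_mem, norm_smul, Real.norm_eq_abs,
            abs_of_nonneg (trH_nonneg _ _)]
          exact pow_le_pow_left₀ (mul_nonneg (trH_nonneg _ _) (norm_nonneg _))
            (mul_le_of_le_one_left (norm_nonneg _) (trH_le _ _)) 2
        · simp [hx]
    rw [l]
    refine h6.trans ?_
    gcongr
  have hlim : Tendsto (fun n : ℕ => ∫ x in Ω, |trE (1 / ((n:ℝ) + 1)) (w x)| ^ 6) atTop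
      (𝓝 (∫ x in Ω, |w x| ^ 6)) := by
    apply tendsto_integral_of_dominated_convergence (fun x => |w x| ^ 6)
    · intro n
      exact (((trE_contDiff _).continuous.comp hw.continuous).abs.pow 6).aestronglyMeasurable
    · exact integrableOn_bdd hb (hw.continuous.abs.pow 6)
    · intro n
      refine Eventually.of_forall fun x => ?_
      rw [Real.norm_eq_abs, abs_of_nonneg (by positivity)]
      exact pow_le_pow_left₀ (abs_nonneg _) (trE_abs_le _ _) 6
    · refine Eventually.of_forall fun x => ?_
      refine (Tendsto.abs ?_).pow 6
      rw [tendsto_iff_norm_sub_tendsto_zero]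
      have ht : Tendsto (fun n : ℕ => 2 * (1 / ((n:ℝ) + 1))) atTop (𝓝 0) := by
        simpa using tendsto_one_div_add_atTop_nhds_zero_nat.const_mul (2:ℝ)
      exact squeeze_zero (fun _ => norm_nonneg _)
        (fun n => trE_sub_le (by positivity) (w x)) ht
  exact le_of_tendsto hlim (Eventually.of_forall fun n => step _ (by positivity))

lemma norm_clm_sq_le (L : E3 →L[ℝ] ℝ) :
    ‖L‖ ^ 2 ≤ ∑ i, (L (EuclideanSpace.single i 1)) ^ 2 := by
  set v : E3 := (InnerProductSpace.toDual ℝ E3).symm L with hv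
  have h1 : ‖L‖ = ‖v‖ := by simp [hv]
  have h2 : ∀ i, L (EuclideanSpace.single i 1) = v i := by
    intro i
    have : L (EuclideanSpace.single i 1) = inner ℝ v (EuclideanSpace.single i 1) := by
      rw [hv, InnerProductSpace.toDual_symm_apply]
    rw [this, EuclideanSpace.inner_single_right]; simp
  rw [h1, EuclideanSpace.norm_sq_eq]
  simp [h2]

lemma pd_contDiff {n : ℕ} {u : E3 → ℝ} (hu : ContDiff ℝ (n + 1 : ℕ) u) (i : Fin 3) :
    ContDiff ℝ n (pd i u) := by
  unfold pd
  exact (hu.fderiv_right (m := n) (by norm_cast)).clm_apply contDiff_const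

lemma pd_compact {u : E3 → ℝ} (hu : HasCompactSupport u) (i : Fin 3) :
    HasCompactSupport (pd i u) := hu.fderiv_apply ℝ _

lemma pd_comm {u : E3 → ℝ} (hu : ContDiff ℝ 2 u) (i j : Fin 3) :
    pd i (pd j u) = pd j (pd i u) := by
  have hd : Differentiable ℝ (fderiv ℝ u) :=
    (hu.fderiv_right (m := 1) (by norm_num)).differentiable one_ne_zero
  have h : ∀ (i j : Fin 3) x, pd i (pd j u) x =
      fderiv ℝ (fderiv ℝ u) x (EuclideanSpace.single i 1) (EuclideanSpace.single j 1) := by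
    intro i j x
    change fderiv ℝ (fun y => fderiv ℝ u y (EuclideanSpace.single j 1)) x _ = _
    rw [fderiv_clm_apply (hd x) (by fun_prop)]
    simp
  ext x
  rw [h, h]
  exact (hu.contDiffAt.isSymmSndFDerivAt (by simp)) _ _

/-- Integration by parts. -/
lemma ibp {Ω : Set E3} (hΩ : IsOpen Ω) (hb : IsBounded Ω) {a b : E3 → ℝ}
    (ha : ContDiff ℝ 1 a) (hc : HasCompactSupport a) (hf : ∀ x ∈ frontier Ω, a x = 0)
    (hb1 : ContDiff ℝ 1 b)
    (i : Fin 3) : ∫ x in Ω, pd i a x * b x = - ∫ x in Ω, a x * pd i b x := by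
  have h := key_int hΩ hb (w := fun x => a x * b x) (ha.mul hb1) hc.mul_right
    (fun x hx => by simp [hf x hx]) i
  have e : ∀ x, pd i (fun x => a x * b x) x = pd i a x * b x + a x * pd i b x := by
    intro x
    unfold pd
    rw [fderiv_fun_mul (ha.differentiable one_ne_zero x) (hb1.differentiable one_ne_zero x)]
    simp; ring
  have c1 : Continuous (pd i a) := (pd_contDiff (n := 0) (by simpa using ha) i).continuous
  have c2 : Continuous (pd i b) := (pd_contDiff (n := 0) (by simpa using hb1) i).continuous
  simp only [e] at h
  rw [integral_add (integrableOn_mul hb c1 hb1.continuous)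
    (integrableOn_mul hb ha.continuous c2)] at h
  linarith

lemma hess_eq {Ω : Set E3} (hΩ : IsOpen Ω) (hb : IsBounded Ω) {u : E3 → ℝ}
    (hu : ContDiff ℝ 4 u) (hc : HasCompactSupport u)
    (h1 : ∀ x ∈ frontier Ω, fderiv ℝ u x = 0) :
    ∑ j, ∑ i, ∫ x in Ω, (pd i (pd j u) x) ^ 2 = ∫ x in Ω, (lap u x) ^ 2 := by
  have p1 : ∀ i, ContDiff ℝ 3 (pd i u) := fun i => pd_contDiff (n := 3) hu i
  have p2 : ∀ i j, ContDiff ℝ 2 (pd i (pd j u)) := fun i j => pd_contDiff (n := 2) (p1 j) i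
  have key : ∀ i j, ∫ x in Ω, (pd i (pd j u) x) ^ 2 =
      ∫ x in Ω, pd j (pd j u) x * pd i (pd i u) x := by
    intro i j
    simp only [sq]
    have z : ∀ x ∈ frontier Ω, pd j u x = 0 := fun x hx => by simp [pd, h1 x hx]
    rw [ibp hΩ hb ((p1 j).of_le (by norm_num)) (pd_compact hc j) z
        ((p2 i j).of_le (by norm_num)) i,
      ibp hΩ hb ((p1 j).of_le (by norm_num)) (pd_compact hc j) z
        ((p2 i i).of_le (by norm_num)) j,
      pd_comm ((p1 i).of_le (by norm_num)) j i, pd_comm (hu.of_le (by norm_num)) j i]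
  have ci : ∀ i j, IntegrableOn (fun x => pd j (pd j u) x * pd i (pd i u) x) Ω := fun i j =>
    integrableOn_bdd hb ((p2 j j).continuous.mul (p2 i i).continuous)
  have : ∀ x, (lap u x) ^ 2 = ∑ j, ∑ i, pd j (pd j u) x * pd i (pd i u) x := by
    intro x; rw [sq, lap, Finset.sum_mul_sum]
  simp only [this, key]
  rw [integral_finsetSum _ (fun j _ => integrable_finsetSum _ fun i _ => ci i j)]
  refine Finset.sum_congr rfl fun j _ => ?_
  rw [integral_finsetSum _ (fun i _ => ci i j)]

lemma energy {Ω : Set E3} (hΩ : IsOpen Ω) (hb : IsBounded Ω) {u : E3 → ℝ}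
    (hu : ContDiff ℝ 4 u) (hc : HasCompactSupport u)
    (h0 : ∀ x ∈ frontier Ω, u x = 0) (h1 : ∀ x ∈ frontier Ω, fderiv ℝ u x = 0)
    {γ : ℝ} (hγ : 0 ≤ γ) :
    ∫ x in Ω, (lap u x) ^ 2 ≤ ∫ x in Ω, (lap (lap u) x - γ * lap u x) * u x := by
  have p1 : ∀ i, ContDiff ℝ 3 (pd i u) := fun i => pd_contDiff (n := 3) hu i
  have p2 : ∀ i j, ContDiff ℝ 2 (pd i (pd j u)) := fun i j => pd_contDiff (n := 2) (p1 j) i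
  have hL : ContDiff ℝ 2 (lap u) := by
    unfold lap; exact ContDiff.sum fun i _ => p2 i i
  have q1 : ∀ i, ContDiff ℝ 1 (pd i (lap u)) := fun i => pd_contDiff (n := 1) hL i
  have q2 : ∀ i, Continuous (pd i (pd i (lap u))) := fun i =>
    (pd_contDiff (n := 0) (by simpa using q1 i) i).continuous
  have z : ∀ j, ∀ x ∈ frontier Ω, pd j u x = 0 := fun j x hx => by simp [pd, h1 x hx]
  have hu1 : ContDiff ℝ 1 u := hu.of_le (by norm_num)
  have A : ∀ i, ∫ x in Ω, u x * pd i (pd i (lap u)) x =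
      ∫ x in Ω, pd i (pd i u) x * lap u x := by
    intro i
    have a1 := ibp hΩ hb hu1 hc h0 (q1 i) i
    have a2 := ibp hΩ hb ((p1 i).of_le (by norm_num)) (pd_compact hc i) (z i)
      (hL.of_le (by norm_num)) i
    linarith
  have B : ∀ i, ∫ x in Ω, u x * pd i (pd i u) x = - ∫ x in Ω, pd i u x * pd i u x := by
    intro i
    have a1 := ibp hΩ hb hu1 hc h0 ((p1 i).of_le (by norm_num)) i
    linarith
  have e1 : ∫ x in Ω, lap (lap u) x * u x = ∫ x in Ω, (lap u x) ^ 2 := by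
    have l : ∀ x, lap (lap u) x * u x = ∑ i, u x * pd i (pd i (lap u)) x := by
      intro x; conv_lhs => rw [lap, Finset.sum_mul]
      exact Finset.sum_congr rfl fun i _ => mul_comm _ _
    have r : ∀ x, (lap u x) ^ 2 = ∑ i, pd i (pd i u) x * lap u x := by
      intro x; rw [sq, ← Finset.sum_mul]; rfl
    simp only [l, r]
    rw [integral_finsetSum _ (fun i _ => integrableOn_mul hb hu.continuous (q2 i)),
      integral_finsetSum _ (fun i _ =>
        integrableOn_mul hb (p2 i i).continuous hL.continuous)]
    exact Finset.sum_congr rfl fun i _ => A i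
  have e2 : ∫ x in Ω, lap u x * u x ≤ 0 := by
    have l : ∀ x, lap u x * u x = ∑ i, u x * pd i (pd i u) x := by
      intro x; rw [lap, Finset.sum_mul]
      exact Finset.sum_congr rfl fun i _ => mul_comm _ _
    simp only [l]
    rw [integral_finsetSum _ (fun i _ =>
      integrableOn_mul hb hu.continuous (p2 i i).continuous)]
    refine Finset.sum_nonpos fun i _ => ?_
    rw [B i, neg_nonpos]
    exact integral_nonneg fun x => mul_self_nonneg _
  have cL : Continuous (lap (lap u)) := by
    unfold lap at q2 ⊢; exact continuous_finsetSum _ fun i _ => q2 i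
  have s : ∫ x in Ω, (lap (lap u) x - γ * lap u x) * u x =
      (∫ x in Ω, lap (lap u) x * u x) - γ * ∫ x in Ω, lap u x * u x := by
    rw [← integral_const_mul, ← integral_sub
      (integrableOn_mul hb cL hu.continuous)
      ((integrableOn_mul hb hL.continuous hu.continuous).const_mul γ)]
    congr 1; ext x; ring
  rw [s, e1]
  have := mul_nonpos_of_nonneg_of_nonpos hγ e2
  linarith

lemma cutoff {Ω U : Set E3} (hb : IsBounded Ω) (hU : IsOpen U) (hsub : closure Ω ⊆ U)
    {u : E3 → ℝ} (hu : ContDiffOn ℝ 4 u U) :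
    ∃ v : E3 → ℝ, ContDiff ℝ 4 v ∧ HasCompactSupport v ∧
      ∀ x ∈ closure Ω, v =ᶠ[𝓝 x] u := by
  obtain ⟨L, hL, h1, h2⟩ := exists_compact_between hb.isCompact_closure hU hsub
  obtain ⟨χ, hχ1, hχ0, -⟩ := exists_contMDiffMap_one_nhds_of_subset_interior
    (n := 4) (modelWithCornersSelf ℝ E3) (isClosed_closure (s := Ω)) h1
  have hχ : ContDiff ℝ 4 χ := χ.contMDiff.contDiff
  refine ⟨fun x => χ x * u x, ?_, ?_, ?_⟩
  · rw [contDiff_iff_contDiffAt]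
    intro x
    by_cases hx : x ∈ U
    · exact hχ.contDiffAt.mul (hu.contDiffAt (hU.mem_nhds hx))
    · have hxL : x ∉ L := fun h => hx (h2 h)
      refine (contDiffAt_const (c := (0:ℝ))).congr_of_eventuallyEq ?_
      filter_upwards [hL.isClosed.isOpen_compl.mem_nhds hxL] with y hy
      simp [hχ0 y hy]
  · exact HasCompactSupport.intro hL fun x hx => by simp [hχ0 x hx]
  · intro x hx
    have := (mem_nhdsSet_iff_forall.1 hχ1) x hx
    filter_upwards [this] with y hy
    have : χ y = 1 := hy
    simp [this]

lemma pd_congr {u v : E3 → ℝ} {x : E3} (h : u =ᶠ[𝓝 x] v) (i : Fin 3) :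
    pd i u =ᶠ[𝓝 x] pd i v := by
  filter_upwards [h.fderiv (𝕜 := ℝ)] with y hy
  simp [pd, hy]

lemma lap_congr {u v : E3 → ℝ} {x : E3} (h : u =ᶠ[𝓝 x] v) :
    lap u =ᶠ[𝓝 x] lap v := by
  have := fun i => pd_congr (pd_congr h i) i
  filter_upwards [eventually_all.2 this] with y hy
  simp [lap, hy]

lemma norm_gradient (u : E3 → ℝ) (x : E3) : ‖gradient u x‖ = ‖fderiv ℝ u x‖ := by
  simp [gradient]

/-- Lemma 4.2 for `N = 3`, `t = 6`: the `L⁶` norm of `∇u` is bounded by `c (∫ fu)^{1/2}`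
with a constant `c` independent of `γ`, `f`, and `u`. -/
theorem stmt9 (Ω : Set (EuclideanSpace ℝ (Fin 3)))
    (hΩ : IsOpen Ω) (hΩb : IsBounded Ω) (hsm : HasSmoothBoundary Ω) :
    ∃ c > (0 : ℝ), ∀ γ : ℝ, 0 ≤ γ →
      ∀ f u : EuclideanSpace ℝ (Fin 3) → ℝ,
        ContinuousOn f Ω → IntegrableOn (fun x => f x ^ 2) Ω →
        (∀ x ∈ Ω, 0 ≤ f x) →
        ∀ U : Set (EuclideanSpace ℝ (Fin 3)),
          IsOpen U → closure Ω ⊆ U → ContDiffOn ℝ 4 u U →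
          (∀ x ∈ frontier Ω, u x = 0) →
          (∀ x ∈ frontier Ω, gradient u x = 0) →
          (∀ x ∈ Ω, lap (lap u) x - γ * lap u x = f x) →
          (∫ x in Ω, ‖gradient u x‖ ^ 6) ^ ((1 : ℝ) / 6) ≤
            c * (∫ x in Ω, f x * u x) ^ ((1 : ℝ) / 2) := by
  obtain ⟨K, hK, hG⟩ := gns hΩ hΩb
  refine ⟨(27 * K + 1) ^ ((1:ℝ) / 6), by positivity, ?_⟩
  intro γ hγ f u _ _ _ U hU hsub hu h0 h1 heq
  obtain ⟨v, hv, hvc, hvu⟩ := cutoff hΩb hU hsub hu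
  have fr : ∀ x ∈ frontier Ω, x ∈ closure Ω := fun x hx => frontier_subset_closure hx
  have hv0 : ∀ x ∈ frontier Ω, v x = 0 := fun x hx => by
    rw [(hvu x (fr x hx)).eq_of_nhds, h0 x hx]
  have hv1 : ∀ x ∈ frontier Ω, fderiv ℝ v x = 0 := fun x hx => by
    rw [(hvu x (fr x hx)).fderiv_eq, ← norm_eq_zero, ← norm_gradient, h1 x hx, norm_zero]
  have eR : ∫ x in Ω, f x * u x = ∫ x in Ω, (lap (lap v) x - γ * lap v x) * v x := by
    refine setIntegral_congr_fun hΩ.measurableSet fun x hx => ?_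
    have e := hvu x (subset_closure hx)
    rw [← heq x hx, e.eq_of_nhds, (lap_congr e).eq_of_nhds, (lap_congr (lap_congr e)).eq_of_nhds]
  have eL : ∫ x in Ω, ‖gradient u x‖ ^ 6 = ∫ x in Ω, ‖fderiv ℝ v x‖ ^ 6 := by
    refine setIntegral_congr_fun hΩ.measurableSet fun x hx => ?_
    simp only [norm_gradient]
    rw [(hvu x (subset_closure hx)).fderiv_eq]
  rw [eR, eL]
  have hE := energy hΩ hΩb hv hvc hv0 hv1 hγ
  have hH := hess_eq hΩ hΩb hv hvc hv1
  set I := ∫ x in Ω, (lap (lap v) x - γ * lap v x) * v x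
  set J := ∫ x in Ω, (lap v x) ^ 2 with hJ
  have hJ0 : 0 ≤ J := integral_nonneg fun x => sq_nonneg _
  have p1 : ∀ i, ContDiff ℝ 3 (pd i v) := fun i => pd_contDiff (n := 3) hv i
  have p2 : ∀ i j, ContDiff ℝ 2 (pd i (pd j v)) := fun i j => pd_contDiff (n := 2) (p1 j) i
  have hD : ∀ j, ∫ x in Ω, ‖fderiv ℝ (pd j v) x‖ ^ 2 ≤ J := by
    intro j
    calc ∫ x in Ω, ‖fderiv ℝ (pd j v) x‖ ^ 2
        ≤ ∫ x in Ω, ∑ i, (pd i (pd j v) x) ^ 2 := by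
          apply integral_mono
          · exact integrableOn_bdd hΩb (((p1 j).continuous_fderiv (by norm_num)).norm.pow 2)
          · exact integrableOn_bdd hΩb
              (continuous_finsetSum _ fun i _ => (p2 i j).continuous.pow 2)
          · intro x; exact norm_clm_sq_le _
      _ = ∑ i, ∫ x in Ω, (pd i (pd j v) x) ^ 2 :=
          integral_finsetSum _ fun i _ => integrableOn_bdd hΩb ((p2 i j).continuous.pow 2)
      _ ≤ J := by
          rw [← hH]
          exact Finset.single_le_sum
            (f := fun j => ∑ i, ∫ x in Ω, (pd i (pd j v) x) ^ 2)
            (fun j _ => Finset.sum_nonneg fun i _ => integral_nonneg fun x => sq_nonneg _)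
            (Finset.mem_univ j)
  have hS : ∀ j, ∫ x in Ω, |pd j v x| ^ 6 ≤ K * J ^ 3 := by
    intro j
    refine (hG (pd j v) ((p1 j).of_le (by norm_num)) fun x hx => by simp [pd, hv1 x hx]).trans ?_
    have := hD j
    have h' : 0 ≤ ∫ x in Ω, ‖fderiv ℝ (pd j v) x‖ ^ 2 := integral_nonneg fun x => sq_nonneg _
    gcongr
  have hT : ∫ x in Ω, ‖fderiv ℝ v x‖ ^ 6 ≤ 27 * K * J ^ 3 := by
    calc ∫ x in Ω, ‖fderiv ℝ v x‖ ^ 6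
        ≤ ∫ x in Ω, ∑ j, 9 * |pd j v x| ^ 6 := by
          apply integral_mono
          · exact integrableOn_bdd hΩb ((hv.continuous_fderiv (by norm_num)).norm.pow 6)
          · exact integrableOn_bdd hΩb
              (continuous_finsetSum _ fun i _ =>
                continuous_const.mul ((p1 i).continuous.abs.pow 6))
          · intro x
            have a := norm_clm_sq_le (fderiv ℝ v x)
            have b := pow_le_pow_left₀ (by positivity) a 3
            have c : ∀ a b c : ℝ, 0 ≤ a → 0 ≤ b → 0 ≤ c →
                (a + b + c) ^ 3 ≤ 9 * a ^ 3 + 9 * b ^ 3 + 9 * c ^ 3 := by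
              intro a b c ha hb hc
              nlinarith [mul_nonneg ha (sq_nonneg (a - b)), mul_nonneg ha (sq_nonneg (a - c)),
                mul_nonneg hb (sq_nonneg (a - b)), mul_nonneg hb (sq_nonneg (b - c)),
                mul_nonneg hc (sq_nonneg (a - c)), mul_nonneg hc (sq_nonneg (b - c)),
                mul_nonneg ha (sq_nonneg (b - c)), mul_nonneg hb (sq_nonneg (a - c)),
                mul_nonneg hc (sq_nonneg (a - b))]
            have e : ∀ j, |pd j v x| ^ 6 = ((pd j v x) ^ 2) ^ 3 := by
              intro j; rw [← sq_abs (pd j v x)]; ring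
            simp only [Fin.sum_univ_three, e] at b ⊢
            calc ‖fderiv ℝ v x‖ ^ 6 = (‖fderiv ℝ v x‖ ^ 2) ^ 3 := by ring
              _ ≤ _ := b
              _ ≤ _ := c _ _ _ (sq_nonneg _) (sq_nonneg _) (sq_nonneg _)
      _ = ∑ j, ∫ x in Ω, 9 * |pd j v x| ^ 6 :=
          integral_finsetSum _ fun i _ => integrableOn_bdd hΩb
            (continuous_const.mul ((p1 i).continuous.abs.pow 6))
      _ ≤ ∑ j : Fin 3, 9 * (K * J ^ 3) := by
          refine Finset.sum_le_sum fun j _ => ?_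
          rw [integral_const_mul]
          exact mul_le_mul_of_nonneg_left (hS j) (by norm_num)
      _ = 27 * K * J ^ 3 := by simp; ring
  have hI0 : 0 ≤ I := hJ0.trans hE
  have hfin : ∫ x in Ω, ‖fderiv ℝ v x‖ ^ 6 ≤ (27 * K + 1) * I ^ 3 := by
    have : J ^ 3 ≤ I ^ 3 := pow_le_pow_left₀ hJ0 hE 3
    have h3 : 0 ≤ I ^ 3 := by positivity
    calc _ ≤ 27 * K * J ^ 3 := hT
      _ ≤ 27 * K * I ^ 3 := by gcongr
      _ ≤ _ := by linarith
  calc (∫ x in Ω, ‖fderiv ℝ v x‖ ^ 6) ^ ((1:ℝ) / 6)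
      ≤ ((27 * K + 1) * I ^ 3) ^ ((1:ℝ) / 6) :=
        Real.rpow_le_rpow (integral_nonneg fun x => by positivity) hfin (by norm_num)
    _ = (27 * K + 1) ^ ((1:ℝ) / 6) * I ^ ((1:ℝ) / 2) := by
        rw [Real.mul_rpow (by positivity) (by positivity), ← Real.rpow_natCast I 3,
          ← Real.rpow_mul hI0]
        norm_num
end
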